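/- arXiv:2206.14909 — 4 statements merged into one kernel-verified Lean document; each statement's English description precedes it below -/
import Mathlib

section
/- Every bridgeless 3-regular graph with oddness 2 on n vertices admits a straight-line RAC drawing of O(n²) area. -/
open scoped Classical

noncomputable section

/-- A point of the Euclidean plane. -/
abbrev Pt : Type := ℝ × ℝ

/-- The segments with endpoints `a, b` and `c, d` are orthogonal:
their direction vectors have zero inner product. -/
def SegOrth (a b c d : Pt) : Prop :=
  (b.1 - a.1) * (d.1 - c.1) + (b.2 - a.2) * (d.2 - c.2) = 0

/-- The degree of a vertex in a simple graph. -/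
def vdeg {V : Type*} (G : SimpleGraph V) (v : V) : ℕ := (G.neighborSet v).ncard

/-- `M` is a matching in `G`: a set of edges of `G` that are pairwise non-adjacent. -/
def IsMatchingOn {V : Type*} (G : SimpleGraph V) (M : Set (Sym2 V)) : Prop :=
  M ⊆ G.edgeSet ∧ ∀ e ∈ M, ∀ f ∈ M, e ≠ f → ∀ v : V, v ∈ e → v ∉ f

/-- `G` is `k`-edge-colorable: its edge set is partitioned into `k` matchings. -/
def EdgeColorable {V : Type*} (G : SimpleGraph V) (k : ℕ) : Prop :=
  ∃ M : Fin k → Set (Sym2 V),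
    (∀ i, IsMatchingOn G (M i)) ∧
    (∀ i j, i ≠ j → Disjoint (M i) (M j)) ∧
    (⋃ i, M i) = G.edgeSet

/-- `p` is a straight-line RAC drawing of `G`: vertices are at pairwise distinct points,
each edge is the closed segment between its endpoints, no edge passes through another
vertex, edges sharing an endpoint meet only there, and any two edges with no common
endpoint that intersect do so orthogonally. -/
structure IsRACDrawing {V : Type*} (G : SimpleGraph V) (p : V → Pt) : Prop where
  inj : Function.Injective p
  vertex_off : ∀ u v w : V, G.Adj u v → w ≠ u → w ≠ v →
    p w ∉ segment ℝ (p u) (p v)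
  shared : ∀ u v w : V, G.Adj u v → G.Adj u w → v ≠ w →
    segment ℝ (p u) (p v) ∩ segment ℝ (p u) (p w) ⊆ {p u}
  rac : ∀ u v u' v' : V, G.Adj u v → G.Adj u' v' →
    u ≠ u' → u ≠ v' → v ≠ u' → v ≠ v' →
    (segment ℝ (p u) (p v) ∩ segment ℝ (p u') (p v')).Nonempty →
    SegOrth (p u) (p v) (p u') (p v')

/-- All points of `P` are integer grid points lying in an axis-aligned square
of side length `side`. -/
def InGridSquare (side : ℝ) (P : Set Pt) : Prop :=
  (∀ q ∈ P, ∃ a b : ℤ, q = ((a : ℝ), (b : ℝ))) ∧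
  ∃ x0 y0 : ℝ, ∀ q ∈ P, x0 ≤ q.1 ∧ q.1 ≤ x0 + side ∧ y0 ≤ q.2 ∧ q.2 ≤ y0 + side

/-- The list of consecutive segments (as pairs of endpoints) of a polyline given
by its list of points. -/
def polySegs (l : List Pt) : List (Pt × Pt) := l.zip l.tail

/-- The set of plane points covered by a polyline given by its list of points. -/
def polySet (l : List Pt) : Set Pt := ⋃ s ∈ polySegs l, segment ℝ s.1 s.2

/-- `p, poly` is a `k`-bend RAC drawing of `G`: each edge `e` is drawn as the polyline
through the list of points `poly e` (at most `k + 1` segments, i.e. at most `k + 2`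
points) joining the two endpoints of `e`; no edge passes through another vertex; edges
sharing an endpoint meet only at that endpoint; any two distinct edges intersect in
finitely many points; and wherever segments of two distinct edges meet (other than at
the point of a common endvertex) the two segments are orthogonal. -/
structure IsBendRACDrawing {V : Type*} (k : ℕ) (G : SimpleGraph V)
    (p : V → Pt) (poly : Sym2 V → List Pt) : Prop where
  inj : Function.Injective p
  ends : ∀ e ∈ G.edgeSet, ∃ u v : V, e = s(u, v) ∧
    (poly e).head? = some (p u) ∧ (poly e).getLast? = some (p v)
  nsegs : ∀ e ∈ G.edgeSet, 2 ≤ (poly e).length ∧ (poly e).length ≤ k + 2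
  vertex_off : ∀ e ∈ G.edgeSet, ∀ w : V, w ∉ e → p w ∉ polySet (poly e)
  shared : ∀ e ∈ G.edgeSet, ∀ e' ∈ G.edgeSet, e ≠ e' → ∀ w : V, w ∈ e → w ∈ e' →
    polySet (poly e) ∩ polySet (poly e') ⊆ {p w}
  fin_inter : ∀ e ∈ G.edgeSet, ∀ e' ∈ G.edgeSet, e ≠ e' →
    (polySet (poly e) ∩ polySet (poly e')).Finite
  rac : ∀ e ∈ G.edgeSet, ∀ e' ∈ G.edgeSet, e ≠ e' →
    ∀ s ∈ polySegs (poly e), ∀ s' ∈ polySegs (poly e'),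
    ∀ x : Pt, x ∈ segment ℝ s.1 s.2 → x ∈ segment ℝ s'.1 s'.2 →
    (∀ w : V, w ∈ e → w ∈ e' → x ≠ p w) →
    SegOrth s.1 s.2 s'.1 s'.2

/-- All vertex points and bend points of a polyline drawing. -/
def drawingPoints {V : Type*} (G : SimpleGraph V) (p : V → Pt)
    (poly : Sym2 V → List Pt) : Set Pt :=
  Set.range p ∪ {q | ∃ e ∈ G.edgeSet, q ∈ poly e}

/-- `F` is (the edge set of) a 2-factor of `G`: a spanning subgraph in which every
vertex has degree exactly 2. -/
def Is2Factor {V : Type*} (G : SimpleGraph V) (F : Set (Sym2 V)) : Prop :=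
  F ⊆ G.edgeSet ∧ ∀ v : V, {e ∈ F | v ∈ e}.ncard = 2

/-- The connected components of the (2-regular) spanning subgraph with edge set `F`
that are odd cycles, i.e. have an odd number of vertices. -/
def oddComps {V : Type*} (F : Set (Sym2 V)) :
    Set ((SimpleGraph.fromEdgeSet F).ConnectedComponent) :=
  {C | Odd C.supp.ncard}

/-- `G` has oddness `k`: the minimum over all 2-factors of the number of odd-cycle
components equals `k` (in particular a 2-factor exists). -/
def HasOddness {V : Type*} (G : SimpleGraph V) (k : ℕ) : Prop :=
  (∃ F, Is2Factor G F ∧ (oddComps F).ncard = k) ∧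
  (∀ F, Is2Factor G F → k ≤ (oddComps F).ncard)

/-- `G` has no cut-edge. -/
def Bridgeless {V : Type*} (G : SimpleGraph V) : Prop := ∀ e, ¬ G.IsBridge e


/-! ### Geometry of segments -/

lemma seg_param {a b z : Pt} (h : z ∈ segment ℝ a b) :
    ∃ t : ℝ, 0 ≤ t ∧ t ≤ 1 ∧ z.1 = a.1 + t * (b.1 - a.1) ∧ z.2 = a.2 + t * (b.2 - a.2) := by
  rw [segment_eq_image'] at h
  obtain ⟨t, ⟨h0, h1⟩, rfl⟩ := h
  exact ⟨t, h0, h1, by simp, by simp⟩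

lemma seg_of_param {a b z : Pt} {t : ℝ} (h0 : 0 ≤ t) (h1 : t ≤ 1)
    (hx : z.1 = a.1 + t * (b.1 - a.1)) (hy : z.2 = a.2 + t * (b.2 - a.2)) :
    z ∈ segment ℝ a b := by
  rw [segment_eq_image']
  exact ⟨t, ⟨h0, h1⟩, by ext <;> simp [hx, hy]⟩

lemma shared_of_off {p a b : Pt} (h1 : a ∉ segment ℝ p b) (h2 : b ∉ segment ℝ p a) :
    segment ℝ p a ∩ segment ℝ p b ⊆ {p} := by
  rintro z ⟨ha, hb⟩
  obtain ⟨s, s0, s1, sx, sy⟩ := seg_param ha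
  obtain ⟨t, t0, t1, tx, ty⟩ := seg_param hb
  rcases s0.eq_or_lt with rfl | s0
  · exact Prod.ext (by simpa using sx) (by simpa using sy)
  rcases t0.eq_or_lt with rfl | t0
  · exact Prod.ext (by simpa using tx) (by simpa using ty)
  exfalso
  have ex : s * (a.1 - p.1) = t * (b.1 - p.1) := by linarith
  have ey : s * (a.2 - p.2) = t * (b.2 - p.2) := by linarith
  rcases le_total s t with hst | hst
  · refine h2 (seg_of_param (t := s / t) (by positivity) (by rw [div_le_one t0]; exact hst) ?_ ?_)
    · field_simp; linarith
    · field_simp; linarith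
  · refine h1 (seg_of_param (t := t / s) (by positivity) (by rw [div_le_one s0]; exact hst) ?_ ?_)
    · field_simp; linarith
    · field_simp; linarith

/-- Coordinates in the plane, indexed by `Bool` (`true` is horizontal). -/
def crd (i : Bool) (z : Pt) : ℝ := if i then z.1 else z.2

lemma crd_ext {z w : Pt} (i : Bool) (h : crd i z = crd i w) (h' : crd (!i) z = crd (!i) w) :
    z = w := by
  cases i <;> simp [crd] at h h' <;> exact Prod.ext (by assumption) (by assumption)

lemma seg_crd {a b z : Pt} (h : z ∈ segment ℝ a b) :
    ∃ t : ℝ, 0 ≤ t ∧ t ≤ 1 ∧ ∀ i, crd i z = crd i a + t * (crd i b - crd i a) := by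
  obtain ⟨t, h0, h1, hx, hy⟩ := seg_param h
  exact ⟨t, h0, h1, by rintro (_ | _) <;> simp [crd, hx, hy]⟩

lemma seg_crd_ge {a b z : Pt} (h : z ∈ segment ℝ a b) (i : Bool) {m : ℝ}
    (ha : m ≤ crd i a) (hb : m ≤ crd i b) : m ≤ crd i z := by
  obtain ⟨t, h0, h1, hz⟩ := seg_crd h
  rw [hz]; nlinarith

lemma seg_crd_le {a b z : Pt} (h : z ∈ segment ℝ a b) (i : Bool) {m : ℝ}
    (ha : crd i a ≤ m) (hb : crd i b ≤ m) : crd i z ≤ m := by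
  obtain ⟨t, h0, h1, hz⟩ := seg_crd h
  rw [hz]; nlinarith

/-- a point of a segment with the same coordinate as an endpoint, when the coordinate is not
constant along the segment, is that endpoint -/
lemma seg_crd_end {a b z : Pt} (h : z ∈ segment ℝ a b) (i : Bool)
    (hne : crd i a ≠ crd i b) (hz : crd i z = crd i a) : z = a := by
  obtain ⟨t, h0, h1, hz'⟩ := seg_crd h
  have h2 : t * (crd i b - crd i a) = 0 := by have := hz' i; linarith
  rcases mul_eq_zero.1 h2 with rfl | h2
  · exact crd_ext i (by simp [hz']) (by simp [hz'])
  · exact absurd (by linarith) hne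

lemma seg_crd_end' {a b z : Pt} (h : z ∈ segment ℝ a b) (i : Bool)
    (hne : crd i a ≠ crd i b) (hz : crd i z = crd i b) : z = b := by
  rw [segment_symm] at h
  exact seg_crd_end h i hne.symm hz

/-- the point of a segment beyond the endpoint in coordinate `i` is the endpoint -/
lemma seg_crd_far {a b z : Pt} (h : z ∈ segment ℝ a b) (i : Bool)
    (hne : crd i a < crd i b) (hz : crd i b ≤ crd i z) : z = b :=
  seg_crd_end' h i hne.ne (le_antisymm (seg_crd_le h i hne.le le_rfl) hz)

lemma seg_crd_far' {a b z : Pt} (h : z ∈ segment ℝ a b) (i : Bool)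
    (hne : crd i b < crd i a) (hz : crd i z ≤ crd i b) : z = b :=
  seg_crd_end' h i hne.ne' (le_antisymm hz (seg_crd_ge h i hne.le le_rfl))

/-- Lower-left corner segments avoid the quadrant. -/
lemma corner_seg {a b z : Pt} {L : ℝ} (h : z ∈ segment ℝ a b) (i : Bool)
    (ha : crd i a = -L) (hb : crd (!i) b = -L) (ha' : 0 ≤ crd (!i) a) (hb' : 0 ≤ crd i b)
    (hL : 0 < L) (hp : crd (!i) a * crd i b < L ^ 2) : crd i z < 0 ∨ crd (!i) z < 0 := by
  obtain ⟨t, h0, h1, hz⟩ := seg_crd h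
  by_contra! hc
  have e1 := hz i
  have e2 := hz (!i)
  rw [ha] at e1
  rw [hb] at e2
  set y := crd (!i) a
  set x := crd i b
  have c1 : 0 ≤ -L + t * (x + L) := by linarith [hc.1]
  have c2 : 0 ≤ y - t * (y + L) := by linarith [hc.2]
  nlinarith [mul_nonneg c1 (by linarith : (0:ℝ) ≤ y + L), mul_nonneg c2 (by linarith : (0:ℝ) ≤ x + L)]

lemma corner_seg2 {a b z : Pt} {L N : ℝ} (h : z ∈ segment ℝ a b) (i : Bool)
    (ha : crd i a = N + L) (hb : crd (!i) b = N + L) (ha' : crd (!i) a ≤ N) (hb' : crd i b ≤ N)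
    (hL : 0 < L) (hp : (N - crd (!i) a) * (N - crd i b) < L ^ 2) :
    N < crd i z ∨ N < crd (!i) z := by
  obtain ⟨t, h0, h1, hz⟩ := seg_crd h
  by_contra! hc
  have e1 := hz i
  have e2 := hz (!i)
  rw [ha] at e1
  rw [hb] at e2
  set y := crd (!i) a
  set x := crd i b
  have c1 : 0 ≤ -L + t * ((N - x) + L) := by linarith [hc.1]
  have c2 : 0 ≤ (N - y) - t * ((N - y) + L) := by linarith [hc.2]
  nlinarith [mul_nonneg c1 (by linarith : (0:ℝ) ≤ (N - y) + L),
    mul_nonneg c2 (by linarith : (0:ℝ) ≤ (N - x) + L)]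

/-! ### Coloured structure and layouts -/

/-- A cubic graph whose edges are coloured by a perfect matching `ρ` and two further matchings
`inv false`, `inv true`, with two uncoloured edges `b false - b true` and `e false - e true`. -/
structure Dfct {V : Type} (ρ : V → V) (inv : Bool → V → V) (b e : Bool → V) : Prop where
  rinv : ∀ a, ρ (ρ a) = a
  rne : ∀ a, ρ a ≠ a
  iinv : ∀ i a, inv i (inv i a) = a
  rni : ∀ i a, ρ a ≠ inv i a
  ini : ∀ i a, inv i a = inv (!i) a → inv i a = a
  fix : ∀ i a, inv i a = a ↔ a = b i ∨ a = e i
  be : ∀ i, b i ≠ e i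
  bb : ∀ i, b i ≠ b (!i)
  ee : ∀ i, e i ≠ e (!i)
  rb : ∀ i, ρ (b i) ≠ b (!i)
  nd : ∀ i, ¬ (b i = e (!i) ∧ b (!i) = e i)

/-- All edges of `G` are coloured edges or one of the two uncoloured edges. -/
def Cover {V : Type} (G : SimpleGraph V) (ρ : V → V) (inv : Bool → V → V) (b e : Bool → V) : Prop :=
  ∀ u v, G.Adj u v → v = ρ u ∨ (∃ i, v = inv i u) ∨ (∃ i, u = b i ∧ v = b (!i)) ∨
    (∃ i, u = e i ∧ v = e (!i))

/-- `d` lies weakly between the two ends of the matching edge at `a`. -/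
def BtwR {V : Type} (ρ : V → V) (k : V → ℤ) (a d : V) : Prop :=
  (k a ≤ k d ∧ k d ≤ k (ρ a)) ∨ (k (ρ a) ≤ k d ∧ k d ≤ k a)

/-- `d` lies strictly between the two ends of the matching edge at `a`. -/
def SBtwR {V : Type} (ρ : V → V) (k : V → ℤ) (a d : V) : Prop :=
  (k a < k d ∧ k d < k (ρ a)) ∨ (k (ρ a) < k d ∧ k d < k a)

/-- The order-theoretic conditions on coordinates that make the drawing work. -/
structure Lay {V : Type} (ρ : V → V) (inv : Bool → V → V) (b e : Bool → V)
    (k : Bool → V → ℤ) : Prop where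
  eq : ∀ i a c, k i a = k i c ↔ c = a ∨ c = inv i a
  sep : ∀ i a, (∀ d, ¬ SBtwR ρ (k i) a d) ∨
    ∃ c, (c = a ∨ c = ρ a) ∧
      ((k (!i) c < k (!i) (ρ c) ∧ ∀ d, d ≠ c → BtwR ρ (k i) a d → k (!i) (ρ c) ≤ k (!i) d) ∨
       (k (!i) (ρ c) < k (!i) c ∧ ∀ d, d ≠ c → BtwR ρ (k i) a d → k (!i) d ≤ k (!i) (ρ c)))
  red : ∀ a c, c ≠ a → c ≠ ρ a → ∃ i,
    (k i a ≤ k i c ∧ k i a ≤ k i (ρ c) ∧ k i (ρ a) ≤ k i c ∧ k i (ρ a) ≤ k i (ρ c)) ∨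
    (k i c ≤ k i a ∧ k i c ≤ k i (ρ a) ∧ k i (ρ c) ≤ k i a ∧ k i (ρ c) ≤ k i (ρ a))
  bmin : ∀ i a, a ≠ b i → k i (b i) < k i a
  emax : ∀ i a, a ≠ e i → k i a < k i (e i)

lemma Lay.transfer {V : Type} {ρ : V → V} {inv : Bool → V → V} {b e : Bool → V}
    {k k' : Bool → V → ℤ} (h : Lay ρ inv b e k)
    (hk : ∀ i a c, k' i a < k' i c ↔ k i a < k i c) : Lay ρ inv b e k' := by
  have hle : ∀ i a c, k' i a ≤ k' i c ↔ k i a ≤ k i c := by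
    intro i a c
    rw [← not_lt, ← not_lt, hk]
  have heq : ∀ i a c, k' i a = k' i c ↔ k i a = k i c := by
    intro i a c
    rw [le_antisymm_iff, le_antisymm_iff, hle, hle]
  constructor
  · intro i a c; rw [heq]; exact h.eq i a c
  · intro i a
    have := h.sep i a
    simp only [SBtwR, BtwR] at this ⊢
    simp only [hk, hle]
    exact this
  · intro a c
    simp only [hle]
    exact h.red a c
  · intro i a
    simp only [hk]
    exact h.bmin i a
  · intro i a
    simp only [hk]
    exact h.emax i a

/-- the placement determined by two coordinate functions -/
def place {V : Type} (k : Bool → V → ℤ) (v : V) : Pt := ((k true v : ℝ), (k false v : ℝ))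

@[simp] lemma crd_place {V : Type} (k : Bool → V → ℤ) (v : V) (i : Bool) :
    crd i (place k v) = (k i v : ℝ) := by cases i <;> simp [crd, place]

section draw
variable {V : Type} {ρ : V → V} {inv : Bool → V → V} {b e : Bool → V} {k : Bool → V → ℤ}

lemma place_inj (D : Dfct ρ inv b e) (L : Lay ρ inv b e k) : Function.Injective (place k) := by
  intro u v h
  have h1 : ∀ i, k i u = k i v := by
    intro i
    have := congrArg (crd i) h
    simpa using this
  have ht := (L.eq true u v).1 (h1 true)
  have hf := (L.eq false u v).1 (h1 false)
  rcases ht with rfl | ht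
  · rfl
  rcases hf with rfl | hf
  · rfl
  have := D.ini true u (by rw [← ht, hf]; rfl)
  rw [ht, this]

lemma k_red_ne (D : Dfct ρ inv b e) (L : Lay ρ inv b e k) (i : Bool) (a : V) :
    k i a ≠ k i (ρ a) := by
  intro h
  rcases (L.eq i _ _).1 h with h | h
  · exact D.rne a h
  · exact D.rni i a h

lemma red_line (D : Dfct ρ inv b e) (L : Lay ρ inv b e k) (i : Bool) {a c d : V} {z : Pt}
    (hd : d = c ∨ d = inv i c) (hca : c ≠ a) (hca' : c ≠ ρ a) (hda : d ≠ a) (hda' : d ≠ ρ a)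
    (h1 : z ∈ segment ℝ (place k a) (place k (ρ a)))
    (h2 : z ∈ segment ℝ (place k c) (place k d)) : False := by
  have hinj := place_inj D L
  have hkcd : k i c = k i d := (L.eq i c d).2 hd
  have hz : crd i z = k i c := by
    apply le_antisymm
    · exact seg_crd_le h2 i (by simp) (by simp [hkcd])
    · exact seg_crd_ge h2 i (by simp) (by simp [hkcd])
  have hne : ∀ j, (crd j (place k a)) ≠ crd j (place k (ρ a)) := by
    intro j; simp only [crd_place]; exact_mod_cast k_red_ne D L j a
  have key : ∀ u, (u = a ∨ u = ρ a) → z = place k u → False := by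
    intro u hu hzu
    have hcu : c ≠ u := by rcases hu with rfl | rfl <;> assumption
    have hdu : d ≠ u := by rcases hu with rfl | rfl <;> assumption
    have hk : k i u = k i c := by
      rw [hzu] at hz; simpa using hz
    rcases (L.eq i u c).1 hk with h | h
    · exact hcu h
    rcases hd with rfl | rfl
    · rw [segment_same] at h2
      have h2 : z = place k d := h2
      exact hcu (hinj (by rw [← h2, hzu]))
    · apply hdu; rw [h, D.iinv]
  rcases L.sep i a with hf | ⟨u, hu, hs⟩
  · -- free
    have h3 := hf c
    simp only [SBtwR] at h3
    rcases lt_trichotomy (k i c) (k i a) with h | h | h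
    · rcases lt_trichotomy (k i c) (k i (ρ a)) with h' | h' | h'
      · have := seg_crd_ge h1 i (m := ((min (k i a) (k i (ρ a)) : ℤ) : ℝ)) (by simp) (by simp)
        rw [hz] at this
        have : min (k i a) (k i (ρ a)) ≤ k i c := by exact_mod_cast this
        omega
      · exact key (ρ a) (Or.inr rfl) (seg_crd_end' h1 i (hne i) (by rw [hz, h']; simp))
      · exact h3 (Or.inr ⟨h', h⟩)
    · exact key a (Or.inl rfl) (seg_crd_end h1 i (hne i) (by rw [hz, h]; simp))
    · rcases lt_trichotomy (k i c) (k i (ρ a)) with h' | h' | h'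
      · exact h3 (Or.inl ⟨h, h'⟩)
      · exact key (ρ a) (Or.inr rfl) (seg_crd_end' h1 i (hne i) (by rw [hz, h']; simp))
      · have := seg_crd_le h1 i (m := ((max (k i a) (k i (ρ a)) : ℤ) : ℝ)) (by simp) (by simp)
        rw [hz] at this
        have : k i c ≤ max (k i a) (k i (ρ a)) := by exact_mod_cast this
        omega
  · have hcu : c ≠ u := by rcases hu with rfl | rfl <;> assumption
    have hdu : d ≠ u := by rcases hu with rfl | rfl <;> assumption
    have hru : ρ u = a ∨ ρ u = ρ a := by
      rcases hu with rfl | rfl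
      · right; rfl
      · left; exact D.rinv a
    have h1' : z ∈ segment ℝ (place k u) (place k (ρ u)) := by
      rcases hu with rfl | rfl
      · exact h1
      · rw [D.rinv, segment_symm]; exact h1
    have hb : BtwR ρ (k i) a c := by
      have t1 := seg_crd_le h1 i (m := ((max (k i a) (k i (ρ a)) : ℤ) : ℝ)) (by simp) (by simp)
      rw [hz] at t1
      have t1 : k i c ≤ max (k i a) (k i (ρ a)) := by exact_mod_cast t1
      have t2 := seg_crd_ge h1 i (m := ((min (k i a) (k i (ρ a)) : ℤ) : ℝ)) (by simp) (by simp)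
      rw [hz] at t2
      have t2 : min (k i a) (k i (ρ a)) ≤ k i c := by exact_mod_cast t2
      unfold BtwR; omega
    have hb' : BtwR ρ (k i) a d := by unfold BtwR at hb ⊢; rwa [← hkcd]
    rcases hs with ⟨hlt, hs⟩ | ⟨hlt, hs⟩
    · have s1 := hs c hcu hb
      have s2 := hs d hdu hb'
      refine key (ρ u) hru (seg_crd_far h1' (!i) (by simpa using hlt) ?_)
      exact seg_crd_ge h2 (!i) (by simpa using s1) (by simpa using s2)
    · have s1 := hs c hcu hb
      have s2 := hs d hdu hb'
      refine key (ρ u) hru (seg_crd_far' h1' (!i) (by simpa using hlt) ?_)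
      exact seg_crd_le h2 (!i) (by simpa using s1) (by simpa using s2)

lemma red_red (D : Dfct ρ inv b e) (L : Lay ρ inv b e k) {a c : V} {z : Pt}
    (hca : c ≠ a) (hca' : c ≠ ρ a)
    (h1 : z ∈ segment ℝ (place k a) (place k (ρ a)))
    (h2 : z ∈ segment ℝ (place k c) (place k (ρ c))) : False := by
  have hinj := place_inj D L
  have hr : ρ c ≠ a := by intro h; apply hca'; rw [← h, D.rinv]
  have hr' : ρ c ≠ ρ a := by intro h; apply hca; rw [← D.rinv c, h, D.rinv]
  have aux : ∀ i u v : _, ∀ z : Pt, z ∈ segment ℝ (place k u) (place k (ρ u)) →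
      z ∈ segment ℝ (place k v) (place k (ρ v)) →
      (k i u ≤ k i v ∧ k i u ≤ k i (ρ v) ∧ k i (ρ u) ≤ k i v ∧ k i (ρ u) ≤ k i (ρ v)) →
      (u = v ∨ u = ρ v ∨ ρ u = v ∨ ρ u = ρ v) := by
    intro i u v z h1 h2 ⟨o1, o2, o3, o4⟩
    have n1 := k_red_ne D L i u
    have n2 := k_red_ne D L i v
    have hz1 := seg_crd_le h1 i (m := ((max (k i u) (k i (ρ u)) : ℤ) : ℝ)) (by simp) (by simp)
    have hz2 := seg_crd_ge h2 i (m := ((min (k i v) (k i (ρ v)) : ℤ) : ℝ)) (by simp) (by simp)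
    have hh : min (k i v) (k i (ρ v)) ≤ max (k i u) (k i (ρ u)) := by
      exact_mod_cast hz2.trans hz1
    have hh' : min (k i v) (k i (ρ v)) = max (k i u) (k i (ρ u)) := by omega
    have hzz : crd i z = ((max (k i u) (k i (ρ u)) : ℤ) : ℝ) := by
      apply le_antisymm hz1; rw [← hh']; exact hz2
    have c1 : z = place k u ∨ z = place k (ρ u) := by
      rcases max_choice (k i u) (k i (ρ u)) with hm | hm
      · left; exact seg_crd_end h1 i (by simpa using n1) (by rw [hzz, hm]; simp)
      · right; exact seg_crd_end' h1 i (by simpa using n1) (by rw [hzz, hm]; simp)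
    have c2 : z = place k v ∨ z = place k (ρ v) := by
      rw [← hh'] at hzz
      rcases min_choice (k i v) (k i (ρ v)) with hm | hm
      · left; exact seg_crd_end h2 i (by simpa using n2) (by rw [hzz, hm]; simp)
      · right; exact seg_crd_end' h2 i (by simpa using n2) (by rw [hzz, hm]; simp)
    rcases c1 with c1 | c1 <;> rcases c2 with c2 | c2
    · left; exact hinj (c1.symm.trans c2)
    · right; left; exact hinj (c1.symm.trans c2)
    · right; right; left; exact hinj (c1.symm.trans c2)
    · right; right; right; exact hinj (c1.symm.trans c2)
  obtain ⟨i, hi | hi⟩ := L.red a c hca hca'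
  · rcases aux i a c z h1 h2 hi with h | h | h | h
    · exact hca h.symm
    · exact hr h.symm
    · exact hca' h.symm
    · exact hr' h.symm
  · rcases aux i c a z h2 h1 hi with h | h | h | h
    · exact hca h
    · exact hca' h
    · exact hr h
    · exact hr' h

lemma spacer_true : True := trivial

/-- Final coordinates: inner coordinates in `[0, N]`, extreme ones pushed away. -/
structure Pushed {V : Type} (b e : Bool → V) (k : Bool → V → ℤ) (N : ℤ) : Prop where
  pos : 1 ≤ N
  inner : ∀ i a, a ≠ b i → a ≠ e i → 0 ≤ k i a ∧ k i a ≤ N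
  kb : ∀ i, k i (b i) = -(2 * N)
  ke : ∀ i, k i (e i) = 3 * N

lemma Pushed.lo {N : ℤ} (P : Pushed b e k N) (i : Bool) {a : V} (h : a ≠ b i) : 0 ≤ k i a := by
  have := P.pos
  by_cases h' : a = e i
  · rw [h', P.ke]; omega
  · exact (P.inner i a h h').1

lemma Pushed.hi {N : ℤ} (P : Pushed b e k N) (i : Bool) {a : V} (h : a ≠ e i) : k i a ≤ N := by
  have := P.pos
  by_cases h' : a = b i
  · rw [h', P.kb]; omega
  · exact (P.inner i a h' h).2

lemma f1_off (D : Dfct ρ inv b e) {N : ℤ} (P : Pushed b e k N) (i : Bool) {c d : V} {z : Pt}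
    (hc : ∀ j, c ≠ b j) (hd : ∀ j, d ≠ b j)
    (h1 : z ∈ segment ℝ (place k (b i)) (place k (b (!i))))
    (h2 : z ∈ segment ℝ (place k c) (place k d)) : False := by
  have hN := P.pos
  have hN' : (1 : ℝ) ≤ N := by exact_mod_cast hN
  have hpos : ∀ j, 0 ≤ crd j z := fun j =>
    seg_crd_ge h2 j (by simpa using P.lo j (hc j)) (by simpa using P.lo j (hd j))
  have l1 := P.lo (!i) (D.bb i)
  have l2 := P.lo i (D.bb i).symm
  have hp : k (!i) (b i) * k i (b (!i)) < (2 * N) ^ 2 := by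
    have m1 : k (!i) (b i) ≤ 3 * N := by
      by_cases h : b i = e (!i)
      · rw [h, P.ke]
      · have := P.hi (!i) h; omega
    have m2 : k i (b (!i)) ≤ 3 * N := by
      by_cases h : b (!i) = e i
      · rw [h, P.ke]
      · have := P.hi i h; omega
    by_cases h : b i = e (!i)
    · have h' : b (!i) ≠ e i := fun h' => D.nd i ⟨h, h'⟩
      have := P.hi i h'
      nlinarith
    · have := P.hi (!i) h
      nlinarith
  have := corner_seg (L := 2 * (N : ℝ)) h1 i (by simp [P.kb]) (by simp [P.kb])
    (by simpa using l1) (by simpa using l2) (by linarith) (by simp only [crd_place]; exact_mod_cast hp)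
  have a1 := hpos i
  have a2 := hpos (!i)
  rcases this with h | h <;> linarith

lemma f2_off (D : Dfct ρ inv b e) {N : ℤ} (P : Pushed b e k N) (i : Bool) {c d : V} {z : Pt}
    (hc : ∀ j, c ≠ e j) (hd : ∀ j, d ≠ e j)
    (h1 : z ∈ segment ℝ (place k (e i)) (place k (e (!i))))
    (h2 : z ∈ segment ℝ (place k c) (place k d)) : False := by
  have hN := P.pos
  have hN' : (1 : ℝ) ≤ N := by exact_mod_cast hN
  have hpos : ∀ j, crd j z ≤ N := fun j =>
    seg_crd_le h2 j (by simpa using P.hi j (hc j)) (by simpa using P.hi j (hd j))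
  have l1 := P.hi (!i) (D.ee i)
  have l2 := P.hi i (D.ee i).symm
  have hp : (N - k (!i) (e i)) * (N - k i (e (!i))) < (2 * N) ^ 2 := by
    have m1 : N - k (!i) (e i) ≤ 3 * N := by
      by_cases h : e i = b (!i)
      · rw [h, P.kb]; omega
      · have := P.lo (!i) h; omega
    have m2 : N - k i (e (!i)) ≤ 3 * N := by
      by_cases h : e (!i) = b i
      · rw [h, P.kb]; omega
      · have := P.lo i h; omega
    by_cases h : e i = b (!i)
    · have h' : e (!i) ≠ b i := fun h' => D.nd i ⟨h'.symm, h.symm⟩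
      have := P.lo i h'
      nlinarith
    · have := P.lo (!i) h
      nlinarith
  have := corner_seg2 (L := 2 * (N : ℝ)) (N := N) h1 i (by simp [P.ke]; ring) (by simp [P.ke]; ring)
    (by simpa using l1) (by simpa using l2) (by linarith) (by simp only [crd_place]; exact_mod_cast hp)
  have a1 := hpos i
  have a2 := hpos (!i)
  rcases this with h | h <;> linarith

lemma bool_cases_of {P : Bool → Prop} (i : Bool) (h1 : P i) (h2 : P (!i)) : ∀ j, P j := by
  cases i <;> rintro (_ | _) <;> simp_all

theorem draw_of_layout {G : SimpleGraph V} (D : Dfct ρ inv b e) (C : Cover G ρ inv b e)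
    (L : Lay ρ inv b e k) {N : ℤ} (P : Pushed b e k N) : IsRACDrawing G (place k) := by
  have hinj := place_inj D L
  have hoff : ∀ u v w : V, G.Adj u v → w ≠ u → w ≠ v →
      place k w ∉ segment ℝ (place k u) (place k v) := by
    intro u v w huv hu hv hw
    have hw' : place k w ∈ segment ℝ (place k w) (place k w) := by simp
    rcases C u v huv with rfl | ⟨i, rfl⟩ | ⟨i, rfl, rfl⟩ | ⟨i, rfl, rfl⟩
    · exact red_line D L true (Or.inl rfl) hu hv hu hv hw hw'
    · have hk : k i u = k i (inv i u) := (L.eq i _ _).2 (Or.inr rfl)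
      have h1 : k i u = k i w := by
        have a1 := seg_crd_le hw i (m := k i u) (by simp) (by simp [hk])
        have a2 := seg_crd_ge hw i (m := k i u) (by simp) (by simp [hk])
        simp only [crd_place] at a1 a2
        have a1 : k i w ≤ k i u := by exact_mod_cast a1
        have a2 : k i u ≤ k i w := by exact_mod_cast a2
        omega
      rcases (L.eq i _ _).1 h1 with h | h
      · exact hu h
      · exact hv h
    · exact f1_off D P i (bool_cases_of i hu hv) (bool_cases_of i hu hv) hw hw'
    · exact f2_off D P i (bool_cases_of i hu hv) (bool_cases_of i hu hv) hw hw'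
  refine ⟨hinj, hoff, ?_, ?_⟩
  · intro u v w huv huw hvw
    exact shared_of_off (hoff u w v huw huv.ne' hvw) (hoff u v w huv huw.ne' hvw.symm)
  · rintro u v u' v' h h' n1 n2 n3 n4 ⟨z, hz, hz'⟩
    rcases C u v h with rfl | ⟨i, rfl⟩ | ⟨i, rfl, rfl⟩ | ⟨i, rfl, rfl⟩
    · rcases C u' v' h' with rfl | ⟨j, rfl⟩ | ⟨j, rfl, rfl⟩ | ⟨j, rfl, rfl⟩
      · exact (red_red D L n1.symm n3.symm hz hz').elim
      · exact (red_line D L j (Or.inr rfl) n1.symm n3.symm n2.symm n4.symm hz hz').elim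
      · exact (f1_off D P j (bool_cases_of j n1 n2) (bool_cases_of j n3 n4) hz' hz).elim
      · exact (f2_off D P j (bool_cases_of j n1 n2) (bool_cases_of j n3 n4) hz' hz).elim
    · rcases C u' v' h' with rfl | ⟨j, rfl⟩ | ⟨j, rfl, rfl⟩ | ⟨j, rfl, rfl⟩
      · exact (red_line D L i (Or.inr rfl) n1 n2 n3 n4 hz' hz).elim
      · have hk : k i u = k i (inv i u) := (L.eq i _ _).2 (Or.inr rfl)
        have hk' : k j u' = k j (inv j u') := (L.eq j _ _).2 (Or.inr rfl)
        by_cases hij : i = j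
        · subst hij
          exfalso
          have a1 := seg_crd_le hz i (m := k i u) (by simp) (by simp [hk])
          have a2 := seg_crd_ge hz i (m := k i u) (by simp) (by simp [hk])
          have b1 := seg_crd_le hz' i (m := k i u') (by simp) (by simp [hk'])
          have b2 := seg_crd_ge hz' i (m := k i u') (by simp) (by simp [hk'])
          have : (k i u : ℝ) = k i u' := by linarith
          have : k i u = k i u' := by exact_mod_cast this
          rcases (L.eq i _ _).1 this with h | h
          · exact n1 h.symm
          · exact n3 h.symm
        · cases i <;> cases j <;> simp_all [SegOrth, place]
      · exact (f1_off D P j (bool_cases_of j n1 n2) (bool_cases_of j n3 n4) hz' hz).elim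
      · exact (f2_off D P j (bool_cases_of j n1 n2) (bool_cases_of j n3 n4) hz' hz).elim
    · exact (f1_off D P i (bool_cases_of i n1.symm n3.symm) (bool_cases_of i n2.symm n4.symm) hz hz').elim
    · exact (f2_off D P i (bool_cases_of i n1.symm n3.symm) (bool_cases_of i n2.symm n4.symm) hz hz').elim

end draw

/-! ### Alternating chains in one direction -/

/-- `c` is in the orbit of `a` under the two involutions. -/
def Rc {V : Type} (ρ β : V → V) (a c : V) : Prop :=
  ∀ P : V → Prop, (∀ x, P x → P (ρ x)) → (∀ x, P x → P (β x)) → P a → P c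

/-- `a` is at position `n` of the chain started at `s`. -/
def Sx {V : Type} (ρ β : V → V) (s : V) (n : ℕ) (a : V) : Prop :=
  a = (ρ ∘ β)^[n] s ∨ a = β ((ρ ∘ β)^[n] s)

/-- position in the chain started at `s` -/
def idx {V : Type} (ρ β : V → V) (s a : V) : ℕ := sInf {n | Sx ρ β s n a}

section chain
variable {V : Type} {ρ β : V → V}

lemma Rc.refl (a : V) : Rc ρ β a a := fun _ _ _ h => h

lemma Rc.trans {a c d : V} (h : Rc ρ β a c) (h' : Rc ρ β c d) : Rc ρ β a d :=
  fun P h1 h2 ha => h' P h1 h2 (h P h1 h2 ha)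

lemma Rc.rho (a : V) : Rc ρ β a (ρ a) := fun _ h1 _ h => h1 _ h

lemma Rc.bet (a : V) : Rc ρ β a (β a) := fun _ _ h2 h => h2 _ h

lemma Rc.symm (hr : ∀ a, ρ (ρ a) = a) (hb : ∀ a, β (β a) = a) {a c : V} (h : Rc ρ β a c) :
    Rc ρ β c a := by
  refine h (fun x => Rc ρ β x a) ?_ ?_ (Rc.refl a)
  · intro x hx
    refine Rc.trans ?_ hx
    have := Rc.rho (ρ := ρ) (β := β) (ρ x)
    rwa [hr] at this
  · intro x hx
    refine Rc.trans ?_ hx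
    have := Rc.bet (ρ := ρ) (β := β) (β x)
    rwa [hb] at this

lemma Sx.bet (hb : ∀ a, β (β a) = a) {s a : V} {n : ℕ} (h : Sx ρ β s n a) : Sx ρ β s n (β a) := by
  rcases h with rfl | rfl
  · right; rfl
  · left; rw [hb]

lemma Sx.rho_up {s : V} {n : ℕ} : Sx ρ β s (n + 1) (ρ (β ((ρ ∘ β)^[n] s))) := by
  left; rw [Function.iterate_succ_apply']; rfl

lemma Sx.rho_down (hr : ∀ a, ρ (ρ a) = a) {s : V} {n : ℕ} :
    Sx ρ β s n (ρ ((ρ ∘ β)^[n + 1] s)) := by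
  right; rw [Function.iterate_succ_apply']; simp [hr]

lemma exists_Sx [Finite V] (hr : ∀ a, ρ (ρ a) = a) (hb : ∀ a, β (β a) = a) {s a : V}
    (h : Rc ρ β s a) : ∃ n, Sx ρ β s n a := by
  refine h (fun x => ∃ n, Sx ρ β s n x) ?_ ?_ ⟨0, Or.inl rfl⟩
  · rintro x ⟨n, rfl | rfl⟩
    · cases n with
      | zero =>
        have hinj : Function.Injective (ρ ∘ β) :=
          (Function.LeftInverse.injective hr).comp (Function.LeftInverse.injective hb)
        obtain ⟨m, hm, hp⟩ := hinj.mem_periodicPts s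
        obtain ⟨j, rfl⟩ : ∃ j, m = j + 1 := ⟨m - 1, by omega⟩
        have := Sx.rho_down (β := β) hr (s := s) (n := j)
        rw [hp.eq] at this
        exact ⟨j, this⟩
      | succ n => exact ⟨n, Sx.rho_down hr⟩
    · exact ⟨n + 1, Sx.rho_up⟩
  · rintro x ⟨n, h⟩
    exact ⟨n, h.bet hb⟩

lemma idx_spec [Finite V] (hr : ∀ a, ρ (ρ a) = a) (hb : ∀ a, β (β a) = a) {s a : V}
    (h : Rc ρ β s a) : Sx ρ β s (idx ρ β s a) a :=
  Nat.sInf_mem (s := {n | Sx ρ β s n a}) (exists_Sx hr hb h)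

lemma idx_le {s a : V} {n : ℕ} (h : Sx ρ β s n a) : idx ρ β s a ≤ n := Nat.sInf_le h

lemma idx_start (s : V) : idx ρ β s s = 0 := Nat.le_zero.1 (idx_le (Or.inl rfl))

lemma idx_eq [Finite V] (hr : ∀ a, ρ (ρ a) = a) (hb : ∀ a, β (β a) = a) {s a c : V}
    (ha : Rc ρ β s a) (hc : Rc ρ β s c) :
    idx ρ β s a = idx ρ β s c ↔ c = a ∨ c = β a := by
  constructor
  · intro h
    have h1 := idx_spec hr hb ha
    have h2 := idx_spec hr hb hc
    rw [← h] at h2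
    generalize idx ρ β s a = n at h1 h2
    rcases h1 with h1 | h1 <;> rcases h2 with h2 | h2
    · left; rw [h1, h2]
    · right; rw [h1, h2]
    · right; rw [h1, h2, hb]
    · left; rw [h1, h2]
  · rintro (rfl | rfl)
    · rfl
    · apply le_antisymm
      · have := idx_le ((idx_spec hr hb hc).bet hb)
        rwa [hb] at this
      · exact idx_le ((idx_spec hr hb ha).bet hb)

lemma idx_rho_le [Finite V] (hr : ∀ a, ρ (ρ a) = a) (hb : ∀ a, β (β a) = a)
    {s a : V} (ha : Rc ρ β s a) (hc : β s = s ∨ a ≠ s) :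
    (a = β ((ρ ∘ β)^[idx ρ β s a] s)) ∨ idx ρ β s (ρ a) < idx ρ β s a := by
  have h := idx_spec hr hb ha
  rcases h with h | h
  · generalize hn : idx ρ β s a = n at h
    cases n with
    | zero =>
      left
      rcases hc with hc | hc
      · rw [h]; simp [hc]
      · exact absurd h hc
    | succ n =>
      right
      have := Sx.rho_down (β := β) hr (s := s) (n := n)
      rw [← h] at this
      have := idx_le this
      omega
  · left; exact h

lemma idx_step [Finite V] (hr : ∀ a, ρ (ρ a) = a) (hb : ∀ a, β (β a) = a)
    (hn : ∀ a, ρ a ≠ a) (hnb : ∀ a, ρ a ≠ β a)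
    {s a : V} (ha : Rc ρ β s a) (hc : β s = s ∨ (a ≠ s ∧ ρ a ≠ s)) :
    idx ρ β s (ρ a) = idx ρ β s a + 1 ∨ idx ρ β s a = idx ρ β s (ρ a) + 1 := by
  have key : ∀ a, Rc ρ β s a → (β s = s ∨ a ≠ s) → idx ρ β s (ρ a) ≤ idx ρ β s a + 1 := by
    intro a ha hc
    rcases idx_rho_le hr hb ha hc with h | h
    · have := Sx.rho_up (ρ := ρ) (β := β) (s := s) (n := idx ρ β s a)
      rw [← h] at this
      exact idx_le this
    · omega
  have h1 := key a ha (by tauto)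
  have hra := ha.trans (Rc.rho a)
  have h2 := key (ρ a) hra (by tauto)
  rw [hr] at h2
  have h3 : idx ρ β s a ≠ idx ρ β s (ρ a) := by
    intro h
    rcases (idx_eq hr hb ha hra).1 h with h | h
    · exact hn a h
    · exact hnb a h
  omega

lemma idx_gap [Finite V] (hr : ∀ a, ρ (ρ a) = a) (hb : ∀ a, β (β a) = a)
    {s a c : V} (ha : Rc ρ β s a) (hc : Rc ρ β s c) (ha' : β s = s ∨ a ≠ s)
    (hc' : β s = s ∨ c ≠ s) (h : idx ρ β s a = idx ρ β s c)
    (h1 : idx ρ β s a < idx ρ β s (ρ a)) (h2 : idx ρ β s c < idx ρ β s (ρ c)) : a = c := by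
  rcases idx_rho_le hr hb ha ha' with h3 | h3
  · rcases idx_rho_le hr hb hc hc' with h4 | h4
    · rw [h3, h4, h]
    · omega
  · omega

lemma idx_max [Finite V] (hr : ∀ a, ρ (ρ a) = a) (hb : ∀ a, β (β a) = a)
    {s t a : V} (hs : β s = s) (ht : β t = t) (hst : s ≠ t) (h : Rc ρ β s t) (ha : Rc ρ β s a) :
    idx ρ β s a ≤ idx ρ β s t := by
  have hn : 1 ≤ idx ρ β s t := by
    by_contra h0
    have h0 : idx ρ β s t = 0 := by omega
    have := idx_spec hr hb h
    rw [h0] at this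
    rcases this with h | h
    · exact hst h.symm
    · exact hst (h.trans hs).symm
  have htn : t = (ρ ∘ β)^[idx ρ β s t] s := by
    rcases idx_spec hr hb h with h | h
    · exact h
    · rw [← hb ((ρ ∘ β)^[idx ρ β s t] s), ← h, ht]
  generalize idx ρ β s t = n at hn htn
  suffices h : ∃ m ≤ n, Sx ρ β s m a by
    obtain ⟨m, hm, h⟩ := h
    exact (idx_le h).trans hm
  refine ha (fun a => ∃ m ≤ n, Sx ρ β s m a) ?_ ?_ ⟨0, by omega, Or.inl rfl⟩
  · rintro x ⟨m, hm, rfl | rfl⟩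
    · cases m with
      | zero =>
        refine ⟨1, hn, ?_⟩
        left; simp [hs]
      | succ m => exact ⟨m, by omega, Sx.rho_down hr⟩
    · rcases hm.lt_or_eq with h | h
      · exact ⟨m + 1, h, Sx.rho_up⟩
      · subst h
        refine ⟨m - 1, by omega, ?_⟩
        have := Sx.rho_down (β := β) hr (s := s) (n := m - 1)
        rw [Nat.sub_add_cancel hn] at this
        rw [← htn] at this ⊢
        rwa [ht]
  · rintro x ⟨m, hm, h⟩
    exact ⟨m, hm, h.bet hb⟩

/-- A fixed point free involution forces an even number of fixed points of another one. -/
lemma even_fixed [DecidableEq V] (C : Finset V) (hr : ∀ a, ρ (ρ a) = a) (hb : ∀ a, β (β a) = a)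
    (hn : ∀ a, ρ a ≠ a) (hC : ∀ a ∈ C, ρ a ∈ C) (hC' : ∀ a ∈ C, β a ∈ C) :
    Even (C.filter (fun a => β a = a)).card := by
  have h1 : ∑ a ∈ C, (1 : ZMod 2) = 0 :=
    Finset.sum_involution (fun a _ => ρ a) (fun _ _ => by decide) (fun a _ _ => hn a)
      (fun a ha => hC a ha) (fun a _ => hr a)
  have h2 : ∑ a ∈ C.filter (fun a => ¬ β a = a), (1 : ZMod 2) = 0 := by
    refine Finset.sum_involution (fun a _ => β a) (fun _ _ => by decide) ?_ ?_ (fun a _ => hb a)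
    · intro a ha _
      exact (Finset.mem_filter.1 ha).2
    · intro a ha
      rw [Finset.mem_filter] at ha ⊢
      refine ⟨hC' a ha.1, ?_⟩
      rw [hb]; exact fun h => ha.2 h.symm
  have h3 := Finset.sum_filter_add_sum_filter_not C (fun a => β a = a) (fun _ => (1 : ZMod 2))
  rw [h1, h2, add_zero] at h3
  simp only [Finset.sum_const, nsmul_eq_mul, mul_one] at h3
  exact (ZMod.natCast_eq_zero_iff_even).1 h3

lemma other_end [Fintype V] (hr : ∀ a, ρ (ρ a) = a) (hb : ∀ a, β (β a) = a)
    (hn : ∀ a, ρ a ≠ a) {s t : V} (hst : s ≠ t) (hf : ∀ a, β a = a ↔ a = s ∨ a = t) :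
    Rc ρ β s t := by
  have h := even_fixed (ρ := ρ) (β := β) (Finset.univ.filter (fun a => Rc ρ β s a)) hr hb hn
    (by intro a ha; simp only [Finset.mem_filter, Finset.mem_univ, true_and] at ha ⊢
        exact ha.trans (Rc.rho a))
    (by intro a ha; simp only [Finset.mem_filter, Finset.mem_univ, true_and] at ha ⊢
        exact ha.trans (Rc.bet a))
  by_contra hne
  have : ((Finset.univ.filter (fun a => Rc ρ β s a)).filter (fun a => β a = a)) = {s} := by
    ext a
    simp only [Finset.mem_filter, Finset.mem_univ, true_and, Finset.mem_singleton, hf]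
    constructor
    · rintro ⟨h1, rfl | rfl⟩
      · rfl
      · exact absurd h1 hne
    · rintro rfl; exact ⟨Rc.refl _, Or.inl rfl⟩
  rw [this] at h
  simp at h

end chain

/-! ### From an abstract ordering to a layout -/

/-- Abstract properties of the orders. -/
structure Pre {V : Type} (ρ : V → V) (inv : Bool → V → V) (b e : Bool → V)
    (k : Bool → V → ℤ) (cut : Bool → V → Prop) : Prop where
  eq : ∀ i a c, k i a = k i c ↔ c = a ∨ c = inv i a
  cutr : ∀ i a, cut i a → cut i (ρ a)
  free : ∀ i a, ¬ cut i a → ∀ d, ¬ SBtwR ρ (k i) a d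
  gap : ∀ i a c, ¬ cut i a → ¬ cut i c → k i a = k i c → k i (ρ a) = k i (ρ c) → a = c
  sep : ∀ i a, cut i a → ∃ c, (c = a ∨ c = ρ a) ∧
      ((k (!i) c < k (!i) (ρ c) ∧ ∀ d, d ≠ c → BtwR ρ (k i) a d → k (!i) (ρ c) ≤ k (!i) d) ∨
       (k (!i) (ρ c) < k (!i) c ∧ ∀ d, d ≠ c → BtwR ρ (k i) a d → k (!i) d ≤ k (!i) (ρ c)))
  two : ∀ i a c, cut i a → cut i c → c ≠ a → c ≠ ρ a →
    (k i a ≤ k i c ∧ k i a ≤ k i (ρ c) ∧ k i (ρ a) ≤ k i c ∧ k i (ρ a) ≤ k i (ρ c)) ∨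
    (k i c ≤ k i a ∧ k i c ≤ k i (ρ a) ∧ k i (ρ c) ≤ k i a ∧ k i (ρ c) ≤ k i (ρ a)) ∨
    (BtwR ρ (k i) a c ∧ BtwR ρ (k i) a (ρ c)) ∨
    (BtwR ρ (k i) c a ∧ BtwR ρ (k i) c (ρ a))
  bmin : ∀ i a, a ≠ b i → k i (b i) < k i a
  emax : ∀ i a, a ≠ e i → k i a < k i (e i)

lemma Pre.lay {V : Type} {ρ : V → V} {inv : Bool → V → V} {b e : Bool → V}
    {k : Bool → V → ℤ} {cut : Bool → V → Prop} (hr : ∀ a, ρ (ρ a) = a)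
    (h : Pre ρ inv b e k cut) : Lay ρ inv b e k := by
  have hsep : ∀ i a c, cut i a → c ≠ a → c ≠ ρ a → BtwR ρ (k i) a c → BtwR ρ (k i) a (ρ c) →
      (k (!i) a ≤ k (!i) c ∧ k (!i) a ≤ k (!i) (ρ c) ∧ k (!i) (ρ a) ≤ k (!i) c ∧
        k (!i) (ρ a) ≤ k (!i) (ρ c)) ∨
      (k (!i) c ≤ k (!i) a ∧ k (!i) c ≤ k (!i) (ρ a) ∧ k (!i) (ρ c) ≤ k (!i) a ∧
        k (!i) (ρ c) ≤ k (!i) (ρ a)) := by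
    intro i a c ha n1 n2 h1 h2
    have n3 : ρ c ≠ a := by intro h; apply n2; rw [← h, hr]
    have n4 : ρ c ≠ ρ a := by intro h; apply n1; rw [← hr c, h, hr]
    obtain ⟨u, hu, hs⟩ := h.sep i a ha
    rcases hu with rfl | rfl
    · rcases hs with ⟨hl, hs⟩ | ⟨hl, hs⟩
      · have s1 := hs c n1 h1
        have s2 := hs (ρ c) n3 h2
        left; omega
      · have s1 := hs c n1 h1
        have s2 := hs (ρ c) n3 h2
        right; omega
    · rw [hr] at hs
      rcases hs with ⟨hl, hs⟩ | ⟨hl, hs⟩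
      · have s1 := hs c n2 h1
        have s2 := hs (ρ c) n4 h2
        left; omega
      · have s1 := hs c n2 h1
        have s2 := hs (ρ c) n4 h2
        right; omega
  have hone : ∀ i a c, cut i a → c ≠ a → c ≠ ρ a → ∃ i,
    (k i a ≤ k i c ∧ k i a ≤ k i (ρ c) ∧ k i (ρ a) ≤ k i c ∧ k i (ρ a) ≤ k i (ρ c)) ∨
    (k i c ≤ k i a ∧ k i c ≤ k i (ρ a) ∧ k i (ρ c) ≤ k i a ∧ k i (ρ c) ≤ k i (ρ a)) := by
    intro i a c ha n1 n2
    have n3 : a ≠ ρ c := by intro h; apply n2; rw [h, hr]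
    by_cases hc : cut i c
    · rcases h.two i a c ha hc n1 n2 with h1 | h1 | ⟨h1, h2⟩ | ⟨h1, h2⟩
      · exact ⟨i, Or.inl h1⟩
      · exact ⟨i, Or.inr h1⟩
      · exact ⟨!i, hsep i a c ha n1 n2 h1 h2⟩
      · exact ⟨!i, (hsep i c a hc n1.symm n3 h1 h2).symm⟩
    · have f1 := h.free i c hc a
      have f2 := h.free i c hc (ρ a)
      by_cases hh : BtwR ρ (k i) a c ∧ BtwR ρ (k i) a (ρ c)
      · exact ⟨!i, hsep i a c ha n1 n2 hh.1 hh.2⟩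
      · refine ⟨i, ?_⟩
        simp only [SBtwR, BtwR] at f1 f2 hh
        omega
  constructor
  · exact h.eq
  · intro i a
    by_cases hc : cut i a
    · exact Or.inr (h.sep i a hc)
    · exact Or.inl (h.free i a hc)
  · intro a c n1 n2
    have n3 : a ≠ ρ c := by intro h; apply n2; rw [h, hr]
    by_cases h1 : ∃ i, cut i a
    · obtain ⟨i, h1⟩ := h1
      exact hone i a c h1 n1 n2
    by_cases h2 : ∃ i, cut i c
    · obtain ⟨i, h2⟩ := h2
      obtain ⟨j, hj⟩ := hone i c a h2 n1.symm n3
      exact ⟨j, hj.symm⟩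
    push Not at h1 h2
    refine ⟨true, ?_⟩
    have f1 := h.free true a (h1 true) c
    have f2 := h.free true a (h1 true) (ρ c)
    have f3 := h.free true c (h2 true) a
    have f4 := h.free true c (h2 true) (ρ a)
    have g1 := h.gap true a c (h1 true) (h2 true)
    have g2 := h.gap true a (ρ c) (h1 true) (fun hh => h2 true (by
      have := h.cutr _ _ hh; rwa [hr] at this))
    rw [hr] at g2
    have g1' : ¬ (k true a = k true c ∧ k true (ρ a) = k true (ρ c)) :=
      fun hh => n1 (g1 hh.1 hh.2).symm
    have g2' : ¬ (k true a = k true (ρ c) ∧ k true (ρ a) = k true c) :=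
      fun hh => n3 (g2 hh.1 hh.2)
    simp only [SBtwR] at f1 f2 f3 f4
    omega
  · exact h.bmin
  · exact h.emax

lemma exists_pushed {V : Type} [Fintype V] {ρ : V → V} {inv : Bool → V → V} {b e : Bool → V}
    {k : Bool → V → ℤ} (D : Dfct ρ inv b e) (L : Lay ρ inv b e k) :
    ∃ k', Lay ρ inv b e k' ∧ Pushed b e k' (Fintype.card V) := by
  let g : Bool → V → ℤ := fun i a => ((Finset.univ.filter (fun c => k i c < k i a)).card : ℤ)
  have g0 : ∀ i a, 0 ≤ g i a := fun i a => by positivity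
  have gN : ∀ i a, g i a ≤ Fintype.card V := fun i a => by
    have := Finset.card_le_univ (Finset.univ.filter (fun c => k i c < k i a))
    exact Int.ofNat_le.2 this
  have gm : ∀ i a c, k i a < k i c → g i a < g i c := by
    intro i a c h
    have : (Finset.univ.filter (fun x => k i x < k i a)).card <
        (Finset.univ.filter (fun x => k i x < k i c)).card := by
      apply Finset.card_lt_card
      rw [Finset.ssubset_iff_of_subset]
      · exact ⟨a, by simpa using h, by simp⟩
      · intro x hx
        simp only [Finset.mem_filter, Finset.mem_univ, true_and] at hx ⊢
        omega
    exact Int.ofNat_lt.2 this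
  have gm' : ∀ i a c, k i a ≤ k i c → g i a ≤ g i c := by
    intro i a c h
    have : (Finset.univ.filter (fun x => k i x < k i a)).card ≤
        (Finset.univ.filter (fun x => k i x < k i c)).card := by
      apply Finset.card_le_card
      intro x hx
      simp only [Finset.mem_filter, Finset.mem_univ, true_and] at hx ⊢
      omega
    exact Int.ofNat_le.2 this
  have hN : (1 : ℤ) ≤ Fintype.card V := by
    have : 0 < Fintype.card V := Fintype.card_pos_iff.2 ⟨b true⟩
    exact_mod_cast this
  refine ⟨fun i a => if a = b i then -(2 * (Fintype.card V : ℤ)) else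
    if a = e i then 3 * (Fintype.card V : ℤ) else g i a, ?_, ?_⟩
  · apply L.transfer
    intro i a c
    have b1 := L.bmin i a
    have b2 := L.bmin i c
    have e1 := L.emax i a
    have e2 := L.emax i c
    have m1 := gm i a c
    have m2 := gm' i c a
    have := g0 i a
    have := g0 i c
    have := gN i a
    have := gN i c
    have be := D.be i
    have bx := L.bmin i (e i) be.symm
    by_cases h1 : a = b i <;> by_cases h2 : a = e i <;> by_cases h3 : c = b i <;>
      by_cases h4 : c = e i <;> simp_all <;> omega
  · constructor
    · exact hN
    · intro i a h1 h2
      simp only [h1, h2, if_false]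
      exact ⟨g0 i a, gN i a⟩
    · intro i; simp
    · intro i
      simp [(D.be i).symm]

/-! ### Orders from ranked classes -/

section sys
variable {V : Type}

/-- position where the root chain of direction `i` is broken -/
def kap (ρ : V → V) (inv : Bool → V → V) (b : Bool → V) (i : Bool) : ℕ :=
  min (idx ρ (inv i) (b i) (b (!i))) (idx ρ (inv i) (b i) (ρ (b (!i))))

/-- the quantity minimised by starting points -/
def cost (ρ : V → V) (inv : Bool → V → V) (b e : Bool → V) (i : Bool) (t c : V) : ℕ :=
  if Rc ρ (inv i) (b i) c then
    (if idx ρ (inv i) (b i) c ≤ kap ρ inv b i then idx ρ (inv i) (b i) c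
      else kap ρ inv b i + 1 + (idx ρ (inv i) (b i) (e i) - idx ρ (inv i) (b i) c))
  else idx ρ (inv i) t c

/-- Ranked classes with starting points. -/
structure Sys (ρ : V → V) (inv : Bool → V → V) (b e : Bool → V) (rk : Bool → V → ℕ)
    (st : Bool → V → V) (R : ℕ) : Prop where
  D : Dfct ρ inv b e
  hmax : ∀ i, Rc ρ (inv i) (b i) (b (!i))
  rkeq : ∀ i a c, rk i a = rk i c ↔ Rc ρ (inv i) a c
  rkR : ∀ i a, rk i a < R
  rk2 : ∀ i a, ¬ Rc ρ (inv i) (b i) a → 2 ≤ rk i a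
  rk1 : ∀ i a, Rc ρ (inv i) (b i) a → rk i a ≤ 1
  strt : ∀ i, st i (b i) = b i
  stcl : ∀ i a c, Rc ρ (inv i) a c → st i a = st i c
  stm : ∀ i a, ¬ Rc ρ (inv i) (b i) a → Rc ρ (inv i) a (st i a)
  sts : ∀ i a, ¬ Rc ρ (inv i) (b i) a → rk (!i) (st i a) < rk i a
  stmin : ∀ i a c, ¬ Rc ρ (inv i) (b i) a → Rc ρ (inv i) a c → rk (!i) (st i a) ≤ rk (!i) c ∧
    (rk (!i) (st i a) = rk (!i) c → cost ρ inv b e (!i) (st (!i) (st i a)) (st i a) ≤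
      cost ρ inv b e (!i) (st (!i) (st i a)) c)

/-- block number -/
def blk (ρ : V → V) (inv : Bool → V → V) (b : Bool → V) (rk : Bool → V → ℕ) (R : ℕ)
    (i : Bool) (a : V) : ℕ :=
  if Rc ρ (inv i) (b i) a then
    (if idx ρ (inv i) (b i) a ≤ kap ρ inv b i then 0 else R)
  else rk i a

/-- the broken edges -/
def cutE (ρ : V → V) (inv : Bool → V → V) (b : Bool → V) (st : Bool → V → V)
    (i : Bool) (a : V) : Prop :=
  if Rc ρ (inv i) (b i) a then a = b (!i) ∨ ρ a = b (!i) else a = st i a ∨ ρ a = st i a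

variable {ρ : V → V} {inv : Bool → V → V} {b e : Bool → V} {rk : Bool → V → ℕ}
  {st : Bool → V → V} {R : ℕ}

namespace Sys

lemma rc_symm (S : Sys ρ inv b e rk st R) {i : Bool} {a c : V} (h : Rc ρ (inv i) a c) :
    Rc ρ (inv i) c a := Rc.symm S.D.rinv (S.D.iinv i) h

lemma fixb (S : Sys ρ inv b e rk st R) (i : Bool) : inv i (b i) = b i :=
  (S.D.fix i _).2 (Or.inl rfl)

lemma fixe (S : Sys ρ inv b e rk st R) (i : Bool) : inv i (e i) = e i :=
  (S.D.fix i _).2 (Or.inr rfl)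

/-- in the class of its start -/
lemma rc_st (S : Sys ρ inv b e rk st R) (i : Bool) (a : V) : Rc ρ (inv i) (st i a) a := by
  by_cases h : Rc ρ (inv i) (b i) a
  · rw [← S.stcl i _ _ h, S.strt]; exact h
  · exact S.rc_symm (S.stm i a h)

lemma st_root (S : Sys ρ inv b e rk st R) {i : Bool} {a : V} (h : Rc ρ (inv i) (b i) a) :
    st i a = b i := by rw [← S.stcl i _ _ h, S.strt]

lemma rc_e [Fintype V] (S : Sys ρ inv b e rk st R) (i : Bool) : Rc ρ (inv i) (b i) (e i) :=
  other_end S.D.rinv (S.D.iinv i) S.D.rne (S.D.be i) (S.D.fix i)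

lemma le_E [Fintype V] (S : Sys ρ inv b e rk st R) {i : Bool} {a : V}
    (h : Rc ρ (inv i) (b i) a) :
    idx ρ (inv i) (b i) a ≤ idx ρ (inv i) (b i) (e i) :=
  idx_max S.D.rinv (S.D.iinv i) (S.fixb i) (S.fixe i) (S.D.be i) (S.rc_e i) h

lemma step_root [Fintype V] (S : Sys ρ inv b e rk st R) {i : Bool} {a : V}
    (h : Rc ρ (inv i) (b i) a) :
    idx ρ (inv i) (b i) (ρ a) = idx ρ (inv i) (b i) a + 1 ∨
    idx ρ (inv i) (b i) a = idx ρ (inv i) (b i) (ρ a) + 1 :=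
  idx_step S.D.rinv (S.D.iinv i) S.D.rne (S.D.rni i) h (Or.inl (S.fixb i))

lemma blk_eq (S : Sys ρ inv b e rk st R) {i : Bool} {a c : V}
    (h : blk ρ inv b rk R i a = blk ρ inv b rk R i c) : Rc ρ (inv i) a c := by
  unfold blk at h
  have r1 := S.rkR i a
  have r2 := S.rkR i c
  have r3 := S.rk2 i a
  have r4 := S.rk2 i c
  by_cases ha : Rc ρ (inv i) (b i) a <;> by_cases hc : Rc ρ (inv i) (b i) c
  · exact (S.rc_symm ha).trans hc
  · rw [if_pos ha, if_neg hc] at h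
    have := r4 hc
    split_ifs at h <;> omega
  · rw [if_neg ha, if_pos hc] at h
    have := r3 ha
    split_ifs at h <;> omega
  · rw [if_neg ha, if_neg hc] at h
    exact (S.rkeq i a c).1 h

lemma root_rho (S : Sys ρ inv b e rk st R) {i : Bool} {a : V} :
    Rc ρ (inv i) (b i) (ρ a) ↔ Rc ρ (inv i) (b i) a := by
  constructor
  · intro h; have := h.trans (Rc.rho (ρ a)); rwa [S.D.rinv] at this
  · intro h; exact h.trans (Rc.rho a)

lemma st_rho (S : Sys ρ inv b e rk st R) (i : Bool) (a : V) : st i (ρ a) = st i a :=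
  (S.stcl i _ _ (Rc.rho a)).symm

lemma rk_rho (S : Sys ρ inv b e rk st R) (i : Bool) (a : V) : rk i (ρ a) = rk i a :=
  ((S.rkeq i _ _).2 (Rc.rho a)).symm

lemma cut_rho (S : Sys ρ inv b e rk st R) {i : Bool} {a : V} (h : cutE ρ inv b st i a) :
    cutE ρ inv b st i (ρ a) := by
  unfold cutE at *
  rw [S.root_rho, S.st_rho, S.D.rinv]
  split_ifs at * <;> tauto

lemma noncut_ok (S : Sys ρ inv b e rk st R) {i : Bool} {a : V} (h : ¬ cutE ρ inv b st i a) :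
    inv i (st i a) = st i a ∨ (a ≠ st i a ∧ ρ a ≠ st i a) := by
  by_cases hr : Rc ρ (inv i) (b i) a
  · left; rw [S.st_root hr]; exact S.fixb i
  · unfold cutE at h
    rw [if_neg hr] at h
    tauto

lemma noncut_step [Fintype V] (S : Sys ρ inv b e rk st R) {i : Bool} {a : V}
    (h : ¬ cutE ρ inv b st i a) :
    blk ρ inv b rk R i (ρ a) = blk ρ inv b rk R i a ∧
    (idx ρ (inv i) (st i a) (ρ a) = idx ρ (inv i) (st i a) a + 1 ∨
     idx ρ (inv i) (st i a) a = idx ρ (inv i) (st i a) (ρ a) + 1) := by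
  have h1 := idx_step S.D.rinv (S.D.iinv i) S.D.rne (S.D.rni i) (S.rc_st i a) (S.noncut_ok h)
  refine ⟨?_, h1⟩
  unfold blk
  rw [S.root_rho]
  by_cases hr : Rc ρ (inv i) (b i) a
  · rw [if_pos hr, if_pos hr]
    rw [S.st_root hr] at h1
    unfold cutE at h
    rw [if_pos hr] at h
    push Not at h
    have hs := S.step_root (S.hmax i)
    have hk : kap ρ inv b i = min (idx ρ (inv i) (b i) (b (!i)))
      (idx ρ (inv i) (b i) (ρ (b (!i)))) := rfl
    have hcontra : ∀ x y : V, Rc ρ (inv i) (b i) x → Rc ρ (inv i) (b i) y → x ≠ y →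
        ¬ (idx ρ (inv i) (b i) x = idx ρ (inv i) (b i) y ∧
        idx ρ (inv i) (b i) x < idx ρ (inv i) (b i) (ρ x) ∧
        idx ρ (inv i) (b i) y < idx ρ (inv i) (b i) (ρ y)) :=
      fun x y hx hy hne hh => hne (idx_gap S.D.rinv (S.D.iinv i) hx hy (Or.inl (S.fixb i))
        (Or.inl (S.fixb i)) hh.1 hh.2.1 hh.2.2)
    have hr' := (S.root_rho).2 hr
    have hm := S.hmax i
    have hm' := (S.root_rho).2 hm
    have n1 := h.1
    have n2 := h.2
    have n3 : a ≠ ρ (b (!i)) := by intro hh; apply n2; rw [hh, S.D.rinv]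
    have n4 : ρ a ≠ ρ (b (!i)) := by
      intro hh; apply n1; rw [← S.D.rinv a, hh, S.D.rinv]
    have c1 := hcontra a (b (!i)) hr hm n1
    have c2 := hcontra (ρ a) (b (!i)) hr' hm n2
    have c3 := hcontra a (ρ (b (!i))) hr hm' n3
    have c4 := hcontra (ρ a) (ρ (b (!i))) hr' hm' n4
    rw [S.D.rinv] at c2 c3 c4
    rw [S.D.rinv] at c4
    split_ifs <;> first | rfl | (exfalso; omega)
  · rw [if_neg hr, if_neg hr, S.rk_rho]

lemma not_cut_below (S : Sys ρ inv b e rk st R) {i : Bool} {y : V}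
    (h : ¬ Rc ρ (inv i) (b i) y) (hlt : rk (!i) y < rk i y) : ¬ cutE ρ inv b st (!i) y := by
  intro hc
  unfold cutE at hc
  by_cases hr : Rc ρ (inv (!i)) (b (!i)) y
  · rw [if_pos hr, Bool.not_not] at hc
    rcases hc with hc | hc
    · exact h (hc ▸ Rc.refl _)
    · exact h (S.root_rho.1 (hc ▸ Rc.refl _))
  · rw [if_neg hr] at hc
    have := S.sts (!i) y hr
    rw [Bool.not_not] at this
    rcases hc with hc | hc
    · rw [← hc] at this; omega
    · rw [← hc, S.rk_rho] at this; omega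

end Sys
end sys

section pre
variable {V : Type} {ρ : V → V} {inv : Bool → V → V} {b e : Bool → V} {rk : Bool → V → ℕ}
  {st : Bool → V → V} {R : ℕ}

lemma lex_lt {M : ℤ} {x y : ℕ} {p q : ℕ} (hp : (p : ℤ) < M) (hq : (q : ℤ) < M) :
    M * x + p < M * y + q ↔ x < y ∨ (x = y ∧ p < q) := by
  have hM : 0 < M := by omega
  constructor
  · intro h
    rcases lt_trichotomy x y with h1 | h1 | h1
    · exact Or.inl h1
    · subst h1; right; exact ⟨rfl, by omega⟩
    · exfalso
      have : (y : ℤ) + 1 ≤ x := by exact_mod_cast h1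
      nlinarith
  · rintro (h1 | ⟨rfl, h1⟩)
    · have : (x : ℤ) + 1 ≤ y := by exact_mod_cast h1
      nlinarith
    · have : (p : ℤ) < q := by exact_mod_cast h1
      linarith

namespace Sys

lemma blk_lower (S : Sys ρ inv b e rk st R) {i : Bool} {a : V}
    (h : blk ρ inv b rk R i a = 0) :
    Rc ρ (inv i) (b i) a := by
  by_contra hr
  unfold blk at h
  rw [if_neg hr] at h
  have := S.rk2 i a hr
  omega

lemma blk_upper (S : Sys ρ inv b e rk st R) {i : Bool} {a : V}
    (h : R ≤ blk ρ inv b rk R i a) :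
    Rc ρ (inv i) (b i) a := by
  by_contra hr
  unfold blk at h
  rw [if_neg hr] at h
  have := S.rkR i a
  omega

lemma blk_non {i : Bool} {a : V} (h : ¬ Rc ρ (inv i) (b i) a) :
    blk ρ inv b rk R i a = rk i a := by
  unfold blk; rw [if_neg h]

lemma blk_le (S : Sys ρ inv b e rk st R) (i : Bool) (a : V) : blk ρ inv b rk R i a ≤ R := by
  unfold blk
  have := S.rkR i a
  split_ifs <;> omega

lemma idx_eq' [Fintype V] (S : Sys ρ inv b e rk st R) {i : Bool} {a c : V}
    (hac : Rc ρ (inv i) a c) :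
    idx ρ (inv i) (st i a) a = idx ρ (inv i) (st i c) c ↔ c = a ∨ c = inv i a := by
  have h := S.stcl i a c hac
  have h2 := S.rc_st i c
  rw [← h] at h2 ⊢
  exact idx_eq S.D.rinv (S.D.iinv i) (S.rc_st i a) h2

/-- minimality of the break vertex in the other direction -/
lemma bmin' [Fintype V] (S : Sys ρ inv b e rk st R) (i : Bool) :
    blk ρ inv b rk R i (b i) = 0 ∧ idx ρ (inv i) (st i (b i)) (b i) = 0 ∧
    ∀ a, a ≠ b i → 0 < blk ρ inv b rk R i a ∨ 0 < idx ρ (inv i) (st i a) a := by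
  have h0 : idx ρ (inv i) (st i (b i)) (b i) = 0 := by rw [S.strt, idx_start]
  refine ⟨?_, h0, ?_⟩
  · unfold blk
    rw [if_pos (Rc.refl _), idx_start, if_pos (Nat.zero_le _)]
  · intro a ha
    by_contra hcon
    push Not at hcon
    have hr := S.blk_lower (i := i) (a := a) (by omega)
    have := (S.idx_eq' hr).1 (by omega)
    rw [S.fixb] at this
    tauto

lemma emax' [Fintype V] (S : Sys ρ inv b e rk st R) (i : Bool) :
    blk ρ inv b rk R i (e i) = R ∧
    ∀ a, a ≠ e i → blk ρ inv b rk R i a < R ∨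
      idx ρ (inv i) (st i a) a < idx ρ (inv i) (st i (e i)) (e i) := by
  have hre := S.rc_e i
  refine ⟨?_, ?_⟩
  · unfold blk
    rw [if_pos hre, if_neg]
    have h1 := S.step_root (S.hmax i)
    have h2 := S.le_E (S.hmax i)
    have h3 := S.le_E (S.root_rho.2 (S.hmax i))
    unfold kap
    omega
  · intro a ha
    by_contra hcon
    push Not at hcon
    have hr := S.blk_upper (i := i) (a := a) hcon.1
    have h2 := hcon.2
    have h3 := S.le_E hr
    have h4 := S.idx_eq' ((S.rc_symm hr).trans hre)
    rw [S.st_root hr, S.st_root hre] at h2 h4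
    have := h4.1 (by omega)
    rcases this with h | h
    · exact ha h.symm
    · apply ha
      rw [← S.D.iinv i a, ← h, S.fixe]

lemma gap' [Fintype V] (S : Sys ρ inv b e rk st R) {i : Bool} {a c : V}
    (hac : Rc ρ (inv i) a c) (ha : ¬ cutE ρ inv b st i a) (hc : ¬ cutE ρ inv b st i c)
    (h : idx ρ (inv i) (st i a) a = idx ρ (inv i) (st i c) c)
    (h1 : idx ρ (inv i) (st i a) a < idx ρ (inv i) (st i a) (ρ a))
    (h2 : idx ρ (inv i) (st i c) c < idx ρ (inv i) (st i c) (ρ c)) : a = c := by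
  have hs := S.stcl i a c hac
  have o1 := S.noncut_ok ha
  have o2 := S.noncut_ok hc
  have h3 := S.rc_st i c
  rw [← hs] at h h2 o2 h3
  exact idx_gap S.D.rinv (S.D.iinv i) (S.rc_st i a) h3 (by tauto) (by tauto) h h1 h2

/-- a member of the class above a lower class sits on an unbroken edge -/
lemma start_side [Fintype V] (S : Sys ρ inv b e rk st R) {i : Bool} {a : V}
    (hnr : ¬ Rc ρ (inv i) (b i) a) :
    (blk ρ inv b rk R (!i) (ρ (st i a)) = blk ρ inv b rk R (!i) (st i a)) ∧
    ((idx ρ (inv (!i)) (st (!i) (st i a)) (ρ (st i a)) =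
        idx ρ (inv (!i)) (st (!i) (st i a)) (st i a) + 1 ∧
      ∀ d, d ≠ st i a → Rc ρ (inv i) a d →
        blk ρ inv b rk R (!i) (st i a) < blk ρ inv b rk R (!i) d ∨
        (blk ρ inv b rk R (!i) (st i a) = blk ρ inv b rk R (!i) d ∧
         idx ρ (inv (!i)) (st (!i) (st i a)) (st i a) < idx ρ (inv (!i)) (st (!i) d) d)) ∨
     (idx ρ (inv (!i)) (st (!i) (st i a)) (st i a) =
        idx ρ (inv (!i)) (st (!i) (st i a)) (ρ (st i a)) + 1 ∧
      ∀ d, d ≠ st i a → Rc ρ (inv i) a d →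
        blk ρ inv b rk R (!i) d < blk ρ inv b rk R (!i) (st i a) ∨
        (blk ρ inv b rk R (!i) d = blk ρ inv b rk R (!i) (st i a) ∧
         idx ρ (inv (!i)) (st (!i) d) d < idx ρ (inv (!i)) (st (!i) (st i a)) (st i a)))) := by
  have hmem := S.stm i a hnr
  have hsts := S.sts i a hnr
  have hmin := fun c => S.stmin i a c hnr
  generalize hs : st i a = s at *
  have hrks : rk i s = rk i a := ((S.rkeq i _ _).2 hmem).symm
  have hnc : ∀ d, Rc ρ (inv i) a d → rk (!i) d = rk (!i) s → ¬ cutE ρ inv b st (!i) d := by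
    intro d hd hd'
    apply S.not_cut_below
    · intro h; exact hnr (h.trans (S.rc_symm hd))
    · rw [← (S.rkeq i _ _).2 hd]; omega
  generalize (!i) = j at *
  have hsr : Rc ρ (inv i) a (ρ s) := hmem.trans (Rc.rho s)
  have hstep := S.noncut_step (hnc s hmem rfl)
  have hms := (hmin (ρ s) hsr).2 (S.rk_rho j s).symm
  refine ⟨hstep.1, ?_⟩
  by_cases hT : Rc ρ (inv j) (b j) s
  · -- the lower class is a root
    have hst := S.st_root hT
    have hTr := (S.root_rho (a := s)).2 hT
    have e1 := S.le_E hT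
    have e2 := S.le_E hTr
    have hcs : ∀ t c, Rc ρ (inv j) (b j) c → cost ρ inv b e j t c =
      (if idx ρ (inv j) (b j) c ≤ kap ρ inv b j then idx ρ (inv j) (b j) c
      else kap ρ inv b j + 1 + (idx ρ (inv j) (b j) (e j) - idx ρ (inv j) (b j) c)) := by
      intro t c hc; unfold cost; rw [if_pos hc]
    have hbs : ∀ c, Rc ρ (inv j) (b j) c → blk ρ inv b rk R j c =
        (if idx ρ (inv j) (b j) c ≤ kap ρ inv b j then 0 else R) := by
      intro c hc; unfold blk; rw [if_pos hc]
    have hR : 0 < R := by have := S.rkR j s; omega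
    have hk1 := hstep.1
    have hk2 := hstep.2
    rw [hst] at hk2 hms ⊢
    rw [hcs _ _ hT, hcs _ _ hTr] at hms
    rw [hbs _ hT, hbs _ hTr] at hk1
    by_cases hlow : idx ρ (inv j) (b j) s ≤ kap ρ inv b j
    · left
      have hlow' : idx ρ (inv j) (b j) (ρ s) ≤ kap ρ inv b j := by
        by_contra hh; rw [if_pos hlow, if_neg hh] at hk1; omega
      rw [if_pos hlow, if_pos hlow'] at hms
      have hup : idx ρ (inv j) (b j) (ρ s) = idx ρ (inv j) (b j) s + 1 := by omega
      refine ⟨hup, ?_⟩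
      intro d hds hd
      by_cases hdT : Rc ρ (inv j) (b j) d
      · have hrk : rk j d = rk j s := (S.rkeq _ _ _).2 ((S.rc_symm hdT).trans hT)
        rw [hbs _ hT, hbs _ hdT, if_pos hlow]
        by_cases hld : idx ρ (inv j) (b j) d ≤ kap ρ inv b j
        · right
          rw [if_pos hld]
          refine ⟨rfl, ?_⟩
          have m1 := (hmin d hd).2 hrk.symm
          rw [hcs _ _ hT, hcs _ _ hdT, if_pos hlow, if_pos hld] at m1
          have hdr : Rc ρ (inv i) a (ρ d) := hd.trans (Rc.rho d)
          have hdTr := (S.root_rho (a := d)).2 hdT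
          have m2 := (hmin (ρ d) hdr).2 (by rw [S.rk_rho, hrk])
          rw [hcs _ _ hT, hcs _ _ hdTr, if_pos hlow] at m2
          have hsd := S.noncut_step (hnc d hd hrk)
          have std := S.st_root hdT
          rw [std] at hsd
          rw [hbs _ hdT, hbs _ hdTr, if_pos hld] at hsd
          have hld' : idx ρ (inv j) (b j) (ρ d) ≤ kap ρ inv b j := by
            by_contra hh; rw [if_neg hh] at hsd; omega
          rw [if_pos hld'] at m2
          rw [std]
          by_contra hcon
          have hE : idx ρ (inv j) (b j) s = idx ρ (inv j) (b j) d := by omega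
          apply hds
          symm
          have := S.gap' (i := j) (a := s) (c := d) ((S.rc_symm hT).trans hdT)
            (hnc s hmem rfl) (hnc d hd hrk)
          rw [hst, std] at this
          apply this hE <;> omega
        · left; rw [if_neg hld]; exact hR
      · left
        rw [hbs _ hT, if_pos hlow]
        by_contra hh
        exact hdT (S.blk_lower (by omega))
    · right
      have hlow' : ¬ idx ρ (inv j) (b j) (ρ s) ≤ kap ρ inv b j := by
        intro hh; rw [if_neg hlow, if_pos hh] at hk1; omega
      rw [if_neg hlow, if_neg hlow'] at hms
      have hup : idx ρ (inv j) (b j) s = idx ρ (inv j) (b j) (ρ s) + 1 := by omega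
      refine ⟨hup, ?_⟩
      intro d hds hd
      by_cases hdT : Rc ρ (inv j) (b j) d
      · have hrk : rk j d = rk j s := (S.rkeq _ _ _).2 ((S.rc_symm hdT).trans hT)
        rw [hbs _ hT, hbs _ hdT, if_neg hlow]
        have m1 := (hmin d hd).2 hrk.symm
        rw [hcs _ _ hT, hcs _ _ hdT, if_neg hlow] at m1
        by_cases hld : idx ρ (inv j) (b j) d ≤ kap ρ inv b j
        · left; rw [if_pos hld]; exact hR
        · right
          rw [if_neg hld]
          refine ⟨rfl, ?_⟩
          rw [if_neg hld] at m1
          have hdr : Rc ρ (inv i) a (ρ d) := hd.trans (Rc.rho d)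
          have hdTr := (S.root_rho (a := d)).2 hdT
          have m2 := (hmin (ρ d) hdr).2 (by rw [S.rk_rho, hrk])
          rw [hcs _ _ hT, hcs _ _ hdTr, if_neg hlow] at m2
          have hsd := S.noncut_step (hnc d hd hrk)
          have std := S.st_root hdT
          rw [std] at hsd
          rw [hbs _ hdT, hbs _ hdTr, if_neg hld] at hsd
          have hld' : ¬ idx ρ (inv j) (b j) (ρ d) ≤ kap ρ inv b j := by
            intro hh; rw [if_pos hh] at hsd; omega
          rw [if_neg hld'] at m2
          rw [std]
          have e3 := S.le_E hdT
          have e4 := S.le_E hdTr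
          by_contra hcon
          have hE : idx ρ (inv j) (b j) s = idx ρ (inv j) (b j) d := by omega
          apply hds
          have := S.gap' (i := j) (a := ρ s) (c := ρ d) ((S.rc_symm hTr).trans hdTr)
            (fun h => hnc s hmem rfl (by simpa [S.D.rinv] using S.cut_rho h))
            (fun h => hnc d hd hrk (by simpa [S.D.rinv] using S.cut_rho h))
          rw [S.st_rho, S.st_rho, hst, std, S.D.rinv, S.D.rinv] at this
          have h5 : ρ s = ρ d := by apply this <;> omega
          rw [← S.D.rinv d, ← h5, S.D.rinv]
      · left
        rw [hbs _ hT, if_neg hlow]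
        by_contra hh
        exact hdT (S.blk_upper (by omega))
  · -- the lower class is not a root
    left
    have hTr := fun h => hT ((S.root_rho (a := s)).1 h)
    have hcs : ∀ t c, ¬ Rc ρ (inv j) (b j) c → cost ρ inv b e j t c = idx ρ (inv j) t c := by
      intro t c hc; unfold cost; rw [if_neg hc]
    rw [hcs _ _ hT, hcs _ _ hTr] at hms
    have hk2 := hstep.2
    have hup : idx ρ (inv j) (st j s) (ρ s) = idx ρ (inv j) (st j s) s + 1 := by omega
    refine ⟨hup, ?_⟩
    intro d hds hd
    have m0 := hmin d hd
    have hdT : ¬ Rc ρ (inv j) (b j) d := by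
      intro h
      have := S.rk1 j d h
      have := S.rk2 j s hT
      omega
    rw [blk_non hT, blk_non hdT]
    rcases m0.1.lt_or_eq with hlt | hrk
    · exact Or.inl hlt
    · right
      refine ⟨hrk, ?_⟩
      have m1 := m0.2 hrk
      have hdr : Rc ρ (inv i) a (ρ d) := hd.trans (Rc.rho d)
      have hdTr := fun h => hdT ((S.root_rho (a := d)).1 h)
      have m2 := (hmin (ρ d) hdr).2 (by rw [S.rk_rho, hrk])
      rw [hcs _ _ hT, hcs _ _ hdT] at m1
      rw [hcs _ _ hT, hcs _ _ hdTr] at m2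
      have hsd := (S.noncut_step (hnc d hd hrk.symm)).2
      have hcl := (S.rkeq _ _ _).1 hrk
      have std := S.stcl _ _ _ hcl
      by_contra hcon
      apply hds
      symm
      have := S.gap' (i := j) (a := s) (c := d) hcl (hnc s hmem rfl) (hnc d hd hrk.symm)
      rw [← std] at this hsd hcon
      apply this <;> omega

end Sys
end pre

section pre2
variable {V : Type} {ρ : V → V} {inv : Bool → V → V} {b e : Bool → V} {rk : Bool → V → ℕ}
  {st : Bool → V → V} {R : ℕ}

/-- the combined order -/
def key (ρ : V → V) (inv : Bool → V → V) (b : Bool → V) (rk : Bool → V → ℕ) (st : Bool → V → V)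
    (R : ℕ) (M : ℤ) (i : Bool) (a : V) : ℤ :=
  M * (blk ρ inv b rk R i a : ℕ) + (idx ρ (inv i) (st i a) a : ℕ)

theorem Sys.pre [Fintype V] (S : Sys ρ inv b e rk st R) {M : ℤ}
    (hM : ∀ i s a, (idx ρ (inv i) s a : ℤ) < M) :
    Pre ρ inv b e (key ρ inv b rk st R M) (cutE ρ inv b st) := by
  have hlt : ∀ i a c, key ρ inv b rk st R M i a < key ρ inv b rk st R M i c ↔
      blk ρ inv b rk R i a < blk ρ inv b rk R i c ∨ (blk ρ inv b rk R i a = blk ρ inv b rk R i c ∧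
        idx ρ (inv i) (st i a) a < idx ρ (inv i) (st i c) c) := by
    intro i a c
    exact lex_lt (hM i _ a) (hM i _ c)
  have hle : ∀ i a c, key ρ inv b rk st R M i a ≤ key ρ inv b rk st R M i c ↔
      blk ρ inv b rk R i a < blk ρ inv b rk R i c ∨ (blk ρ inv b rk R i a = blk ρ inv b rk R i c ∧
        idx ρ (inv i) (st i a) a ≤ idx ρ (inv i) (st i c) c) := by
    intro i a c
    rw [← not_lt, hlt]
    omega
  have heq : ∀ i a c, key ρ inv b rk st R M i a = key ρ inv b rk st R M i c ↔
      (blk ρ inv b rk R i a = blk ρ inv b rk R i c ∧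
        idx ρ (inv i) (st i a) a = idx ρ (inv i) (st i c) c) := by
    intro i a c
    rw [le_antisymm_iff, hle, hle]
    omega
  have hrootblk : ∀ i, (blk ρ inv b rk R i (b (!i)) = 0 ∧ blk ρ inv b rk R i (ρ (b (!i))) = R) ∨
      (blk ρ inv b rk R i (b (!i)) = R ∧ blk ρ inv b rk R i (ρ (b (!i))) = 0) := by
    intro i
    have h1 := S.step_root (S.hmax i)
    unfold blk
    rw [if_pos (S.hmax i), if_pos (S.root_rho.2 (S.hmax i))]
    unfold kap
    rcases h1 with h1 | h1 <;> rw [h1]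
    · left; rw [if_pos (by omega), if_neg (by omega)]; exact ⟨rfl, rfl⟩
    · right; rw [if_neg (by omega), if_pos (by omega)]; exact ⟨rfl, rfl⟩
  have hcutroot : ∀ i a, Rc ρ (inv i) (b i) a → cutE ρ inv b st i a →
      (a = b (!i) ∨ a = ρ (b (!i))) := by
    intro i a hr h
    unfold cutE at h
    rw [if_pos hr] at h
    rcases h with h | h
    · exact Or.inl h
    · right; rw [← h, S.D.rinv]
  have hcutnon : ∀ i a, ¬ Rc ρ (inv i) (b i) a → cutE ρ inv b st i a →
      (a = st i a ∨ a = ρ (st i a)) := by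
    intro i a hr h
    unfold cutE at h
    rw [if_neg hr] at h
    rcases h with h | h
    · exact Or.inl h
    · right; rw [← h, S.D.rinv]
  have hspan : ∀ i a, Rc ρ (inv i) (b i) a → cutE ρ inv b st i a → ∀ c,
      ¬ Rc ρ (inv i) (b i) c → BtwR ρ (key ρ inv b rk st R M i) a c := by
    intro i a hr h c hc
    have h1 := hrootblk i
    have h2 := Sys.blk_non (rk := rk) (R := R) hc
    have h3 := S.rk2 i c hc
    have h4 := S.rkR i c
    simp only [BtwR, hle]
    rcases hcutroot i a hr h with rfl | rfl
    · omega
    · rw [S.D.rinv]; omega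
  constructor
  · -- eq
    intro i a c
    rw [heq]
    constructor
    · rintro ⟨h1, h2⟩
      exact (S.idx_eq' (S.blk_eq h1)).1 h2
    · intro h
      have hac : Rc ρ (inv i) a c := by
        rcases h with rfl | rfl
        · exact Rc.refl _
        · exact Rc.bet _
      have h2 := (S.idx_eq' hac).2 h
      refine ⟨?_, h2⟩
      unfold blk
      by_cases hr : Rc ρ (inv i) (b i) a
      · have hr' := hr.trans hac
        rw [if_pos hr, if_pos hr']
        rw [S.st_root hr, S.st_root hr'] at h2
        rw [h2]
      · have hr' : ¬ Rc ρ (inv i) (b i) c := fun hh => hr (hh.trans (S.rc_symm hac))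
        rw [if_neg hr, if_neg hr']
        exact (S.rkeq _ _ _).2 hac
  · intro i a h; exact S.cut_rho h
  · -- free
    intro i a h d
    have h1 := S.noncut_step h
    have h2 := S.st_rho i a
    simp only [SBtwR, hlt, h2]
    omega
  · -- gap
    intro i a c ha hc h1 h2
    rw [heq] at h1 h2
    have hac := S.blk_eq h1.1
    have s1 := (S.noncut_step ha).2
    have s2 := (S.noncut_step hc).2
    have g1 := S.gap' hac ha hc h1.2
    have g2 := S.gap' (i := i) (a := ρ a) (c := ρ c) (S.blk_eq h2.1)
      (fun h => ha (by simpa [S.D.rinv] using S.cut_rho h))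
      (fun h => hc (by simpa [S.D.rinv] using S.cut_rho h)) h2.2
    rw [S.st_rho, S.st_rho] at h2 g2
    rw [S.D.rinv, S.D.rinv] at g2
    have h12 := h1.2
    have h22 := h2.2
    rcases s1 with s1 | s1
    · exact g1 (by omega) (by omega)
    · have := g2 (by omega) (by omega)
      rw [← S.D.rinv a, this, S.D.rinv]
  · -- sep
    intro i a hcut
    by_cases hr : Rc ρ (inv i) (b i) a
    · have hca := hcutroot i a hr hcut
      refine ⟨b (!i), ?_, Or.inl ?_⟩
      · rcases hca with h | h
        · exact Or.inl h.symm
        · right; rw [h, S.D.rinv]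
      · have hnc : ¬ cutE ρ inv b st (!i) (b (!i)) := by
          unfold cutE
          rw [if_pos (Rc.refl _), Bool.not_not]
          rintro (h | h)
          · exact S.D.bb i h.symm
          · have := S.D.rb (!i)
            rw [Bool.not_not] at this
            exact this h
        have hs := S.noncut_step hnc
        have hm := S.bmin' (!i)
        have hst := S.st_rho (!i) (b (!i))
        refine ⟨?_, ?_⟩
        · rw [hlt, hst]; omega
        · intro d hd _
          rw [hle, hst]
          have := hm.2.2 d hd
          omega
    · have hca := hcutnon i a hr hcut
      have hss := S.start_side hr
      have hbtw : ∀ d, BtwR ρ (key ρ inv b rk st R M i) a d → Rc ρ (inv i) a d := by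
        intro d hd
        have h1 := Sys.blk_non (rk := rk) (R := R) hr
        have h2 := Sys.blk_non (rk := rk) (R := R) (fun h => hr ((S.root_rho (a := a)).1 h))
        rw [S.rk_rho] at h2
        simp only [BtwR, hle] at hd
        exact S.blk_eq (by omega)
      have hst := S.st_rho (!i) (st i a)
      refine ⟨st i a, ?_, ?_⟩
      · rcases hca with h | h
        · exact Or.inl h.symm
        · right
          have h' := congrArg ρ h
          rw [S.D.rinv] at h'
          exact h'.symm
      · obtain ⟨hb, ⟨h1, h2⟩ | ⟨h1, h2⟩⟩ := hss
        · left
          refine ⟨?_, ?_⟩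
          · rw [hlt, hst]; omega
          · intro d hd hd'
            have := h2 d hd (hbtw d hd')
            rw [hle, hst]; omega
        · right
          refine ⟨?_, ?_⟩
          · rw [hlt, hst]; omega
          · intro d hd hd'
            have := h2 d hd (hbtw d hd')
            rw [hle, hst]; omega
  · -- two
    intro i a c ha hc n1 n2
    by_cases hra : Rc ρ (inv i) (b i) a <;> by_cases hrc : Rc ρ (inv i) (b i) c
    · exfalso
      rcases hcutroot i a hra ha with h | h <;> rcases hcutroot i c hrc hc with h' | h'
      · exact n1 (h'.trans h.symm)
      · exact n2 (by rw [h', h])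
      · exact n2 (by rw [h', h, S.D.rinv])
      · exact n1 (h'.trans h.symm)
    · right; right; left
      exact ⟨hspan i a hra ha c hrc, hspan i a hra ha _ (fun h => hrc (S.root_rho.1 h))⟩
    · right; right; right
      exact ⟨hspan i c hrc hc a hra, hspan i c hrc hc _ (fun h => hra (S.root_rho.1 h))⟩
    · have b1 := Sys.blk_non (rk := rk) (R := R) hra
      have b2 := Sys.blk_non (rk := rk) (R := R) (fun h => hra ((S.root_rho (a := a)).1 h))
      have b3 := Sys.blk_non (rk := rk) (R := R) hrc
      have b4 := Sys.blk_non (rk := rk) (R := R) (fun h => hrc ((S.root_rho (a := c)).1 h))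
      rw [S.rk_rho] at b2 b4
      simp only [hle]
      rcases lt_trichotomy (rk i a) (rk i c) with h | h | h
      · left; omega
      · exfalso
        have := S.stcl _ _ _ ((S.rkeq _ _ _).1 h)
        have h1 := hcutnon i a hra ha
        have h2 := hcutnon i c hrc hc
        rw [this] at h1
        rcases h1 with h | h <;> rcases h2 with h' | h'
        · exact n1 (h'.trans h.symm)
        · exact n2 (by rw [h', ← h])
        · exact n2 (by rw [h, S.D.rinv]; exact h')
        · exact n1 (h'.trans h.symm)
      · right; left; omega
  · intro i a ha
    have hm := S.bmin' i
    have := hm.2.2 a ha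
    rw [hlt]; omega
  · intro i a ha
    have hm := S.emax' i
    have := hm.2 a ha
    have := S.blk_le i a
    rw [hlt]; omega

end pre2

/-! ### Existence of ranks and starting points -/

lemma exists_rank {O : Type} [Finite O] (adj : O → O → Prop) (r0 r1 : O) (hne : r0 ≠ r1) :
    ∃ rk : O → ℕ, Function.Injective rk ∧ rk r0 = 0 ∧ rk r1 = 1 ∧
      ∀ X, (∀ P : O → Prop, P r0 → (∀ X Y, adj X Y → P X → P Y) → P X) → X ≠ r0 → X ≠ r1 →
        2 ≤ rk X ∧ ∃ Y, adj Y X ∧ rk Y < rk X := by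
  obtain ⟨M, ⟨f⟩⟩ := Finite.exists_equiv_fin O
  let rch : ℕ → O → Prop := fun n => Nat.rec (fun X => X = r0)
    (fun _ p X => ∃ Y, p Y ∧ adj Y X) n
  have r0' : ∀ X, rch 0 X ↔ X = r0 := fun X => Iff.rfl
  have rs : ∀ n X, rch (n + 1) X ↔ ∃ Y, rch n Y ∧ adj Y X := fun n X => Iff.rfl
  let lev : O → ℕ := fun X => sInf {n | rch n X}
  let rk : O → ℕ := fun X => if X = r0 then 0 else if X = r1 then 1 else 2 + (lev X * M + (f X : ℕ))
  have k0 : rk r0 = 0 := if_pos rfl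
  have k1 : rk r1 = 1 := (if_neg hne.symm).trans (if_pos rfl)
  have k2 : ∀ X, X ≠ r0 → X ≠ r1 → rk X = 2 + (lev X * M + (f X : ℕ)) := by
    intro X h1 h2; simp only [rk]; rw [if_neg h1, if_neg h2]
  refine ⟨rk, ?_, k0, k1, ?_⟩
  · intro X Y h
    by_cases h1 : X = r0 <;> by_cases h2 : X = r1 <;> by_cases h3 : Y = r0 <;> by_cases h4 : Y = r1
    all_goals first
      | (exfalso; exact hne (h1.symm.trans h2))
      | (exfalso; exact hne (h3.symm.trans h4))
      | exact h1.trans h3.symm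
      | exact h2.trans h4.symm
      | skip
    · rw [h1, h4, k0, k1] at h; omega
    · rw [h1, k0, k2 Y h3 h4] at h; omega
    · rw [h2, h3, k0, k1] at h; omega
    · rw [h2, k1, k2 Y h3 h4] at h; omega
    · rw [h3, k0, k2 X h1 h2] at h; omega
    · rw [h4, k1, k2 X h1 h2] at h; omega
    · rw [k2 X h1 h2, k2 Y h3 h4] at h
      have h : lev X * M + (f X : ℕ) = lev Y * M + (f Y : ℕ) := by omega
      have h := congrArg (· % M) h
      simp only [Nat.mul_add_mod_self_right, Nat.mod_eq_of_lt (f X).2, Nat.mod_eq_of_lt (f Y).2] at h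
      exact f.injective (Fin.ext h)
  · intro X hX h1 h2
    have hk := k2 X h1 h2
    refine ⟨by omega, ?_⟩
    have hr : ∃ n, rch n X := by
      apply hX (fun X => ∃ n, rch n X)
      · exact ⟨0, rfl⟩
      · rintro X Y h ⟨n, hn⟩
        exact ⟨n + 1, X, hn, h⟩
    have hl : rch (lev X) X := Nat.sInf_mem (s := {n | rch n X}) hr
    generalize hL : lev X = L at hl hk
    cases L with
    | zero => exact absurd ((r0' X).1 hl) h1
    | succ n =>
      obtain ⟨Y, hY, ha⟩ := (rs n X).1 hl
      refine ⟨Y, ha, ?_⟩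
      have hlY : lev Y ≤ n := Nat.sInf_le hY
      by_cases h3 : Y = r0
      · rw [h3, k0]; omega
      by_cases h4 : Y = r1
      · rw [h4, k1]; omega
      rw [k2 Y h3 h4, hk]
      have := (f Y).2
      have : lev Y * M ≤ n * M := Nat.mul_le_mul_right _ hlY
      have : (n + 1) * M = n * M + M := by ring
      omega

lemma exists_rec {O V : Type} [Nonempty V] (rk : O → ℕ) (Good : O → (O → V) → V → Prop)
    (hex : ∀ X st, ∃ v, Good X st v)
    (hloc : ∀ X st st' v, (∀ Y, rk Y < rk X → st Y = st' Y) → Good X st v → Good X st' v) :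
    ∃ st, ∀ X, Good X st (st X) := by
  let F : (X : O) → ((Y : O) → rk Y < rk X → V) → V := fun X rec =>
    Classical.choose (hex X (fun Y => if h : rk Y < rk X then rec Y h else Classical.arbitrary V))
  let st : O → V := (measure rk).wf.fix F
  have hst : ∀ X, st X = F X (fun Y _ => st Y) := fun X => WellFounded.fix_eq _ _ _
  refine ⟨st, ?_⟩
  intro X
  have := Classical.choose_spec
    (hex X (fun Y => if h : rk Y < rk X then st Y else Classical.arbitrary V))
  rw [hst X]
  refine hloc X _ st _ ?_ this
  intro Y hY
  simp [hY]

lemma exists_lexmin {V : Type} [Finite V] (S : Set V) (hS : S.Nonempty) (f g : V → ℕ) :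
    ∃ s ∈ S, ∀ c ∈ S, f s ≤ f c ∧ (f s = f c → g s ≤ g c) := by
  obtain ⟨s, hs, h1⟩ := Set.exists_min_image S f S.toFinite hS
  obtain ⟨t, ht, h2⟩ := Set.exists_min_image {c ∈ S | f c = f s} g (Set.toFinite _) ⟨s, hs, rfl⟩
  refine ⟨t, ht.1, ?_⟩
  intro c hc
  have := h1 c hc
  refine ⟨by rw [ht.2]; exact this, ?_⟩
  intro h
  exact h2 c ⟨hc, by rw [← h, ht.2]⟩

section exsys
variable {V : Type} {ρ : V → V} {inv : Bool → V → V} {b e : Bool → V}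

theorem exists_sys [Fintype V] (D : Dfct ρ inv b e)
    (hmax : ∀ i, Rc ρ (inv i) (b i) (b (!i)))
    (hconn : ∀ P : V → Prop, (∀ x, P x → P (ρ x)) → (∀ i x, P x → P (inv i x)) →
      P (b false) → ∀ x, P x) :
    ∃ rk st R, Sys ρ inv b e rk st R := by
  let mk : Bool → V → Bool × Set V := fun i a => (i, {c | Rc ρ (inv i) a c})
  have mk_eq : ∀ i a c, mk i a = mk i c ↔ Rc ρ (inv i) a c := by
    intro i a c
    constructor
    · intro h
      have h2 : {x | Rc ρ (inv i) a x} = {x | Rc ρ (inv i) c x} := congrArg Prod.snd h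
      have : c ∈ {x | Rc ρ (inv i) a x} := by rw [h2]; exact Rc.refl c
      exact this
    · intro h
      have : {x | Rc ρ (inv i) a x} = {x | Rc ρ (inv i) c x} := by
        ext x
        exact ⟨fun hx => (Rc.symm D.rinv (D.iinv i) h).trans hx, fun hx => h.trans hx⟩
      simp only [mk, this]
  have mk_ne : ∀ i a c, mk i a ≠ mk (!i) c := by
    intro i a c h
    have : i = !i := congrArg Prod.fst h
    cases i <;> simp at this
  let adj : Bool × Set V → Bool × Set V → Prop := fun X Y => ∃ i a, X = mk i a ∧ Y = mk (!i) a
  obtain ⟨rk, rinj, rk0, rk1, hrk⟩ := exists_rank adj (mk false (b false)) (mk true (b true))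
    (mk_ne false _ _)
  have hroot01 : ∀ i, rk (mk i (b i)) ≤ 1 := by
    intro i; cases i
    · rw [rk0]; omega
    · rw [rk1]
  have hreach : ∀ i a, (∀ P : Bool × Set V → Prop, P (mk false (b false)) →
      (∀ X Y, adj X Y → P X → P Y) → P (mk i a)) := by
    intro i a P h0 hP
    have hh : ∀ a, P (mk false a) ∧ P (mk true a) := by
      refine hconn (fun a => P (mk false a) ∧ P (mk true a)) ?_ ?_ ?_
      · intro x hx
        rw [← (mk_eq false _ _).2 (Rc.rho x), ← (mk_eq true _ _).2 (Rc.rho x)]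
        exact hx
      · intro j x hx
        cases j
        · have h1 : P (mk false (inv false x)) := by
            rw [← (mk_eq false _ _).2 (Rc.bet x)]; exact hx.1
          exact ⟨h1, hP _ _ ⟨false, _, rfl, rfl⟩ h1⟩
        · have h1 : P (mk true (inv true x)) := by
            rw [← (mk_eq true _ _).2 (Rc.bet x)]; exact hx.2
          exact ⟨hP _ _ ⟨true, _, rfl, rfl⟩ h1, h1⟩
      · exact ⟨h0, hP _ _ ⟨false, _, rfl, rfl⟩ h0⟩
    cases i
    · exact (hh a).1
    · exact (hh a).2
  have hnon : ∀ i a, ¬ Rc ρ (inv i) (b i) a → 2 ≤ rk (mk i a) ∧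
      ∃ c, Rc ρ (inv i) a c ∧ rk (mk (!i) c) < rk (mk i a) := by
    intro i a h
    have h1 : mk i a ≠ mk i (b i) := fun hh => h ((mk_eq i _ _).1 hh.symm)
    have h2 : mk i a ≠ mk (!i) (b (!i)) := mk_ne i _ _
    have := hrk (mk i a) (hreach i a) (by cases i; exacts [h1, h2]) (by cases i; exacts [h2, h1])
    obtain ⟨h3, Y, ⟨j, c, rfl, hY⟩, hlt⟩ := this
    have hij : i = !j := congrArg Prod.fst hY
    subst hij
    refine ⟨h3, c, (mk_eq _ _ _).1 hY, ?_⟩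
    rw [Bool.not_not]; exact hlt
  -- starting points
  let Good : Bool × Set V → (Bool × Set V → V) → V → Prop := fun X st v =>
    (X = mk X.1 (b X.1) → v = b X.1) ∧
    (X ≠ mk X.1 (b X.1) → X.2.Nonempty → v ∈ X.2 ∧ ∀ c ∈ X.2,
      rk (mk (!X.1) v) ≤ rk (mk (!X.1) c) ∧ (rk (mk (!X.1) v) = rk (mk (!X.1) c) →
        rk (mk (!X.1) v) < rk X →
        cost ρ inv b e (!X.1) (st (mk (!X.1) v)) v ≤ cost ρ inv b e (!X.1) (st (mk (!X.1) v)) c))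
  have hV : Nonempty V := ⟨b true⟩
  obtain ⟨st, hst⟩ := exists_rec rk Good (by
    intro X st
    by_cases h : X = mk X.1 (b X.1)
    · exact ⟨b X.1, fun _ => rfl, fun h' => absurd h h'⟩
    · by_cases hne : X.2.Nonempty
      · obtain ⟨s, hs, h1⟩ := exists_lexmin X.2 hne (fun c => rk (mk (!X.1) c))
          (fun c => cost ρ inv b e (!X.1) (st (mk (!X.1) c)) c)
        refine ⟨s, fun h' => absurd h' h, fun _ _ => ⟨hs, fun c hc => ⟨(h1 c hc).1, ?_⟩⟩⟩
        intro h2 _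
        have := (h1 c hc).2 h2
        rw [← rinj h2] at this
        exact this
      · exact ⟨b true, fun h' => absurd h' h, fun _ h' => absurd h' hne⟩) (by
    intro X st st' v hl hg
    refine ⟨hg.1, fun h h' => ⟨(hg.2 h h').1, fun c hc => ⟨((hg.2 h h').2 c hc).1, ?_⟩⟩⟩
    intro h1 h2
    rw [← hl _ h2]
    exact ((hg.2 h h').2 c hc).2 h1 h2)
  have hg : ∀ i a, ¬ Rc ρ (inv i) (b i) a → st (mk i a) ∈ {c | Rc ρ (inv i) a c} ∧
      ∀ c ∈ {c | Rc ρ (inv i) a c},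
      rk (mk (!i) (st (mk i a))) ≤ rk (mk (!i) c) ∧ (rk (mk (!i) (st (mk i a))) = rk (mk (!i) c) →
        rk (mk (!i) (st (mk i a))) < rk (mk i a) →
        cost ρ inv b e (!i) (st (mk (!i) (st (mk i a)))) (st (mk i a)) ≤
          cost ρ inv b e (!i) (st (mk (!i) (st (mk i a)))) c) := by
    intro i a h
    exact (hst (mk i a)).2 (fun hh => h ((mk_eq i _ _).1 hh.symm)) ⟨a, Rc.refl a⟩
  have hR : ∃ R, ∀ X, rk X < R := by
    obtain ⟨R, hR⟩ := (Set.finite_range rk).bddAbove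
    exact ⟨R + 1, fun X => Nat.lt_succ_of_le (hR ⟨X, rfl⟩)⟩
  obtain ⟨R, hR⟩ := hR
  have hsts : ∀ i a, ¬ Rc ρ (inv i) (b i) a → rk (mk (!i) (st (mk i a))) < rk (mk i a) := by
    intro i a h
    obtain ⟨_, c, hc, hlt⟩ := hnon i a h
    exact lt_of_le_of_lt ((hg i a h).2 c hc).1 hlt
  refine ⟨fun i a => rk (mk i a), fun i a => st (mk i a), R, ?_⟩
  constructor
  · exact D
  · exact hmax
  · intro i a c
    rw [← mk_eq]
    exact ⟨fun h => rinj h, fun h => by rw [h]⟩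
  · intro i a; exact hR _
  · intro i a h; exact (hnon i a h).1
  · intro i a h
    rw [← (mk_eq i _ _).2 h]; exact hroot01 i
  · intro i; exact (hst (mk i (b i))).1 rfl
  · intro i a c h
    simp only [(mk_eq i _ _).2 h]
  · intro i a h; exact (hg i a h).1
  · exact hsts
  · intro i a c h hc
    have := (hg i a h).2 c hc
    exact ⟨this.1, fun hh => this.2 hh (hsts i a h)⟩

theorem exists_layout [Fintype V] (D : Dfct ρ inv b e)
    (hmax : ∀ i, Rc ρ (inv i) (b i) (b (!i)))
    (hconn : ∀ P : V → Prop, (∀ x, P x → P (ρ x)) → (∀ i x, P x → P (inv i x)) →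
      P (b false) → ∀ x, P x) :
    ∃ k, Lay ρ inv b e k ∧ Pushed b e k (Fintype.card V) := by
  obtain ⟨rk, st, R, S⟩ := exists_sys D hmax hconn
  have hM : ∃ M : ℤ, ∀ i s a, (idx ρ (inv i) s a : ℤ) < M := by
    obtain ⟨M, hM⟩ := (Set.finite_range
      (fun x : Bool × V × V => idx ρ (inv x.1) x.2.1 x.2.2)).bddAbove
    refine ⟨M + 1, fun i s a => ?_⟩
    have : idx ρ (inv i) s a ≤ M := hM ⟨(i, s, a), rfl⟩
    omega
  obtain ⟨M, hM⟩ := hM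
  exact exists_pushed D ((S.pre hM).lay D.rinv)

end exsys

/-! ### Making the root chains meet -/

section move
variable {V : Type} {ρ : V → V} {inv : Bool → V → V} {b e : Bool → V}

/-- modified involution -/
def minv (inv : Bool → V → V) (b : Bool → V) (i : Bool) (j : Bool) (x : V) : V :=
  if j = i then
    (if x = b i then b (!i) else if x = b (!i) then b i else
      if x = inv i (b (!i)) then x else inv i x)
  else inv j x

/-- modified end -/
def mb (inv : Bool → V → V) (b : Bool → V) (i : Bool) (j : Bool) : V :=
  if j = i then inv i (b (!i)) else b j

lemma minv_other (i : Bool) : minv inv b i (!i) = inv (!i) := by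
  funext x; unfold minv; rw [if_neg (by cases i <;> simp)]

lemma mb_self (i : Bool) : mb inv b i i = inv i (b (!i)) := if_pos rfl

lemma mb_other (i : Bool) : mb inv b i (!i) = b (!i) := if_neg (by cases i <;> simp)

lemma minv_b (i : Bool) : minv inv b i i (b i) = b (!i) := by
  unfold minv; rw [if_pos rfl, if_pos rfl]

lemma minv_b' {i : Bool} (h : b (!i) ≠ b i) : minv inv b i i (b (!i)) = b i := by
  unfold minv; rw [if_pos rfl, if_neg h, if_pos rfl]

lemma minv_w {i : Bool} (h : inv i (b (!i)) ≠ b i) (h' : inv i (b (!i)) ≠ b (!i)) :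
    minv inv b i i (inv i (b (!i))) = inv i (b (!i)) := by
  unfold minv; rw [if_pos rfl, if_neg h, if_neg h', if_pos rfl]

lemma minv_rest {i : Bool} {x : V} (h : x ≠ b i) (h' : x ≠ b (!i)) (h'' : x ≠ inv i (b (!i))) :
    minv inv b i i x = inv i x := by
  unfold minv; rw [if_pos rfl, if_neg h, if_neg h', if_neg h'']

theorem move [Fintype V] {G : SimpleGraph V} (D : Dfct ρ inv b e) (C : Cover G ρ inv b e) (i : Bool)
    (hi : ¬ Rc ρ (inv i) (b i) (b (!i))) :
    Dfct ρ (minv inv b i) (mb inv b i) e ∧ Cover G ρ (minv inv b i) (mb inv b i) e ∧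
    (Finset.univ.filter (fun x => Rc ρ (inv i) (e i) x)).card <
      (Finset.univ.filter (fun x => Rc ρ (minv inv b i i) (e i) x)).card := by
  have hbe : Rc ρ (inv i) (b i) (e i) := other_end D.rinv (D.iinv i) D.rne (D.be i) (D.fix i)
  have hbe' := Rc.symm D.rinv (D.iinv i) hbe
  have fb : inv i (b i) = b i := (D.fix i _).2 (Or.inl rfl)
  have fe : inv i (e i) = e i := (D.fix i _).2 (Or.inr rfl)
  have fb' : inv (!i) (b (!i)) = b (!i) := (D.fix (!i) _).2 (Or.inl rfl)
  have n1 : b (!i) ≠ b i := (D.bb i).symm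
  have n2 : b (!i) ≠ e i := fun h => hi (h ▸ hbe)
  have hw : ¬ Rc ρ (inv i) (b i) (inv i (b (!i))) := by
    intro h
    have := h.trans (Rc.bet _)
    rw [D.iinv] at this
    exact hi this
  have n3 : inv i (b (!i)) ≠ b (!i) := by
    intro h
    rcases (D.fix i _).1 h with h | h
    · exact n1 h
    · exact n2 h
  have n4 : inv i (b (!i)) ≠ b i := fun h => hw (by rw [h]; exact Rc.refl _)
  have n5 : inv i (b (!i)) ≠ e i := fun h => hw (by rw [h]; exact hbe)
  have m1 := minv_b (inv := inv) (b := b) i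
  have m2 := minv_b' (inv := inv) n1
  have m3 := minv_w n4 n3
  have m4 := fun x => minv_rest (inv := inv) (b := b) (i := i) (x := x)
  have bcase : ∀ {Q : Bool → Prop}, Q i → Q (!i) → ∀ j, Q j := fun h1 h2 => bool_cases_of i h1 h2
  have cases4 : ∀ {Q : V → Prop}, Q (b i) → Q (b (!i)) → Q (inv i (b (!i))) →
      (∀ x, x ≠ b i → x ≠ b (!i) → x ≠ inv i (b (!i)) → Q x) → ∀ x, Q x := by
    intro Q q1 q2 q3 q4 x
    by_cases h1 : x = b i
    · rw [h1]; exact q1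
    by_cases h2 : x = b (!i)
    · rw [h2]; exact q2
    by_cases h3 : x = inv i (b (!i))
    · rw [h3]; exact q3
    exact q4 x h1 h2 h3
  have hini : ∀ a, minv inv b i i a = inv (!i) a → minv inv b i i a = a := by
    apply cases4
    · rw [m1]; intro h
      have := congrArg (inv (!i)) h
      rw [D.iinv, fb'] at this
      exact this
    · rw [m2, fb']; exact fun h => h
    · rw [m3]; exact fun _ => rfl
    · intro x h1 h2 h3
      rw [m4 x h1 h2 h3]
      exact D.ini i x
  refine ⟨?_, ?_, ?_⟩
  · constructor
    · exact D.rinv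
    · exact D.rne
    · apply bcase
      · apply cases4
        · rw [m1, m2]
        · rw [m2, m1]
        · rw [m3, m3]
        · intro x h1 h2 h3
          rw [m4 x h1 h2 h3, m4, D.iinv]
          · intro h; apply h1; rw [← D.iinv i x, h, fb]
          · intro h; apply h3; rw [← D.iinv i x, h]
          · intro h; apply h2; rw [← D.iinv i x, h, D.iinv]
      · rw [minv_other]; exact D.iinv (!i)
    · apply bcase
      · apply cases4
        · rw [m1]; exact D.rb i
        · rw [m2]; have := D.rb (!i); rwa [Bool.not_not] at this
        · rw [m3]; exact D.rne _
        · intro x h1 h2 h3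
          rw [m4 x h1 h2 h3]; exact D.rni i x
      · rw [minv_other]; exact D.rni (!i)
    · apply bcase
      · rw [minv_other]; exact hini
      · intro a
        rw [Bool.not_not, minv_other]
        intro h
        rw [h]; exact hini a h.symm
    · apply bcase
      · rw [mb_self]
        apply cases4
        · rw [m1]
          exact ⟨fun h => absurd h n1, fun h => by
            rcases h with h | h
            · exact absurd h.symm n4
            · exact absurd h (D.be i)⟩
        · rw [m2]
          exact ⟨fun h => absurd h.symm n1, fun h => by
            rcases h with h | h
            · exact absurd h.symm n3
            · exact absurd h n2⟩
        · rw [m3]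
          exact ⟨fun _ => Or.inl rfl, fun _ => rfl⟩
        · intro x h1 h2 h3
          rw [m4 x h1 h2 h3, D.fix]
          tauto
      · rw [minv_other, mb_other]; exact D.fix (!i)
    · apply bcase
      · rw [mb_self]; exact n5
      · rw [mb_other]; exact D.be (!i)
    · apply bcase
      · rw [mb_self, mb_other]; exact n3
      · rw [Bool.not_not, mb_self, mb_other]; exact n3.symm
    · exact D.ee
    · apply bcase
      · rw [mb_self, mb_other]
        intro h
        apply D.rni i (b (!i))
        rw [← h, D.rinv]
        exact h.symm ▸ rfl
      · rw [Bool.not_not, mb_self, mb_other]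
        exact D.rni i _
    · apply bcase
      · rw [mb_self, mb_other]
        exact fun h => n2 h.2
      · rw [Bool.not_not, mb_self, mb_other]
        exact fun h => n2 h.1
  · intro u v huv
    rcases C u v huv with h | ⟨j, h⟩ | ⟨j, h1, h2⟩ | h
    · exact Or.inl h
    · have : j = i ∨ j = !i := by cases i <;> cases j <;> simp
      rcases this with rfl | rfl
      · by_cases h1 : u = b j
        · exfalso
          rw [h1, fb] at h
          exact huv.ne (h1.trans h.symm)
        by_cases h2 : u = b (!j)
        · right; right; left
          refine ⟨!j, ?_, ?_⟩
          · rw [mb_other]; exact h2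
          · rw [Bool.not_not, mb_self, h, h2]
        by_cases h3 : u = inv j (b (!j))
        · right; right; left
          refine ⟨j, ?_, ?_⟩
          · rw [mb_self]; exact h3
          · rw [mb_other, h, h3, D.iinv]
        · right; left
          exact ⟨j, by rw [m4 u h1 h2 h3]; exact h⟩
      · right; left
        exact ⟨!i, by rw [minv_other]; exact h⟩
    · have : j = i ∨ j = !i := by cases i <;> cases j <;> simp
      rcases this with rfl | rfl
      · right; left
        exact ⟨j, by rw [h1, m1, h2]⟩
      · right; left
        refine ⟨i, by rw [h1, m2, h2, Bool.not_not]⟩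
    · exact Or.inr (Or.inr (Or.inr h))
  · apply Finset.card_lt_card
    have hsub : ∀ x, Rc ρ (inv i) (e i) x → Rc ρ (minv inv b i i) (e i) x := by
      intro x hx
      have := hx (fun y => Rc ρ (minv inv b i i) (e i) y ∧ Rc ρ (inv i) (e i) y) ?_ ?_
        ⟨Rc.refl _, Rc.refl _⟩
      · exact this.1
      · rintro y ⟨h1, h2⟩
        exact ⟨h1.trans (Rc.rho y), h2.trans (Rc.rho y)⟩
      · rintro y ⟨h1, h2⟩
        refine ⟨?_, h2.trans (Rc.bet y)⟩
        by_cases hy : y = b i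
        · rw [hy, fb, ← hy]; exact h1
        · have := m4 y hy (fun h => hi (by rw [← h]; exact hbe.trans h2))
            (fun h => hw (by rw [← h]; exact hbe.trans h2))
          rw [← this]
          exact h1.trans (Rc.bet y)
    rw [Finset.ssubset_iff_of_subset]
    · refine ⟨b (!i), ?_, ?_⟩
      · simp only [Finset.mem_filter, Finset.mem_univ, true_and]
        rw [← m1]
        exact (hsub _ hbe').trans (Rc.bet _)
      · simp only [Finset.mem_filter, Finset.mem_univ, true_and]
        exact fun h => hi (hbe.trans h)
    · intro x
      simp only [Finset.mem_filter, Finset.mem_univ, true_and]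
      exact hsub x

theorem exists_max [Fintype V] {G : SimpleGraph V} (D : Dfct ρ inv b e) (C : Cover G ρ inv b e) :
    ∃ inv b, Dfct ρ inv b e ∧ Cover G ρ inv b e ∧ ∀ i, Rc ρ (inv i) (b i) (b (!i)) := by
  let m : (Bool → V → V) → ℕ := fun inv =>
    (Finset.univ.filter (fun x => Rc ρ (inv true) (e true) x)).card +
    (Finset.univ.filter (fun x => Rc ρ (inv false) (e false) x)).card
  have hm : ∀ inv, m inv ≤ 2 * Fintype.card V := by
    intro inv
    have h1 := Finset.card_le_univ (Finset.univ.filter (fun x => Rc ρ (inv true) (e true) x))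
    have h2 := Finset.card_le_univ (Finset.univ.filter (fun x => Rc ρ (inv false) (e false) x))
    show _ + _ ≤ _
    omega
  suffices h : ∀ n inv b, 2 * Fintype.card V - m inv ≤ n → Dfct ρ inv b e → Cover G ρ inv b e →
      ∃ inv b, Dfct ρ inv b e ∧ Cover G ρ inv b e ∧ ∀ i, Rc ρ (inv i) (b i) (b (!i)) from
    h _ inv b le_rfl D C
  intro n
  induction n with
  | zero =>
    intro inv b hn D C
    refine ⟨inv, b, D, C, ?_⟩
    by_contra hc
    push Not at hc
    obtain ⟨i, hi⟩ := hc
    have h1 := (move D C i hi).2.2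
    have h2 := hm (minv inv b i)
    have h3 : m inv < m (minv inv b i) := by
      cases i
      · have := minv_other (inv := inv) (b := b) false
        simp only [Bool.not_false] at this
        simp only [m, this]; omega
      · have := minv_other (inv := inv) (b := b) true
        simp only [Bool.not_true] at this
        simp only [m, this]; omega
    omega
  | succ n ih =>
    intro inv b hn D C
    by_cases hc : ∀ i, Rc ρ (inv i) (b i) (b (!i))
    · exact ⟨inv, b, D, C, hc⟩
    push Not at hc
    obtain ⟨i, hi⟩ := hc
    have h0 := move D C i hi
    have h1 := h0.2.2
    have h3 : m inv < m (minv inv b i) := by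
      cases i
      · have := minv_other (inv := inv) (b := b) false
        simp only [Bool.not_false] at this
        simp only [m, this]; omega
      · have := minv_other (inv := inv) (b := b) true
        simp only [Bool.not_true] at this
        simp only [m, this]; omega
    exact ih _ _ (by omega) h0.1 h0.2.1

theorem conn_draw [Fintype V] {G : SimpleGraph V} (D : Dfct ρ inv b e) (C : Cover G ρ inv b e)
    (hG : ∀ P : V → Prop, (∀ u v, G.Adj u v → P u → P v) → ∀ x y, P x → P y) :
    ∃ k : Bool → V → ℤ, IsRACDrawing G (place k) ∧
      ∀ i a, -(2 * (Fintype.card V : ℤ)) ≤ k i a ∧ k i a ≤ 3 * Fintype.card V := by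
  obtain ⟨inv, b, D, C, hmax⟩ := exists_max D C
  obtain ⟨k, L, P⟩ := exists_layout D hmax (by
    intro P h1 h2 h3 x
    have hcl : ∀ i x y, Rc ρ (inv i) x y → P x → P y := fun i x y h => h P h1 (h2 i)
    have hb : ∀ i, P (b i) := by
      intro i
      cases i
      · exact h3
      · exact hcl false _ _ (hmax false) h3
    have he : ∀ i, P (e i) := fun i =>
      hcl i _ _ (other_end D.rinv (D.iinv i) D.rne (D.be i) (D.fix i)) (hb i)
    refine hG P ?_ (b false) x h3
    intro u v huv hu
    rcases C u v huv with rfl | ⟨i, rfl⟩ | ⟨i, rfl, rfl⟩ | ⟨i, rfl, rfl⟩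
    · exact h1 _ hu
    · exact h2 i _ hu
    · exact hb _
    · exact he _)
  refine ⟨k, draw_of_layout D C L P, ?_⟩
  intro i a
  have hp := P.pos
  have h1 := P.kb i
  have h2 := P.ke i
  by_cases ha : a = b i
  · subst ha; omega
  by_cases ha' : a = e i
  · subst ha'; omega
  have := P.inner i a ha ha'
  omega

end move

section initial

/-- Cyclic enumeration of a component of a 2-regular graph. -/
lemma cyc_enum {V : Type} [Fintype V] (H : SimpleGraph V)
    (h2 : ∀ v, (H.neighborSet v).ncard = 2) (c : H.ConnectedComponent) :
    ∃ (m : ℕ) (g : ℕ → V), 3 ≤ m ∧ c.supp.ncard = m ∧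
      (∀ j k, j < m → k < m → g j = g k → j = k) ∧
      (∀ v, H.connectedComponentMk v = c ↔ ∃ k, k < m ∧ g k = v) ∧
      (∀ j k, j < m → k < m → (H.Adj (g j) (g k) ↔
        k = j + 1 ∨ j = k + 1 ∨ (j = 0 ∧ k + 1 = m) ∨ (k = 0 ∧ j + 1 = m))) := by
  obtain ⟨v, hv⟩ := c.nonempty_supp
  have hc : H.IsCycles := fun v _ => h2 v
  obtain ⟨p, hp, hps⟩ := hc.exists_cycle_toSubgraph_verts_eq_connectedComponentSupp hv
    (Set.nonempty_of_ncard_ne_zero (by rw [h2]; norm_num))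
  have hinj : ∀ j k, j < p.length → k < p.length → p.getVert j = p.getVert k → j = k := by
    intro j k hj hk h
    exact hp.getVert_injOn' (by simp; omega) (by simp; omega) h
  have hmem : ∀ v, H.connectedComponentMk v = c ↔ ∃ k, k < p.length ∧ p.getVert k = v := by
    intro w
    have h1 : H.connectedComponentMk w = c ↔ w ∈ p.toSubgraph.verts := by
      rw [hps]; rfl
    rw [h1, SimpleGraph.Walk.mem_verts_toSubgraph, SimpleGraph.Walk.mem_support_iff_exists_getVert]
    constructor
    · rintro ⟨n, hn, hl⟩
      rcases hl.lt_or_eq with hl | hl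
      · exact ⟨n, hl, hn⟩
      · refine ⟨0, by have := hp.three_le_length; omega, ?_⟩
        subst hl
        simpa using hn
    · rintro ⟨k, hk, h⟩
      exact ⟨k, h, hk.le⟩
  refine ⟨p.length, p.getVert, hp.three_le_length, ?_, hinj, hmem, ?_⟩
  · have : c.supp = p.getVert '' (Set.Iio p.length) := by
      ext w
      rw [SimpleGraph.ConnectedComponent.mem_supp_iff, hmem]
      simp
    have hio : Set.InjOn p.getVert (Set.Iio p.length) := fun j hj k hk h => hinj j k hj hk h
    rw [this, hio.ncard_image]
    rw [← Finset.coe_Iio, Set.ncard_coe_finset]; simp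
  · have key : ∀ j k, j < p.length → k < p.length → p.getVert (j+1) = p.getVert k →
        k = j + 1 ∨ (k = 0 ∧ j + 1 = p.length) := by
      intro j k hj hk h
      by_cases hjl : j + 1 < p.length
      · left; exact (hinj _ _ hjl hk h).symm
      · right
        have : j + 1 = p.length := by omega
        refine ⟨?_, this⟩
        rw [this] at h
        have h0 : p.getVert 0 = p.getVert k := by simpa using h
        exact (hinj 0 k (by omega) hk h0).symm
    intro j k hj hk
    have hjv : p.getVert j ∈ p.toSubgraph.verts := by
      rw [SimpleGraph.Walk.mem_verts_toSubgraph]; exact p.getVert_mem_support j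
    rw [← hp.adj_toSubgraph_iff_of_isCycles hc hjv, SimpleGraph.Walk.toSubgraph_adj_iff]
    constructor
    · rintro ⟨i, hi, hl⟩
      rw [Sym2.eq_iff] at hi
      rcases hi with ⟨h1, h3⟩ | ⟨h1, h3⟩
      · have := hinj _ _ hl hj h1
        subst this
        have := key i k hl hk h3
        omega
      · have := hinj _ _ hl hk h1
        subst this
        have := key i j hl hj h3
        omega
    · rintro (h | h | ⟨h, h'⟩ | ⟨h, h'⟩)
      · exact ⟨j, by rw [h], hj⟩
      · exact ⟨k, by rw [h]; exact Sym2.eq_swap, hk⟩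
      · refine ⟨k, ?_, hk⟩
        rw [h', h]; simp [Sym2.eq_swap]
      · refine ⟨j, ?_, hj⟩
        rw [h', h]; simp

/-- Index version of the blue and green pairings on a cycle of length `m`. -/
def idxInv (i : Bool) (m k : ℕ) : ℕ :=
  if i then
    if k % 2 = 1 then (if k + 1 < m then k + 1 else 0)
    else if k = 0 then (if m % 2 = 0 then m - 1 else 0) else k - 1
  else
    if k % 2 = 0 then (if k + 1 < m then k + 1 else k) else k - 1

/-- Index of the fixed point on an odd cycle. -/
def idxFix (i : Bool) (m : ℕ) : ℕ := if i then 0 else m - 1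

lemma idxInv_lt {i m k} (hm : 3 ≤ m) (h : k < m) : idxInv i m k < m := by
  cases i <;> simp only [idxInv] <;> split_ifs <;> omega

lemma idxInv_inv {i m k} (hm : 3 ≤ m) (h : k < m) : idxInv i m (idxInv i m k) = k := by
  cases i <;> simp only [idxInv] <;> split_ifs <;> first | omega | contradiction

lemma idxInv_ne {i m k} (hm : 3 ≤ m) (h : k < m) (h' : idxInv i m k = idxInv (!i) m k) :
    idxInv i m k = k := by
  cases i <;> simp [idxInv] at h' ⊢ <;> split_ifs at h' ⊢ <;> omega

lemma idxInv_fix {i m k} (hm : 3 ≤ m) (h : k < m) :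
    idxInv i m k = k ↔ (m % 2 = 1 ∧ k = idxFix i m) := by
  cases i <;> simp [idxInv, idxFix] <;> split_ifs <;> omega

lemma idxInv_adj {i m k} (hm : 3 ≤ m) (h : k < m) (h' : idxInv i m k ≠ k) :
    idxInv i m k = k + 1 ∨ k = idxInv i m k + 1 ∨ (k = 0 ∧ idxInv i m k + 1 = m) ∨
      (idxInv i m k = 0 ∧ k + 1 = m) := by
  cases i <;> simp [idxInv] at h' ⊢ <;> split_ifs at h' ⊢ <;> omega

lemma idxInv_cover {m j k} (hm : 3 ≤ m) (hj : j < m) (hk : k < m)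
    (h : k = j + 1 ∨ j = k + 1 ∨ (j = 0 ∧ k + 1 = m) ∨ (k = 0 ∧ j + 1 = m)) :
    (∃ i, k = idxInv i m j) ∨ (m % 2 = 1 ∧ ∃ i, j = idxFix i m ∧ k = idxFix (!i) m) := by
  by_cases h1 : k = idxInv true m j
  · exact Or.inl ⟨_, h1⟩
  by_cases h2 : k = idxInv false m j
  · exact Or.inl ⟨_, h2⟩
  right
  simp [idxInv] at h1 h2
  simp [idxFix]
  split_ifs at h1 h2 <;> omega

/-- The initial partial colouring. -/
structure Init {V : Type} (H : SimpleGraph V) (inv : Bool → V → V) (b e : Bool → V) : Prop where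
  iinv : ∀ i a, inv i (inv i a) = a
  iadj : ∀ i a, inv i a ≠ a → H.Adj a (inv i a)
  ini : ∀ i a, inv i a = inv (!i) a → inv i a = a
  fix : ∀ i a, inv i a = a ↔ a = b i ∨ a = e i
  be : ∀ i j, b i ≠ e j
  badj : ∀ i, H.Adj (b i) (b (!i))
  eadj : ∀ i, H.Adj (e i) (e (!i))
  cov : ∀ u v, H.Adj u v → (∃ i, v = inv i u) ∨ (∃ i, u = b i ∧ v = b (!i)) ∨
    (∃ i, u = e i ∧ v = e (!i))

lemma exists_init {V : Type} [Fintype V] (H : SimpleGraph V)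
    (h2 : ∀ v, (H.neighborSet v).ncard = 2)
    (ho : {C : H.ConnectedComponent | Odd C.supp.ncard}.ncard = 2) :
    ∃ inv b e, Init H inv b e := by
  obtain ⟨O1, O2, hne, hO⟩ := Set.ncard_eq_two.1 ho
  choose m g hm hcard hinj hmem hadj using cyc_enum H h2
  have hodd : ∀ c, m c % 2 = 1 ↔ c = O1 ∨ c = O2 := by
    intro c
    have : c ∈ {C : H.ConnectedComponent | Odd C.supp.ncard} ↔ c ∈ ({O1, O2} : Set _) := by
      rw [hO]
    simpa [hcard, Nat.odd_iff] using this
  let cm := H.connectedComponentMk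
  have hx : ∀ v, ∃ k, k < m (cm v) ∧ g (cm v) k = v := fun v => (hmem (cm v) v).1 rfl
  choose x hxl hxg using hx
  have hcg : ∀ c k, k < m c → cm (g c k) = c := fun c k hk => (hmem c _).2 ⟨k, hk, rfl⟩
  have hxx : ∀ c k, k < m c → x (g c k) = k := by
    intro c k hk
    have h1 := hcg c k hk
    have h3 := hxl (g c k)
    have h4 := hxg (g c k)
    rw [h1] at h3 h4
    exact hinj c _ _ h3 hk h4
  have hgj : ∀ c c' k k', k < m c → k' < m c' → g c k = g c' k' → c = c' ∧ k = k' := by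
    intro c c' k k' hk hk' h
    exact ⟨by rw [← hcg c k hk, h, hcg c' k' hk'], by rw [← hxx c k hk, h, hxx c' k' hk']⟩
  have hfl : ∀ i c, idxFix i (m c) < m c := by
    intro i c
    have := hm c
    cases i <;> simp [idxFix] <;> omega
  have hba : ∀ c, m c % 2 = 1 → ∀ i, H.Adj (g c (idxFix i (m c))) (g c (idxFix (!i) (m c))) := by
    intro c hc i
    rw [hadj c _ _ (hfl _ _) (hfl _ _)]
    have := hm c
    cases i <;> simp [idxFix] <;> omega
  refine ⟨fun i v => g (cm v) (idxInv i (m (cm v)) (x v)), fun i => g O1 (idxFix i (m O1)),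
    fun i => g O2 (idxFix i (m O2)), ?_, ?_, ?_, ?_, ?_, ?_, ?_, ?_⟩
  · intro i a
    have hl := idxInv_lt (i := i) (hm (cm a)) (hxl a)
    rw [hcg _ _ hl, hxx _ _ hl, idxInv_inv (hm _) (hxl a), hxg]
  · intro i a hne
    have hl := idxInv_lt (i := i) (hm (cm a)) (hxl a)
    have := (hadj (cm a) (x a) _ (hxl a) hl).2 (idxInv_adj (hm _) (hxl a) (by
      intro h
      rw [h, hxg] at hne
      exact hne rfl))
    rwa [hxg] at this
  · intro i a h
    have hl := idxInv_lt (i := i) (hm (cm a)) (hxl a)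
    have hl' := idxInv_lt (i := !i) (hm (cm a)) (hxl a)
    rw [idxInv_ne (hm _) (hxl a) (hinj _ _ _ hl hl' h), hxg]
  · intro i a
    have hl := idxInv_lt (i := i) (hm (cm a)) (hxl a)
    have e1 : g (cm a) (idxInv i (m (cm a)) (x a)) = a ↔ idxInv i (m (cm a)) (x a) = x a := by
      constructor
      · intro h
        exact hinj _ _ _ hl (hxl a) (h.trans (hxg a).symm)
      · intro h; rw [h, hxg]
    rw [e1, idxInv_fix (hm _) (hxl a), hodd]
    constructor
    · rintro ⟨h | h, h'⟩
      · left; rw [← h, ← h', hxg]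
      · right; rw [← h, ← h', hxg]
    · rintro (h | h)
      · have h3 : cm a = O1 := by rw [h]; exact hcg _ _ (hfl _ _)
        refine ⟨Or.inl h3, ?_⟩
        rw [h3]
        have := hxx _ _ (hfl i O1)
        rw [← h] at this; exact this
      · have h3 : cm a = O2 := by rw [h]; exact hcg _ _ (hfl _ _)
        refine ⟨Or.inr h3, ?_⟩
        rw [h3]
        have := hxx _ _ (hfl i O2)
        rw [← h] at this; exact this
  · intro i j h
    exact hne (hgj _ _ _ _ (hfl _ _) (hfl _ _) h).1
  · exact hba O1 ((hodd _).2 (Or.inl rfl))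
  · exact hba O2 ((hodd _).2 (Or.inr rfl))
  · intro u v huv
    have hc : cm v = cm u := (SimpleGraph.ConnectedComponent.sound huv.reachable).symm
    have hxv := hxl v
    have hgv := hxg v
    rw [hc] at hxv hgv
    have h3 := (hadj (cm u) (x u) (x v) (hxl u) hxv).1 (by rw [hxg, hgv]; exact huv)
    rcases idxInv_cover (hm _) (hxl u) hxv h3 with ⟨i, hi⟩ | ⟨ho, i, h4, h5⟩
    · left
      exact ⟨i, by rw [← hi, hgv]⟩
    · right
      rcases (hodd _).1 ho with h | h
      · left
        exact ⟨i, by rw [← h, ← h4, hxg], by rw [← h, ← h5, hgv]⟩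
      · right
        exact ⟨i, by rw [← h, ← h4, hxg], by rw [← h, ← h5, hgv]⟩

end initial

section comps

/-- The initial colouring together with the perfect matching `ρ`. -/
structure Init2 {V : Type} (G H : SimpleGraph V) (ρ : V → V) (inv : Bool → V → V)
    (b e : Bool → V) : Prop extends Init H inv b e where
  rinv : ∀ a, ρ (ρ a) = a
  radj : ∀ a, G.Adj a (ρ a)
  rnadj : ∀ a, ¬ H.Adj a (ρ a)
  sub : ∀ a c, H.Adj a c → G.Adj a c
  gadj : ∀ a c, G.Adj a c → c = ρ a ∨ H.Adj a c

lemma exists_init2 {V : Type} [Fintype V] (G : SimpleGraph V)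
    (h3 : ∀ v : V, vdeg G v = 3) (hO : HasOddness G 2) :
    ∃ H ρ inv b e, Init2 G H ρ inv b e := by
  obtain ⟨⟨F, ⟨hF, hF2⟩, hodd⟩, -⟩ := hO
  let H := SimpleGraph.fromEdgeSet F
  have hsub : ∀ a c, H.Adj a c → G.Adj a c := by
    intro a c h
    exact hF ((SimpleGraph.fromEdgeSet_adj F).1 h).1
  have h2 : ∀ v, (H.neighborSet v).ncard = 2 := by
    intro v
    rw [← hF2 v]
    have : {e ∈ F | v ∈ e} = (fun w => s(v, w)) '' (H.neighborSet v) := by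
      ext e
      constructor
      · rintro ⟨he, hv⟩
        obtain ⟨w, rfl⟩ := hv
        have : G.Adj v w := hF he
        exact ⟨w, (SimpleGraph.fromEdgeSet_adj F).2 ⟨he, this.ne⟩, rfl⟩
      · rintro ⟨w, hw, rfl⟩
        exact ⟨((SimpleGraph.fromEdgeSet_adj F).1 hw).1, by simp⟩
    rw [this, Set.InjOn.ncard_image]
    intro x _ y _ h
    exact Sym2.congr_right.1 h
  obtain ⟨inv, b, e, I⟩ := exists_init H h2 hodd
  have h1 : ∀ v, ∃ w, G.neighborSet v \ H.neighborSet v = {w} := by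
    intro v
    have hs : H.neighborSet v ⊆ G.neighborSet v := fun w hw => hsub v w hw
    rw [← Set.ncard_eq_one, Set.ncard_sdiff hs, h2]
    have := h3 v
    unfold vdeg at this
    omega
  choose ρ hρ using h1
  have hr : ∀ a c, c = ρ a ↔ G.Adj a c ∧ ¬ H.Adj a c := by
    intro a c
    have : c ∈ G.neighborSet a \ H.neighborSet a ↔ c ∈ ({ρ a} : Set V) := by rw [hρ]
    simpa using this.symm
  refine ⟨H, ρ, inv, b, e, I, ?_, ?_, ?_, hsub, ?_⟩
  · intro a
    have := (hr a _).1 rfl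
    exact ((hr (ρ a) a).2 ⟨this.1.symm, fun h => this.2 h.symm⟩).symm
  · exact fun a => ((hr a _).1 rfl).1
  · exact fun a => ((hr a _).1 rfl).2
  · intro a c h
    by_cases hc : H.Adj a c
    · exact Or.inr hc
    · exact Or.inl ((hr a c).2 ⟨h, hc⟩)

/-- Drawing one connected component. -/
lemma comp_draw {V : Type} [Fintype V] {G H : SimpleGraph V} {ρ : V → V} {inv : Bool → V → V}
    {b e : Bool → V} (I : Init2 G H ρ inv b e) (W : G.ConnectedComponent) :
    ∃ k : Bool → {v // G.connectedComponentMk v = W} → ℤ,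
      IsRACDrawing (G.comap (Subtype.val : {v // G.connectedComponentMk v = W} → V)) (place k) ∧
      ∀ i a, -(2 * (Fintype.card {v // G.connectedComponentMk v = W} : ℤ)) ≤ k i a ∧
        k i a ≤ 3 * Fintype.card {v // G.connectedComponentMk v = W} := by
  let S := {v // G.connectedComponentMk v = W}
  have hext : ∀ x y : S, x = y ↔ x.1 = y.1 := fun x y => Subtype.ext_iff
  have hadj : ∀ u v, G.Adj u v → G.connectedComponentMk u = W → G.connectedComponentMk v = W := by
    intro u v h hu
    rw [← hu]
    exact (SimpleGraph.ConnectedComponent.sound h.reachable).symm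
  have hconn : ∀ P : S → Prop,
      (∀ u v, (G.comap (Subtype.val : S → V)).Adj u v → P u → P v) → ∀ x y, P x → P y := by
    intro P hP x y hx
    have hr : G.Reachable x.1 y.1 := by
      apply SimpleGraph.ConnectedComponent.exact
      rw [x.2, y.2]
    obtain ⟨w⟩ := hr
    have key : ∀ (u v : V) (w : G.Walk u v) (hu : G.connectedComponentMk u = W)
        (hv : G.connectedComponentMk v = W), P ⟨u, hu⟩ → P ⟨v, hv⟩ := by
      intro u v w
      induction w with
      | nil => intro _ _ h; exact h
      | cons h w ih =>
        intro hu hv hp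
        exact ih (hadj _ _ h hu) hv (hP ⟨_, hu⟩ ⟨_, hadj _ _ h hu⟩ h hp)
    exact key _ _ w x.2 y.2 hx
  have hrS : ∀ a, G.connectedComponentMk a = W → G.connectedComponentMk (ρ a) = W :=
    fun a ha => hadj _ _ (I.radj a) ha
  have hiS : ∀ i a, G.connectedComponentMk a = W → G.connectedComponentMk (inv i a) = W := by
    intro i a ha
    by_cases h : inv i a = a
    · rw [h]; exact ha
    · exact hadj _ _ (I.sub _ _ (I.iadj i a h)) ha
  let ρ' : S → S := fun a => ⟨ρ a.1, hrS _ a.2⟩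
  let inv' : Bool → S → S := fun i a => ⟨inv i a.1, hiS i _ a.2⟩
  have hrne : ∀ a, ρ a ≠ a := fun a => (I.radj a).ne.symm
  have hrni : ∀ i a, ρ a ≠ inv i a := by
    intro i a h
    by_cases h' : inv i a = a
    · exact hrne a (h.trans h')
    · have := I.iadj i a h'
      rw [← h] at this
      exact I.rnadj a this
  have hbn : ∀ i, b i ≠ b (!i) := fun i => (I.badj i).ne
  have hen : ∀ i, e i ≠ e (!i) := fun i => (I.eadj i).ne
  -- both special pairs lie in the component, or neither
  have hbb : ∀ i j, G.connectedComponentMk (b i) = W → G.connectedComponentMk (b j) = W := by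
    intro i j h
    exact bool_cases_of (P := fun j => G.connectedComponentMk (b j) = W) i h
      (hadj _ _ (I.sub _ _ (I.badj i)) h) j
  have hee : ∀ i j, G.connectedComponentMk (e i) = W → G.connectedComponentMk (e j) = W := by
    intro i j h
    exact bool_cases_of (P := fun j => G.connectedComponentMk (e j) = W) i h
      (hadj _ _ (I.sub _ _ (I.eadj i)) h) j
  have hpar : G.connectedComponentMk (b false) = W ↔ G.connectedComponentMk (e false) = W := by
    have := even_fixed (ρ := ρ) (β := inv false)
      (Finset.univ.filter (fun v => G.connectedComponentMk v = W)) I.rinv (I.iinv false) hrne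
      (by intro a ha; simp at ha ⊢; exact hrS a ha)
      (by intro a ha; simp at ha ⊢; exact hiS false a ha)
    by_contra hcon
    have h1 : (Finset.filter (fun a => inv false a = a)
        (Finset.univ.filter (fun v => G.connectedComponentMk v = W))).card = 1 := by
      rw [Finset.card_eq_one]
      by_cases hb : G.connectedComponentMk (b false) = W
      · refine ⟨b false, ?_⟩
        ext v
        simp only [Finset.mem_filter, Finset.mem_univ, true_and, Finset.mem_singleton, I.fix]
        constructor
        · rintro ⟨h, rfl | rfl⟩
          · rfl
          · tauto
        · rintro rfl
          exact ⟨hb, Or.inl rfl⟩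
      · refine ⟨e false, ?_⟩
        ext v
        simp only [Finset.mem_filter, Finset.mem_univ, true_and, Finset.mem_singleton, I.fix]
        constructor
        · rintro ⟨h, rfl | rfl⟩
          · tauto
          · rfl
        · rintro rfl
          exact ⟨by tauto, Or.inr rfl⟩
    rw [h1] at this
    exact absurd this (by decide)
  by_cases hb : G.connectedComponentMk (b false) = W
  · have he := hpar.1 hb
    let b' : Bool → S := fun i => ⟨b i, hbb false i hb⟩
    let e' : Bool → S := fun i => ⟨e i, hee false i he⟩
    refine conn_draw (ρ := ρ') (inv := inv') (b := b') (e := e') ?_ ?_ hconn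
    · constructor
      · intro a; exact Subtype.ext (I.rinv _)
      · intro a h; exact hrne _ (congrArg Subtype.val h)
      · intro i a; exact Subtype.ext (I.iinv i _)
      · intro i a h; exact hrni i _ (congrArg Subtype.val h)
      · intro i a h; exact Subtype.ext (I.ini i _ (congrArg Subtype.val h))
      · intro i a
        simp only [hext]
        exact I.fix i a.1
      · intro i h; exact I.be i i (congrArg Subtype.val h)
      · intro i h; exact hbn i (congrArg Subtype.val h)
      · intro i h; exact hen i (congrArg Subtype.val h)
      · intro i h
        have h : ρ (b i) = b (!i) := congrArg Subtype.val h
        apply I.rnadj (b i)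
        rw [h]
        exact I.badj i
      · intro i h; exact I.be i (!i) (congrArg Subtype.val h.1)
    · intro u v huv
      simp only [hext]
      rcases I.gadj _ _ huv with h | h
      · exact Or.inl h
      · exact Or.inr (I.cov _ _ h)
  · have he : ¬ G.connectedComponentMk (e false) = W := fun h => hb (hpar.2 h)
    have hnf : ∀ i (a : S), inv i a.1 ≠ a.1 := by
      intro i a h
      rcases (I.fix i _).1 h with h | h
      · exact hb (hbb i false (h ▸ a.2))
      · exact he (hee i false (h ▸ a.2))
    have hcov : ∀ u v : S, G.Adj u v → v = ρ' u ∨ ∃ i, v = inv' i u := by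
      intro u v huv
      simp only [hext]
      rcases I.gadj _ _ huv with h | h
      · exact Or.inl h
      · rcases I.cov _ _ h with h | ⟨i, h, -⟩ | ⟨i, h, -⟩
        · exact Or.inr h
        · exact absurd (hbb i false (h ▸ u.2)) hb
        · exact absurd (hee i false (h ▸ u.2)) he
    obtain ⟨v0, hv0⟩ := W.nonempty_supp
    let v : S := ⟨v0, hv0⟩
    have hii : ∀ i a, inv' i (inv' i a) = a := fun i a => Subtype.ext (I.iinv i _)
    have hne : ∀ i a, inv' i a ≠ a := fun i a h => hnf i a (congrArg Subtype.val h)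
    have hri : ∀ i a, ρ' a ≠ inv' i a := fun i a h => hrni i _ (congrArg Subtype.val h)
    have hij : ∀ i a, inv' i a ≠ inv' (!i) a := by
      intro i a h
      exact hne i a (Subtype.ext (I.ini i _ (congrArg Subtype.val h)))
    have hrr : ∀ a, ρ' (ρ' a) = a := fun a => Subtype.ext (I.rinv _)
    have hrn : ∀ a, ρ' a ≠ a := fun a h => hrne _ (congrArg Subtype.val h)
    let nv : Bool → S → S := fun i a => if a = v ∨ a = inv' i v then a else inv' i a
    have hst : ∀ i a, ¬ (a = v ∨ a = inv' i v) → ¬ (inv' i a = v ∨ inv' i a = inv' i v) := by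
      intro i a h h'
      apply h
      rcases h' with h' | h'
      · right; rw [← h', hii]
      · left; rw [← hii i a, h', hii]
    refine conn_draw (ρ := ρ') (inv := nv) (b := fun i => if i then v else inv' false v)
      (e := fun i => if i then inv' true v else v) ?_ ?_ hconn
    · constructor
      · exact hrr
      · exact hrn
      · intro i a
        by_cases h : a = v ∨ a = inv' i v
        · simp only [nv, if_pos h]
        · simp only [nv, if_neg h, if_neg (hst i a h), hii]
      · intro i a
        by_cases h : a = v ∨ a = inv' i v
        · simp only [nv, if_pos h]; exact hrn a
        · simp only [nv, if_neg h]; exact hri i a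
      · intro i a hh
        by_cases h : a = v ∨ a = inv' i v
        · simp only [nv, if_pos h]
        · by_cases h' : a = v ∨ a = inv' (!i) v
          · simp only [nv, if_neg h, if_pos h'] at hh
            exact absurd hh (hne i a)
          · simp only [nv, if_neg h, if_neg h'] at hh
            exact absurd hh (hij i a)
      · intro i a
        have : nv i a = a ↔ (a = v ∨ a = inv' i v) := by
          by_cases h : a = v ∨ a = inv' i v
          · simp only [nv, if_pos h, h]
          · simp only [nv, if_neg h, h, iff_false]; exact hne i a
        rw [this]
        cases i
        · simp [or_comm]
        · simp
      · intro i
        cases i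
        · simpa using hne false v
        · simpa using (hne true v).symm
      · intro i
        cases i
        · simpa using hne false v
        · simpa using (hne false v).symm
      · intro i
        cases i
        · simpa using (hne true v).symm
        · simpa using hne true v
      · intro i
        cases i
        · simp only [Bool.not_false, if_true]
          intro h
          have h : ρ' (inv' false v) = v := h
          exact hri false v (by rw [← hrr (inv' false v), h])
        · exact hri false v
      · intro i h
        cases i
        · exact hij false v h.1
        · exact hij true v h.2.symm
    · intro u w huw
      rcases hcov u w huw with h | ⟨i, h⟩
      · exact Or.inl h
      · right
        by_cases hu : u = v ∨ u = inv' i v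
        · right
          have h' : (u = v ∧ w = inv' i v) ∨ (u = inv' i v ∧ w = v) := by
            rcases hu with hu | hu
            · left; exact ⟨hu, by rw [h, hu]⟩
            · right; exact ⟨hu, by rw [h, hu, hii]⟩
          cases i
          · left
            rcases h' with ⟨h1, h2⟩ | ⟨h1, h2⟩
            · exact ⟨true, by simpa using h1, by simpa using h2⟩
            · exact ⟨false, by simpa using h1, by simpa using h2⟩
          · right
            rcases h' with ⟨h1, h2⟩ | ⟨h1, h2⟩
            · exact ⟨false, by simpa using h1, by simpa using h2⟩
            · exact ⟨true, by simpa using h1, by simpa using h2⟩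
        · left
          exact ⟨i, by simp only [nv, if_neg hu]; exact h⟩

end comps

section combine

/-- Placing the drawings of the components next to each other. -/
lemma combine_draw {V : Type} [Fintype V] (G : SimpleGraph V)
    (hd : ∀ W : G.ConnectedComponent, ∃ k : Bool → {v // G.connectedComponentMk v = W} → ℤ,
      IsRACDrawing (G.comap (Subtype.val : {v // G.connectedComponentMk v = W} → V)) (place k) ∧
      ∀ i a, -(2 * (Fintype.card {v // G.connectedComponentMk v = W} : ℤ)) ≤ k i a ∧
        k i a ≤ 3 * Fintype.card {v // G.connectedComponentMk v = W}) :
    ∃ p : V → Pt, IsRACDrawing G p ∧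
      InGridSquare (6 * (Fintype.card V : ℝ)) (Set.range p) := by
  choose k hk hkb using hd
  let cm := G.connectedComponentMk
  obtain ⟨N, ⟨f⟩⟩ := Finite.exists_equiv_fin G.ConnectedComponent
  let lo : G.ConnectedComponent → ℕ := fun W =>
    (Finset.univ.filter (fun v => f (cm v) < f W)).card
  let sz : G.ConnectedComponent → ℕ := fun W => (Finset.univ.filter (fun v => cm v = W)).card
  have hsz : ∀ W, Fintype.card {v // G.connectedComponentMk v = W} = sz W := by
    intro W
    rw [Fintype.card_subtype]
  have hpos : ∀ v, 0 < sz (cm v) := by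
    intro v
    exact Finset.card_pos.2 ⟨v, by simp⟩
  have hlt : ∀ W W', f W < f W' → lo W + sz W ≤ lo W' := by
    intro W W' h
    rw [← Finset.card_union_of_disjoint]
    · apply Finset.card_le_card
      intro v hv
      simp only [Finset.mem_union, Finset.mem_filter, Finset.mem_univ, true_and] at hv ⊢
      rcases hv with hv | hv
      · exact hv.trans h
      · rw [hv]; exact h
    · rw [Finset.disjoint_left]
      intro v hv hv'
      simp only [Finset.mem_filter, Finset.mem_univ, true_and] at hv hv'
      rw [hv'] at hv
      exact lt_irrefl _ hv
  have htot : ∀ W, lo W + sz W ≤ Fintype.card V := by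
    intro W
    rw [← Finset.card_union_of_disjoint]
    · exact Finset.card_le_univ _
    · rw [Finset.disjoint_left]
      intro v hv hv'
      simp only [Finset.mem_filter, Finset.mem_univ, true_and] at hv hv'
      rw [hv'] at hv
      exact lt_irrefl _ hv
  simp only [hsz] at hkb
  let sh : G.ConnectedComponent → Pt := fun W => (((6 * lo W + 2 * sz W : ℤ) : ℝ), 0)
  let p : V → Pt := fun v => sh (cm v) + place (k (cm v)) ⟨v, rfl⟩
  have hp : ∀ W v (h : cm v = W), p v = sh W + place (k W) ⟨v, h⟩ := by
    intro W v h
    subst h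
    rfl
  have hx : ∀ v, (6 * lo (cm v) : ℝ) ≤ crd true (p v) ∧
      crd true (p v) ≤ 6 * lo (cm v) + 5 * sz (cm v) := by
    intro v
    obtain ⟨h1, h2⟩ := hkb (cm v) true ⟨v, rfl⟩
    have h1' : (-(2 * (sz (cm v) : ℝ))) ≤ ((k (cm v) true ⟨v, rfl⟩ : ℤ) : ℝ) := by exact_mod_cast h1
    have h2' : ((k (cm v) true ⟨v, rfl⟩ : ℤ) : ℝ) ≤ 3 * (sz (cm v) : ℝ) := by exact_mod_cast h2
    simp only [crd, p, sh, place, if_true, Prod.fst_add]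
    push_cast
    constructor <;> linarith
  have hseg : ∀ u v z, cm u = cm v → z ∈ segment ℝ (p u) (p v) →
      (6 * lo (cm u) : ℝ) ≤ crd true z ∧ crd true z ≤ 6 * lo (cm u) + 5 * sz (cm u) := by
    intro u v z h hz
    have h1 := hx u
    have h2 := hx v
    rw [← h] at h2
    exact ⟨seg_crd_ge hz true h1.1 h2.1, seg_crd_le hz true h1.2 h2.2⟩
  have hsep : ∀ u v u' v' z, cm u = cm v → cm u' = cm v' → z ∈ segment ℝ (p u) (p v) →
      z ∈ segment ℝ (p u') (p v') → cm u = cm u' := by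
    intro u v u' v' z h h' hz hz'
    have h1 := hseg u v z h hz
    have h2 := hseg u' v' z h' hz'
    by_contra hne
    have hp1 : (0:ℝ) < sz (cm u) := by exact_mod_cast hpos u
    have hp2 : (0:ℝ) < sz (cm u') := by exact_mod_cast hpos u'
    rcases lt_trichotomy (f (cm u)) (f (cm u')) with hl | hl | hl
    · have : (lo (cm u) + sz (cm u) : ℝ) ≤ lo (cm u') := by exact_mod_cast hlt _ _ hl
      linarith
    · exact hne (f.injective hl)
    · have : (lo (cm u') + sz (cm u') : ℝ) ≤ lo (cm u) := by exact_mod_cast hlt _ _ hl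
      linarith
  have hcadj : ∀ u v, G.Adj u v → cm u = cm v :=
    fun u v h => SimpleGraph.ConnectedComponent.sound h.reachable
  have hback : ∀ W u v z (hu : cm u = W) (hv : cm v = W), z ∈ segment ℝ (p u) (p v) →
      -sh W + z ∈ segment ℝ (place (k W) ⟨u, hu⟩) (place (k W) ⟨v, hv⟩) := by
    intro W u v z hu hv hz
    rw [hp W u hu, hp W v hv] at hz
    rw [← mem_segment_translate ℝ (sh W)]
    simpa using hz
  refine ⟨p, ⟨?_, ?_, ?_, ?_⟩, ?_, ?_⟩
  · intro u v h
    have hc : cm v = cm u := hsep v v u u (p u) rfl rfl (by rw [h]; exact left_mem_segment ℝ _ _)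
      (left_mem_segment ℝ _ _)
    rw [hp (cm u) u rfl, hp (cm u) v hc] at h
    exact congrArg Subtype.val ((hk (cm u)).inj (add_left_cancel h))
  · intro u v w huv hwu hwv hm
    have hc : cm w = cm u := hsep w w u v (p w) rfl (hcadj u v huv) (left_mem_segment ℝ _ _) hm
    have := hback (cm u) u v _ rfl (hcadj u v huv).symm hm
    rw [hp (cm u) w hc, neg_add_cancel_left] at this
    exact (hk (cm u)).vertex_off ⟨u, rfl⟩ ⟨v, (hcadj u v huv).symm⟩ ⟨w, hc⟩ huv
      (fun h => hwu (congrArg Subtype.val h)) (fun h => hwv (congrArg Subtype.val h)) this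
  · rintro u v w huv huw hvw z ⟨hz, hz'⟩
    have h1 := hback (cm u) u v _ rfl (hcadj u v huv).symm hz
    have h2 := hback (cm u) u w _ rfl (hcadj u w huw).symm hz'
    have := (hk (cm u)).shared ⟨u, rfl⟩ ⟨v, (hcadj u v huv).symm⟩ ⟨w, (hcadj u w huw).symm⟩ huv huw
      (fun h => hvw (congrArg Subtype.val h)) ⟨h1, h2⟩
    rw [Set.mem_singleton_iff] at this ⊢
    rw [hp (cm u) u rfl, ← this]
    simp
  · rintro u v u' v' huv huv' h1 h2 h3 h4 ⟨z, hz, hz'⟩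
    have hcv := (hcadj u v huv).symm
    have hc : cm u' = cm u :=
      (hsep u v u' v' z (hcadj u v huv) (hcadj u' v' huv') hz hz').symm
    have hc' : cm v' = cm u := (hcadj u' v' huv').symm.trans hc
    have g1 := hback (cm u) u v _ rfl hcv hz
    have g2 := hback (cm u) u' v' _ hc hc' hz'
    have := (hk (cm u)).rac ⟨u, rfl⟩ ⟨v, hcv⟩ ⟨u', hc⟩ ⟨v', hc'⟩ huv huv'
      (fun h => h1 (congrArg Subtype.val h)) (fun h => h2 (congrArg Subtype.val h))
      (fun h => h3 (congrArg Subtype.val h)) (fun h => h4 (congrArg Subtype.val h)) ⟨_, g1, g2⟩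
    rw [hp (cm u) u rfl, hp (cm u) v hcv, hp (cm u) u' hc, hp (cm u) v' hc']
    simpa [SegOrth] using this
  · rintro q ⟨v, rfl⟩
    refine ⟨6 * lo (cm v) + 2 * sz (cm v) + k (cm v) true ⟨v, rfl⟩, k (cm v) false ⟨v, rfl⟩, ?_⟩
    apply Prod.ext <;> simp [p, sh, place]
  · refine ⟨0, -(2 * (Fintype.card V : ℝ)), ?_⟩
    rintro q ⟨v, rfl⟩
    have h1 := hx v
    simp only [crd, if_true] at h1
    have ht : (lo (cm v) + sz (cm v) : ℝ) ≤ Fintype.card V := by exact_mod_cast htot (cm v)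
    have hl0 : (0:ℝ) ≤ lo (cm v) := Nat.cast_nonneg _
    have hs0 : (0:ℝ) ≤ sz (cm v) := Nat.cast_nonneg _
    obtain ⟨h3, h4⟩ := hkb (cm v) false ⟨v, rfl⟩
    have h3' : (-(2 * (sz (cm v) : ℝ))) ≤ ((k (cm v) false ⟨v, rfl⟩ : ℤ) : ℝ) := by
      exact_mod_cast h3
    have h4' : ((k (cm v) false ⟨v, rfl⟩ : ℤ) : ℝ) ≤ 3 * (sz (cm v) : ℝ) := by exact_mod_cast h4
    have hy : (p v).2 = ((k (cm v) false ⟨v, rfl⟩ : ℤ) : ℝ) := by simp [p, sh, place]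
    rw [hy]
    refine ⟨by linarith, by linarith, by linarith, by linarith⟩

end combine

/-- There is an absolute constant `c` such that every bridgeless
3-regular graph with oddness 2 on `n` vertices admits a straight-line RAC drawing with
all vertices on integer grid points inside a square of side `c * n`
(i.e. of `O(n²)` area). -/
theorem stmt4 :
    ∃ c : ℝ, 0 < c ∧
      ∀ (V : Type) [Fintype V] (G : SimpleGraph V),
        (∀ v : V, vdeg G v = 3) → Bridgeless G → HasOddness G 2 →
        ∃ p : V → Pt, IsRACDrawing G p ∧
          InGridSquare (c * (Fintype.card V : ℝ)) (Set.range p) := by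

  refine ⟨6, by norm_num, ?_⟩
  intro V _ G h3 _ hO
  obtain ⟨H, ρ, inv, b, e, I⟩ := exists_init2 G h3 hO
  exact combine_draw G (fun W => comp_draw I W)
end
end

section
/- Let G = (V,E) be an undirected simple graph with maximum degree Δ and let d = ⌈Δ/2⌉. Then there exists a directed multigraph G' = (V,E'), where E' is a finite multiset of ordered pairs of vertices, such that: (1) every vertex of G' has in-degree exactly d and out-degree exactly d; (2) G is a subgraph of the underlying undirected graph of G', i.e., for every edge {u,v} ∈ E at least one of (u,v) or (v,u) occurs in E'; and (3) E' can be partitioned into d edge-disjoint directed 2-factors, i.e., d sub-multisets in each of which every vertex has in-degree exactly 1 and out-degree exactly 1. -/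
open scoped Classical

noncomputable section

/-- A `d`-regular nonnegative integer matrix is covered by `d` permutations. -/
theorem perm_cover {V : Type} [Fintype V] (d : ℕ) : ∀ (A : V → V → ℕ)
    (_ : ∀ u, ∑ v, A u v = d) (_ : ∀ v, ∑ u, A u v = d),
    ∃ σ : Fin d → Equiv.Perm V, ∀ u v, 0 < A u v → ∃ i, σ i u = v := by
  induction d with
  | zero =>
    intro A hr hc
    refine ⟨fun i => i.elim0, fun u v h => ?_⟩
    have := (Finset.sum_eq_zero_iff.1 (hr u)) v (Finset.mem_univ v)
    omega
  | succ d ih =>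
    intro A hr hc
    have hall := (Finset.all_card_le_biUnion_card_iff_exists_injective
      (fun u : V => Finset.univ.filter (fun v => 0 < A u v))).1 (by
        intro S
        set N := S.biUnion (fun u : V => Finset.univ.filter (fun v => 0 < A u v)) with hN
        have h1 : S.card * (d + 1) = ∑ u ∈ S, ∑ v ∈ N, A u v := by
          rw [← smul_eq_mul, ← Finset.sum_const]
          refine Finset.sum_congr rfl fun u hu => ?_
          rw [← hr u]
          symm
          refine Finset.sum_subset (Finset.subset_univ _) fun v _ hv => ?_
          by_contra hne
          exact hv (Finset.mem_biUnion.2 ⟨u, hu, by simpa using Nat.pos_of_ne_zero hne⟩)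
        have h2 : ∑ u ∈ S, ∑ v ∈ N, A u v ≤ N.card * (d + 1) := by
          rw [Finset.sum_comm, ← smul_eq_mul, ← Finset.sum_const]
          refine Finset.sum_le_sum fun v _ => ?_
          rw [← hc v]
          exact Finset.sum_le_sum_of_subset (Finset.subset_univ _)
        exact Nat.le_of_mul_le_mul_right (h1 ▸ h2) (Nat.succ_pos d))
    obtain ⟨f, hf, hfA⟩ := hall
    have hbij : Function.Bijective f := Finite.injective_iff_bijective.1 hf
    let τ : Equiv.Perm V := Equiv.ofBijective f hbij
    have hτ : ∀ u, 0 < A u (τ u) := fun u => (Finset.mem_filter.1 (hfA u)).2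
    have key : ∀ u v, A u v = (A u v - if τ u = v then 1 else 0) + if τ u = v then 1 else 0 := by
      intro u v
      split_ifs with h
      · have := hτ u
        rw [h] at this
        omega
      · simp
    obtain ⟨σ, hσ⟩ := ih (fun u v => A u v - if τ u = v then 1 else 0)
      (by
        intro u
        have := hr u
        rw [Finset.sum_congr rfl (fun v _ => key u v), Finset.sum_add_distrib] at this
        simpa using this)
      (by
        intro v
        have := hc v
        rw [Finset.sum_congr rfl (fun u _ => key u v), Finset.sum_add_distrib] at this
        have h1 : ∑ u, (if τ u = v then 1 else 0) = 1 := by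
          rw [Equiv.sum_comp τ (fun w => if w = v then 1 else 0)]
          simp
        rw [h1] at this
        simpa using this)
    refine ⟨Fin.cons τ σ, fun u v h => ?_⟩
    by_cases hv : τ u = v
    · exact ⟨0, by simpa using hv⟩
    · obtain ⟨i, hi⟩ := hσ u v (by simpa [hv] using h)
      exact ⟨i.succ, by simpa using hi⟩

/-- Every `2d`-regular multigraph has an orientation with all in/out-degrees `d`. -/
theorem balanced_orient {V E : Type} [Fintype V] [Fintype E] (d : ℕ) (s t : E → V)
    (h : ∀ v, (∑ e, if s e = v then 1 else 0) + (∑ e, if t e = v then 1 else 0) = 2 * d) :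
    ∃ a b : E → V, (∀ e, (a e = s e ∧ b e = t e) ∨ (a e = t e ∧ b e = s e)) ∧
      (∀ v, (∑ e, if a e = v then 1 else 0) = d) ∧
      (∀ v, (∑ e, if b e = v then 1 else 0) = d) := by
  have hall := (Finset.all_card_le_biUnion_card_iff_exists_injective
    (fun e : E => (({s e, t e} : Finset V) ×ˢ (Finset.univ : Finset (Fin d))))).1 (by
      intro S
      set N : Finset V := S.biUnion (fun e => {s e, t e}) with hN
      have hb : S.biUnion (fun e : E => (({s e, t e} : Finset V) ×ˢ
          (Finset.univ : Finset (Fin d)))) = N ×ˢ Finset.univ := by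
        ext x
        simp [hN]
      rw [hb, Finset.card_product, Finset.card_univ, Fintype.card_fin]
      have h1 : ∀ g : E → V, (∀ e ∈ S, g e ∈ N) →
          S.card ≤ ∑ v ∈ N, ∑ e, if g e = v then 1 else 0 := by
        intro g hg
        rw [Finset.sum_comm, Finset.card_eq_sum_ones]
        calc ∑ e ∈ S, 1 ≤ ∑ e ∈ S, ∑ v ∈ N, (if g e = v then 1 else 0) := by
              refine Finset.sum_le_sum fun e he => ?_
              simp [hg e he]
          _ ≤ _ := Finset.sum_le_sum_of_subset (Finset.subset_univ _)
      have hs := h1 s (fun e he => Finset.mem_biUnion.2 ⟨e, he, by simp⟩)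
      have ht := h1 t (fun e he => Finset.mem_biUnion.2 ⟨e, he, by simp⟩)
      have h2 := Finset.sum_congr (rfl : N = N) (fun v _ => h v)
      rw [Finset.sum_add_distrib, Finset.sum_const, smul_eq_mul] at h2
      nlinarith)
  obtain ⟨f, hf, hfm⟩ := hall
  have tot : ∀ g : E → V, ∑ v, (∑ e, if g e = v then 1 else 0) = Fintype.card E := by
    intro g
    rw [Finset.sum_comm]
    simp
  have hcard : Fintype.card E = Fintype.card (V × Fin d) := by
    have h2 := Finset.sum_congr (rfl : (Finset.univ : Finset V) = Finset.univ) (fun v _ => h v)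
    rw [Finset.sum_add_distrib, Finset.sum_const, smul_eq_mul, tot, tot, Finset.card_univ] at h2
    rw [Fintype.card_prod, Fintype.card_fin]
    nlinarith
  have hbij := (Fintype.bijective_iff_injective_and_card f).2 ⟨hf, hcard⟩
  let F := Equiv.ofBijective f hbij
  have ha : ∀ v, (∑ e, if (f e).1 = v then 1 else 0) = d := by
    intro v
    have := Equiv.sum_comp F (fun x => if x.1 = v then 1 else 0)
    refine this.trans ?_
    rw [Fintype.sum_prod_type, Finset.sum_eq_single v (fun w _ hw => by simp [hw]) (by simp)]
    simp
  have hor : ∀ e, (f e).1 = s e ∨ (f e).1 = t e := by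
    intro e
    simpa using hfm e
  have hE : ∀ e, ((f e).1 = s e ∧ (if (f e).1 = s e then t e else s e) = t e) ∨
      ((f e).1 = t e ∧ (if (f e).1 = s e then t e else s e) = s e) := by
    intro e
    by_cases hh : (f e).1 = s e
    · left; simp [hh]
    · right; exact ⟨(hor e).resolve_left hh, by simp [hh]⟩
  refine ⟨fun e => (f e).1, fun e => if (f e).1 = s e then t e else s e, hE, ha, ?_⟩
  intro v
  have h3 : (∑ e, if (f e).1 = v then 1 else 0) +
      (∑ e, if (if (f e).1 = s e then t e else s e) = v then 1 else 0) = 2 * d := by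
    rw [← h v, ← Finset.sum_add_distrib, ← Finset.sum_add_distrib]
    refine Finset.sum_congr rfl fun e _ => ?_
    rcases hE e with ⟨h1, h2⟩ | ⟨h1, h2⟩
    · rw [h2, h1]
    · rw [h2, h1, add_comm]
  have := ha v
  simp only
  omega

/-- A graph of maximum degree at most `2d` sits in a `2d`-regular multigraph. -/
theorem regular_ext {V : Type} [Fintype V] (G : SimpleGraph V) (d : ℕ)
    (hdeg : ∀ v : V, vdeg G v ≤ 2 * d) :
    ∃ (E : Type) (_ : Fintype E) (s t : E → V),
      (∀ v, (∑ e, if s e = v then 1 else 0) + (∑ e, if t e = v then 1 else 0) = 2 * d) ∧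
      ∀ u v, G.Adj u v → ∃ e, (s e = u ∧ t e = v) ∨ (s e = v ∧ t e = u) := by
  have hvd : ∀ v, vdeg G v = G.degree v := by
    intro v
    rw [vdeg, ← SimpleGraph.card_neighborSet_eq_degree, ← Nat.card_coe_set_eq,
      Nat.card_eq_fintype_card]
  have hout : ∀ e : Sym2 V, s(e.out.1, e.out.2) = e := fun e => by
    rw [Sym2.mk, Prod.mk.eta]; exact e.out_eq
  let s0 : G.edgeSet → V := fun e => e.1.out.1
  let t0 : G.edgeSet → V := fun e => e.1.out.2
  have h0 : ∀ v, (∑ e, if s0 e = v then 1 else 0) + (∑ e, if t0 e = v then 1 else 0)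
      = G.degree v := by
    intro v
    rw [← Finset.sum_add_distrib, ← SimpleGraph.card_incidenceFinset_eq_degree,
      SimpleGraph.incidenceFinset_eq_filter, Finset.card_filter]
    rw [Finset.sum_subtype G.edgeFinset (p := fun e => e ∈ G.edgeSet) (by simp)]
    refine Finset.sum_congr rfl fun e _ => ?_
    obtain ⟨e, he⟩ := e
    have h1 := hout e
    have hne : e.out.1 ≠ e.out.2 := by
      have h2 := he
      rw [← h1] at h2
      exact G.ne_of_adj h2
    have hm : v ∈ e ↔ e.out.1 = v ∨ e.out.2 = v := by
      conv_lhs => rw [← h1]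
      rw [Sym2.mem_iff]
      exact or_congr eq_comm eq_comm
    simp only [s0, t0, hm]
    by_cases ha : e.out.1 = v
    · have hb : e.out.2 ≠ v := fun hb => hne (ha.trans hb.symm)
      simp [ha, hb]
    · by_cases hb : e.out.2 = v <;> simp [ha, hb]
  have htot : ∑ v, G.degree v = 2 * Fintype.card G.edgeSet := by
    rw [SimpleGraph.sum_degrees_eq_twice_card_edges, SimpleGraph.edgeFinset_card]
  let H := Σ v : V, Fin (2 * d - G.degree v)
  have hH : ∃ k, Fintype.card H = k * 2 := by
    have h1 : Fintype.card H + ∑ v, G.degree v = Fintype.card V * (2 * d) := by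
      simp only [H, Fintype.card_sigma, Fintype.card_fin]
      rw [← Finset.sum_add_distrib, ← Finset.card_univ, ← smul_eq_mul (Finset.card _), ← Finset.sum_const]
      refine Finset.sum_congr rfl fun v _ => ?_
      have := hdeg v
      rw [hvd] at this
      omega
    rw [htot] at h1
    refine ⟨Fintype.card V * d - Fintype.card G.edgeSet, ?_⟩
    have : Fintype.card V * (2 * d) = 2 * (Fintype.card V * d) := by ring
    omega
  obtain ⟨k, hk⟩ := hH
  have eqv : Fin k × Bool ≃ H := Fintype.equivOfCardEq (by simp [hk])
  refine ⟨G.edgeSet ⊕ Fin k, inferInstance, Sum.elim s0 (fun j => (eqv (j, true)).1),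
    Sum.elim t0 (fun j => (eqv (j, false)).1), ?_, ?_⟩
  · intro v
    have h2 : (∑ j, if (eqv (j, true)).1 = v then 1 else 0) +
        (∑ j, if (eqv (j, false)).1 = v then 1 else 0) = 2 * d - G.degree v := by
      rw [← Finset.sum_add_distrib]
      have := Equiv.sum_comp eqv (fun x => if x.1 = v then 1 else 0)
      rw [Fintype.sum_prod_type] at this
      simp only [Fintype.sum_bool] at this
      rw [this, Fintype.sum_sigma, Finset.sum_eq_single v (fun w _ hw => by simp [hw]) (by simp)]
      simp
    have h3 := h0 v
    have h4 := hdeg v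
    rw [hvd] at h4
    rw [Fintype.sum_sum_type, Fintype.sum_sum_type]
    change ((∑ e, if s0 e = v then 1 else 0) + (∑ j, if (eqv (j, true)).1 = v then 1 else 0)) +
      ((∑ e, if t0 e = v then 1 else 0) + (∑ j, if (eqv (j, false)).1 = v then 1 else 0)) = 2 * d
    omega
  · intro u v huv
    refine ⟨Sum.inl ⟨s(u, v), huv⟩, ?_⟩
    have := hout s(u, v)
    rw [Sym2.eq_iff] at this
    exact this

/-- Eades–Symvonis–Whitesides. Let `G` be an undirected simple graph
of maximum degree `Δ` and `d = ⌈Δ/2⌉`. Then there is a directed multigraph `E'` on the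
same vertices (a multiset of ordered pairs) such that (1) every vertex has in-degree and
out-degree exactly `d`; (2) for every edge `{u,v}` of `G`, `(u,v)` or `(v,u)` occurs in
`E'`; and (3) `E'` is the disjoint (multiset) union of `d` directed 2-factors, each
giving every vertex in-degree 1 and out-degree 1. -/
theorem stmt7 (V : Type) [Fintype V] (G : SimpleGraph V) (Δ : ℕ)
    (hdeg : ∀ v : V, vdeg G v ≤ Δ) :
    ∃ E' : Multiset (V × V),
      (∀ v : V, E'.countP (fun e => e.2 = v) = (Δ + 1) / 2 ∧
                E'.countP (fun e => e.1 = v) = (Δ + 1) / 2) ∧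
      (∀ u v : V, G.Adj u v → (u, v) ∈ E' ∨ (v, u) ∈ E') ∧
      (∃ parts : Fin ((Δ + 1) / 2) → Multiset (V × V),
        E' = ∑ i, parts i ∧
        ∀ (i : Fin ((Δ + 1) / 2)) (v : V),
          (parts i).countP (fun e => e.2 = v) = 1 ∧
          (parts i).countP (fun e => e.1 = v) = 1) := by
  obtain ⟨E, _, s, t, hreg, hcov⟩ := regular_ext G ((Δ + 1) / 2)
    (fun v => (hdeg v).trans (by omega))
  obtain ⟨a, b, hab, ha, hb⟩ := balanced_orient _ s t hreg
  obtain ⟨σ, hσ⟩ := perm_cover ((Δ + 1) / 2)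
    (fun u v => ∑ e, if a e = u ∧ b e = v then 1 else 0)
    (by
      intro u
      rw [Finset.sum_comm, ← ha u]
      refine Finset.sum_congr rfl fun e _ => ?_
      by_cases h : a e = u <;> simp [h])
    (by
      intro v
      rw [Finset.sum_comm, ← hb v]
      refine Finset.sum_congr rfl fun e _ => ?_
      by_cases h : b e = v <;> simp [h])
  have hσ' : ∀ e, ∃ i, σ i (a e) = b e := by
    intro e
    apply hσ
    refine Finset.sum_pos' (fun _ _ => Nat.zero_le _) ⟨e, Finset.mem_univ e, by simp⟩
  let parts : Fin ((Δ + 1) / 2) → Multiset (V × V) :=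
    fun i => (Finset.univ : Finset V).val.map (fun u => (u, σ i u))
  have hparts : ∀ (i : Fin ((Δ + 1) / 2)) (v : V),
          (parts i).countP (fun e => e.2 = v) = 1 ∧
          (parts i).countP (fun e => e.1 = v) = 1 := by
    intro i v
    constructor
    · simp only [parts, Multiset.countP_map]
      change (Finset.univ.filter (fun u => σ i u = v)).card = 1
      rw [Finset.card_eq_one]
      exact ⟨(σ i).symm v, by ext; simp [Equiv.eq_symm_apply]⟩
    · simp only [parts, Multiset.countP_map]
      change (Finset.univ.filter (fun u => u = v)).card = 1
      rw [Finset.card_eq_one]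
      exact ⟨v, by ext; simp⟩
  have hcount : ∀ (p : V × V → Prop), (∀ i, (parts i).countP p = 1) →
      (∑ i, parts i).countP p = (Δ + 1) / 2 := by
    intro p hp
    have := map_sum (Multiset.countPAddMonoidHom p) parts Finset.univ
    simp only [Multiset.coe_countPAddMonoidHom] at this
    rw [this, Finset.sum_congr rfl (fun i _ => hp i)]
    simp
  have hmem : ∀ i u, (u, σ i u) ∈ ∑ i, parts i := by
    intro i u
    rw [Multiset.mem_sum]
    exact ⟨i, Finset.mem_univ i, Multiset.mem_map.2 ⟨u, Finset.mem_univ u, rfl⟩⟩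
  refine ⟨∑ i, parts i, fun v => ⟨hcount _ fun i => (hparts i v).1,
    hcount _ fun i => (hparts i v).2⟩, ?_, parts, rfl, hparts⟩
  intro u v huv
  obtain ⟨e, he⟩ := hcov u v huv
  obtain ⟨i, hi⟩ := hσ' e
  have hm := hmem i (a e)
  rw [hi] at hm
  rcases hab e with ⟨h1, h2⟩ | ⟨h1, h2⟩ <;> rcases he with ⟨h3, h4⟩ | ⟨h3, h4⟩ <;>
    rw [h1, h2, h3, h4] at hm <;> tauto
end
end

section
/- Let G be a connected finite simple graph in which every vertex has degree 2 or 3, and suppose the edge set of G is partitioned into three matchings M1, M2, M3. Let H_y be the spanning subgraph of G with edge set M1 ∪ M2 and H_x the spanning subgraph with edge set M2 ∪ M3. Define the auxiliary bipartite graph 𝓗 whose vertices are the connected components of H_y together with the connected components of H_x, with an edge between a component of H_y and a component of H_x if and only if they share at least one vertex of G. Then 𝓗 is connected. -/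
open scoped Classical

noncomputable section

/-- The relation on components of `Hy` and `Hx` (as a disjoint sum): a component of
`Hy` is related to a component of `Hx` iff they share a vertex. -/
def auxCompRel {V : Type*} (Hy Hx : SimpleGraph V) :
    (Hy.ConnectedComponent ⊕ Hx.ConnectedComponent) →
    (Hy.ConnectedComponent ⊕ Hx.ConnectedComponent) → Prop
  | Sum.inl a, Sum.inr b => ∃ v, v ∈ a.supp ∧ v ∈ b.supp
  | _, _ => False

/-- The auxiliary bipartite graph `𝓗` whose vertices are the connected components of
`Hy` and of `Hx`, two components being adjacent iff they share at least one vertex. -/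
def auxGraph {V : Type*} (Hy Hx : SimpleGraph V) :
    SimpleGraph (Hy.ConnectedComponent ⊕ Hx.ConnectedComponent) :=
  SimpleGraph.fromRel (auxCompRel Hy Hx)

/-- For a connected graph `G` with all degrees 2 or 3 whose edge set is
partitioned into three matchings `M1, M2, M3`, the auxiliary bipartite graph on the
components of `H_y` (edge set `M1 ∪ M2`) and of `H_x` (edge set `M2 ∪ M3`), joining two
components iff they share a vertex, is connected. -/
theorem stmt8 (V : Type) [Fintype V] (G : SimpleGraph V)
    (hconn : G.Connected)
    (hdeg : ∀ v : V, vdeg G v = 2 ∨ vdeg G v = 3)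
    (M1 M2 M3 : Set (Sym2 V))
    (h1 : IsMatchingOn G M1) (h2 : IsMatchingOn G M2) (h3 : IsMatchingOn G M3)
    (h12 : Disjoint M1 M2) (h13 : Disjoint M1 M3) (h23 : Disjoint M2 M3)
    (hunion : M1 ∪ M2 ∪ M3 = G.edgeSet) :
    (auxGraph (SimpleGraph.fromEdgeSet (M1 ∪ M2))
        (SimpleGraph.fromEdgeSet (M2 ∪ M3))).Connected := by
  set Hy := SimpleGraph.fromEdgeSet (M1 ∪ M2) with hHy
  set Hx := SimpleGraph.fromEdgeSet (M2 ∪ M3) with hHx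
  have hadj : ∀ v : V, (auxGraph Hy Hx).Adj (Sum.inl (Hy.connectedComponentMk v))
      (Sum.inr (Hx.connectedComponentMk v)) := by
    intro v
    unfold auxGraph
    rw [SimpleGraph.fromRel_adj]
    exact ⟨by simp, Or.inl ⟨v, rfl, rfl⟩⟩
  have hstep : ∀ u v : V, G.Adj u v → (auxGraph Hy Hx).Reachable
      (Sum.inl (Hy.connectedComponentMk u)) (Sum.inl (Hy.connectedComponentMk v)) := by
    intro u v huv
    have hmem : s(u, v) ∈ M1 ∪ M2 ∪ M3 := by
      rw [hunion]
      exact huv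
    by_cases hy : s(u, v) ∈ M1 ∪ M2
    · have hA : Hy.Adj u v := (SimpleGraph.fromEdgeSet_adj _).2 ⟨hy, huv.ne⟩
      rw [SimpleGraph.ConnectedComponent.sound hA.reachable]
    · have hm3 : s(u, v) ∈ M3 := hmem.resolve_left hy
      have hA : Hx.Adj u v := (SimpleGraph.fromEdgeSet_adj _).2 ⟨Or.inr hm3, huv.ne⟩
      have hu := (hadj u).reachable
      rw [SimpleGraph.ConnectedComponent.sound hA.reachable] at hu
      exact hu.trans (hadj v).reachable.symm
  have hwalk : ∀ u v : V, G.Walk u v → (auxGraph Hy Hx).Reachable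
      (Sum.inl (Hy.connectedComponentMk u)) (Sum.inl (Hy.connectedComponentMk v)) := by
    intro u v p
    induction p with
    | nil => exact SimpleGraph.Reachable.refl _
    | cons h _ ih => exact (hstep _ _ h).trans ih
  obtain ⟨w⟩ := hconn.nonempty
  have hall : ∀ x, (auxGraph Hy Hx).Reachable (Sum.inl (Hy.connectedComponentMk w)) x := by
    rintro (a | b)
    · induction a using SimpleGraph.ConnectedComponent.ind with
      | _ v => exact (hconn.preconnected w v).elim (hwalk w v)
    · induction b using SimpleGraph.ConnectedComponent.ind with
      | _ v => exact ((hconn.preconnected w v).elim (hwalk w v)).trans (hadj v).reachable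
  exact (SimpleGraph.connected_iff_exists_forall_reachable _).2 ⟨_, hall⟩
end
end

section
/- Let G be a bridgeless 3-regular graph with oddness k ≥ 2. Then there exists a perfect matching M1 of G such that the spanning subgraph F = G ∖ M1 (with edge set E(G) ∖ M1) is a 2-factor having exactly k components that are odd cycles c_1, …, c_k; moreover, for every choice of edges e_1, …, e_k with e_i an edge of the odd cycle c_i, the edge set of F can be partitioned into three matchings M2, M3, M4 with M4 = {e_1, …, e_k} (so |M4| = k). In particular, the edge set of G decomposes into four matchings M1, M2, M3, M4 where M1 is perfect and |M4| = k. -/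
open scoped Classical

noncomputable section

theorem cycle_getVert_eq {V : Type} {H : SimpleGraph V} {v : V} {p : H.Walk v v}
    (hp : p.IsCycle) {i j : ℕ} (hi : i ≤ p.length) (hj : j ≤ p.length)
    (h : p.getVert i = p.getVert j) :
    i = j ∨ (i = 0 ∧ j = p.length) ∨ (i = p.length ∧ j = 0) := by
  have h3 := hp.three_le_length
  have hn : p.getVert p.length = p.getVert 0 := by simp
  have key : ∀ a b : ℕ, 1 ≤ a → a ≤ p.length → 1 ≤ b → b ≤ p.length →
      p.getVert a = p.getVert b → a = b :=
    fun a b h1 h2 h3 h4 h5 => hp.getVert_injOn ⟨h1, h2⟩ ⟨h3, h4⟩ h5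
  rcases Nat.eq_zero_or_pos i with rfl | hi0
  · rcases Nat.eq_zero_or_pos j with rfl | hj0
    · simp
    · have := key p.length j (by omega) le_rfl hj0 hj (hn.trans h)
      omega
  · rcases Nat.eq_zero_or_pos j with rfl | hj0
    · have := key i p.length hi0 hi (by omega) le_rfl (h.trans hn.symm)
      omega
    · exact Or.inl (key i j hi0 hi hj0 hj h)

theorem component_coloring {V : Type} [Fintype V] (H : SimpleGraph V)
    (hreg : ∀ v : V, (H.neighborSet v).ncard = 2) (C : H.ConnectedComponent) (s : Sym2 V)
    (hs : Odd C.supp.ncard → s ∈ H.edgeSet ∧ ∀ v ∈ s, v ∈ C.supp) :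
    ∃ c : Sym2 V → Prop, ∀ e ∈ H.edgeSet, ∀ f ∈ H.edgeSet, e ≠ f →
      ∀ w ∈ C.supp, w ∈ e → w ∈ f → (Odd C.supp.ncard → e ≠ s ∧ f ≠ s) →
      (c e ↔ ¬ c f) := by
  have hcyc : H.IsCycles := fun v _ => hreg v
  have hne : ∀ v, (H.neighborSet v).Nonempty := fun v =>
    Set.nonempty_of_ncard_ne_zero (by rw [hreg v]; norm_num)
  -- pick the starting vertex on the selected edge
  obtain ⟨v, hvC, hvs⟩ : ∃ v ∈ C.supp, Odd C.supp.ncard → v ∈ s := by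
    by_cases ho : Odd C.supp.ncard
    · induction s using Sym2.ind with
      | _ a b => exact ⟨a, (hs ho).2 a (by simp), fun _ => by simp⟩
    · obtain ⟨v, hv⟩ := C.nonempty_supp
      exact ⟨v, hv, fun h => absurd h ho⟩
  obtain ⟨p, hp, hpv⟩ :=
    hcyc.exists_cycle_toSubgraph_verts_eq_connectedComponentSupp hvC (hne v)
  have h3 := hp.three_le_length
  -- every edge touching the component is an edge of the cycle
  have hedge : ∀ e ∈ H.edgeSet, ∀ w ∈ C.supp, w ∈ e →
      ∃ i < p.length, e = s(p.getVert i, p.getVert (i + 1)) := by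
    intro e he w hw hwe
    obtain ⟨x, rfl⟩ := Sym2.mem_iff_exists.mp hwe
    have hws : w ∈ p.support := by rw [← p.mem_verts_toSubgraph, hpv]; exact hw
    have heq : p.toSubgraph.neighborSet w = H.neighborSet w := by
      apply Set.eq_of_subset_of_ncard_le (p.toSubgraph.neighborSet_subset w)
      rw [hreg, hp.ncard_neighborSet_toSubgraph_eq_two hws]
    have hx : x ∈ p.toSubgraph.neighborSet w := by rw [heq]; exact he
    obtain ⟨i, h1, h2⟩ := p.toSubgraph_adj_iff.mp hx
    exact ⟨i, h2, h1.symm⟩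
  have hcard : C.supp.ncard = p.length := by
    have himg : C.supp = p.getVert '' (Set.Iio p.length) := by
      rw [← hpv]
      ext w
      rw [p.mem_verts_toSubgraph, SimpleGraph.Walk.mem_support_iff_exists_getVert]
      constructor
      · rintro ⟨i, rfl, hi⟩
        rcases hi.lt_or_eq with h | rfl
        · exact ⟨i, h, rfl⟩
        · exact ⟨0, by simp only [Set.mem_Iio]; omega, by simp⟩
      · rintro ⟨i, hi, rfl⟩
        exact ⟨i, rfl, le_of_lt hi⟩
    rw [himg, Set.ncard_image_of_injOn]
    · rw [← Finset.coe_Iio, Set.ncard_coe_finset]; simp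
    · intro i hi j hj hij
      simp only [Set.mem_Iio] at hi hj
      have := cycle_getVert_eq hp hi.le hj.le hij
      omega
  have huniq : ∀ i j, i < p.length → j < p.length →
      s(p.getVert i, p.getVert (i + 1)) = s(p.getVert j, p.getVert (j + 1)) → i = j := by
    intro i j hi hj h
    rcases Sym2.eq_iff.mp h with ⟨h1, -⟩ | ⟨h1, h2⟩
    · have := cycle_getVert_eq hp hi.le hj.le h1
      omega
    · have := cycle_getVert_eq hp hi.le hj h1
      have := cycle_getVert_eq hp hi hj.le h2
      omega
  refine ⟨fun e => ∃ i < p.length, e = s(p.getVert i, p.getVert (i + 1)) ∧ Even i, ?_⟩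
  have hc : ∀ i < p.length, ((∃ idx < p.length, s(p.getVert i, p.getVert (i + 1)) =
      s(p.getVert idx, p.getVert (idx + 1)) ∧ Even idx) ↔ Even i) := by
    intro i hi
    constructor
    · rintro ⟨j, hj, h, he⟩
      rwa [huniq i j hi hj h]
    · intro h
      exact ⟨i, hi, rfl, h⟩
  intro e he f hf hef w hw hwe hwf hsel
  obtain ⟨i, hi, rfl⟩ := hedge e he w hw hwe
  obtain ⟨j, hj, rfl⟩ := hedge f hf w hw hwf
  simp only [hc i hi, hc j hj]
  have hij : i ≠ j := by rintro rfl; exact hef rfl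
  -- if the cycle is odd, the first or the last edge is the selected one
  have hfl : Odd p.length → ¬ (i = 0 ∧ j + 1 = p.length) ∧ ¬ (j = 0 ∧ i + 1 = p.length) := by
    intro ho
    rw [← hcard] at ho
    obtain ⟨k, hk, hks⟩ := hedge s (hs ho).1 v hvC (hvs ho)
    have hkv := hvs ho
    rw [hks, Sym2.mem_iff] at hkv
    have h0 : p.getVert 0 = v := by simp
    have hkk : k = 0 ∨ k + 1 = p.length := by
      rcases hkv with h | h
      · have := cycle_getVert_eq hp (Nat.zero_le _) hk.le (h0.trans h)
        omega
      · have := cycle_getVert_eq hp (Nat.zero_le _) hk (h0.trans h)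
        omega
    have hik : i ≠ k := by rintro rfl; exact (hsel ho).1 hks.symm
    have hjk : j ≠ k := by rintro rfl; exact (hsel ho).2 hks.symm
    omega
  have hadj : i = j + 1 ∨ j = i + 1 ∨ (i = 0 ∧ j + 1 = p.length) ∨
      (j = 0 ∧ i + 1 = p.length) := by
    rw [Sym2.mem_iff] at hwe hwf
    rcases hwe with h1 | h1 <;> rcases hwf with h2 | h2
    · have := cycle_getVert_eq hp hi.le hj.le (h1.symm.trans h2)
      omega
    · have := cycle_getVert_eq hp hi.le hj (h1.symm.trans h2)
      omega
    · have := cycle_getVert_eq hp hi hj.le (h1.symm.trans h2)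
      omega
    · have := cycle_getVert_eq hp hi hj (h1.symm.trans h2)
      omega
  rw [Nat.odd_iff] at hfl
  rw [Nat.even_iff, Nat.even_iff]
  omega

/-- The edges at `v` correspond to the neighbors of `v`. -/
theorem ncard_edges_at {V : Type} [Fintype V] (H : SimpleGraph V) (v : V) :
    {e ∈ H.edgeSet | v ∈ e}.ncard = (H.neighborSet v).ncard := by
  have : {e ∈ H.edgeSet | v ∈ e} = (fun w => s(v, w)) '' H.neighborSet v := by
    ext e
    constructor
    · rintro ⟨he, hv⟩
      obtain ⟨x, rfl⟩ := Sym2.mem_iff_exists.mp hv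
      exact ⟨x, he, rfl⟩
    · rintro ⟨x, hx, rfl⟩
      exact ⟨hx, by simp⟩
  rw [this, Set.ncard_image_of_injective]
  intro a b h
  rcases Sym2.eq_iff.mp h with ⟨-, h⟩ | ⟨h1, h2⟩
  · exact h
  · exact h2.trans h1

theorem factor_coloring {V : Type} [Fintype V] (G : SimpleGraph V) (F : Set (Sym2 V))
    (hF : Is2Factor G F) (sel : (SimpleGraph.fromEdgeSet F).ConnectedComponent → Sym2 V)
    (hsel : ∀ C ∈ oddComps F, sel C ∈ F ∧ ∀ v ∈ sel C, v ∈ C.supp) :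
    ∃ M2 M3 : Set (Sym2 V),
      IsMatchingOn G M2 ∧ IsMatchingOn G M3 ∧
      IsMatchingOn G (sel '' oddComps F) ∧
      Disjoint M2 M3 ∧
      Disjoint M2 (sel '' oddComps F) ∧
      Disjoint M3 (sel '' oddComps F) ∧
      M2 ∪ M3 ∪ sel '' oddComps F = F := by
  obtain ⟨hFG, hdeg⟩ := hF
  have hES : (SimpleGraph.fromEdgeSet F).edgeSet = F := by
    rw [SimpleGraph.edgeSet_fromEdgeSet]
    ext e
    constructor
    · exact fun h => h.1
    · exact fun h => ⟨h, fun hd => G.not_isDiag_of_mem_edgeSet (hFG h) hd⟩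
  have hreg : ∀ v : V, ((SimpleGraph.fromEdgeSet F).neighborSet v).ncard = 2 := by
    intro v
    rw [← ncard_edges_at, hES]
    exact hdeg v
  have hcol := fun C : (SimpleGraph.fromEdgeSet F).ConnectedComponent => component_coloring (SimpleGraph.fromEdgeSet F) hreg C (sel C)
    (fun ho => by rw [hES]; exact hsel C ho)
  choose c hc using hcol
  -- the component of an edge
  have hcomp : ∀ e ∈ F, ∀ x ∈ e, ∀ y ∈ e,
      (SimpleGraph.fromEdgeSet F).connectedComponentMk x = (SimpleGraph.fromEdgeSet F).connectedComponentMk y := by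
    intro e he x hx y hy
    by_cases hxy : x = y
    · rw [hxy]
    · have : e = s(x, y) := (Sym2.mem_and_mem_iff hxy).mp ⟨hx, hy⟩
      rw [← hES, this] at he
      exact SimpleGraph.ConnectedComponent.sound (SimpleGraph.Adj.reachable he)
  have hmemC : ∀ (C : (SimpleGraph.fromEdgeSet F).ConnectedComponent) (w : V), w ∈ C.supp ↔
      (SimpleGraph.fromEdgeSet F).connectedComponentMk w = C := fun C w => Iff.rfl
  let col : Sym2 V → Prop := fun e => ∃ x ∈ e, c ((SimpleGraph.fromEdgeSet F).connectedComponentMk x) e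
  have hcol : ∀ e ∈ F, ∀ w ∈ e, (col e ↔ c ((SimpleGraph.fromEdgeSet F).connectedComponentMk w) e) := by
    intro e he w hw
    constructor
    · rintro ⟨x, hx, h⟩
      rwa [hcomp e he w hw x hx]
    · intro h
      exact ⟨w, hw, h⟩
  have hmain : ∀ e ∈ F, e ∉ sel '' oddComps F → ∀ f ∈ F, f ∉ sel '' oddComps F → e ≠ f →
      ∀ w, w ∈ e → w ∈ f → (col e ↔ ¬ col f) := by
    intro e he hes f hf hfs hef w hwe hwf
    rw [hcol e he w hwe, hcol f hf w hwf]
    refine hc _ e (hES.symm.subset he) f (hES.symm.subset hf) hef w rfl hwe hwf ?_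
    intro ho
    exact ⟨fun h => hes ⟨_, ho, h.symm⟩, fun h => hfs ⟨_, ho, h.symm⟩⟩
  refine ⟨{e ∈ F | e ∉ sel '' oddComps F ∧ col e}, {e ∈ F | e ∉ sel '' oddComps F ∧ ¬ col e},
    ⟨fun e he => hFG he.1, ?_⟩, ⟨fun e he => hFG he.1, ?_⟩, ⟨?_, ?_⟩, ?_, ?_, ?_, ?_⟩
  · rintro e ⟨he, hes, h1⟩ f ⟨hf, hfs, h2⟩ hef w hwe hwf
    exact (hmain e he hes f hf hfs hef w hwe hwf).mp h1 h2
  · rintro e ⟨he, hes, h1⟩ f ⟨hf, hfs, h2⟩ hef w hwe hwf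
    exact h1 ((hmain e he hes f hf hfs hef w hwe hwf).mpr h2)
  · rintro _ ⟨C, hC, rfl⟩
    exact hFG (hsel C hC).1
  · rintro _ ⟨C, hC, rfl⟩ _ ⟨D, hD, rfl⟩ hne w hw hwD
    have h1 := (hmemC C w).mp ((hsel C hC).2 w hw)
    have h2 := (hmemC D w).mp ((hsel D hD).2 w hwD)
    exact hne (by rw [← h1, ← h2])
  · exact Set.disjoint_left.mpr fun e h1 h2 => h2.2.2 h1.2.2
  · exact Set.disjoint_left.mpr fun e h1 h2 => h1.2.1 h2
  · exact Set.disjoint_left.mpr fun e h1 h2 => h1.2.1 h2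
  · ext e
    constructor
    · rintro ((h | h) | ⟨C, hC, rfl⟩)
      · exact h.1
      · exact h.1
      · exact (hsel C hC).1
    · intro he
      by_cases h1 : e ∈ sel '' oddComps F
      · exact Or.inr h1
      · by_cases h2 : col e
        · exact Or.inl (Or.inl ⟨he, h1, h2⟩)
        · exact Or.inl (Or.inr ⟨he, h1, h2⟩)

/-- Let `G` be a bridgeless 3-regular graph with oddness `k ≥ 2`. Then
there is a perfect matching `M1` of `G` such that `F = E(G) \ M1` is a 2-factor with
exactly `k` odd-cycle components; moreover, for every choice `sel` of one edge from each
odd-cycle component of `F`, the edge set `F` can be partitioned into three matchings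
`M2, M3, M4` where `M4` is exactly the set of chosen edges. -/
theorem stmt9 (V : Type) [Fintype V] (G : SimpleGraph V) (k : ℕ)
    (h3reg : ∀ v : V, vdeg G v = 3) (hbr : Bridgeless G)
    (hk : 2 ≤ k) (hodd : HasOddness G k) :
    ∃ M1 : Set (Sym2 V),
      IsMatchingOn G M1 ∧ (∀ v : V, ∃ e ∈ M1, v ∈ e) ∧
      Is2Factor G (G.edgeSet \ M1) ∧
      (oddComps (G.edgeSet \ M1)).ncard = k ∧
      ∀ sel : (SimpleGraph.fromEdgeSet (G.edgeSet \ M1)).ConnectedComponent → Sym2 V,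
        (∀ C ∈ oddComps (G.edgeSet \ M1),
            sel C ∈ G.edgeSet \ M1 ∧ ∀ v ∈ sel C, v ∈ C.supp) →
        ∃ M2 M3 : Set (Sym2 V),
          IsMatchingOn G M2 ∧ IsMatchingOn G M3 ∧
          IsMatchingOn G (sel '' oddComps (G.edgeSet \ M1)) ∧
          Disjoint M2 M3 ∧
          Disjoint M2 (sel '' oddComps (G.edgeSet \ M1)) ∧
          Disjoint M3 (sel '' oddComps (G.edgeSet \ M1)) ∧
          M2 ∪ M3 ∪ sel '' oddComps (G.edgeSet \ M1) = G.edgeSet \ M1 := by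
  obtain ⟨⟨F, hF, hFk⟩, -⟩ := hodd
  have hFF : G.edgeSet \ (G.edgeSet \ F) = F := by
    rw [Set.diff_diff_cancel_left hF.1]
  have hone : ∀ v : V, {e ∈ G.edgeSet \ F | v ∈ e}.ncard = 1 := by
    intro v
    have h1 : {e ∈ G.edgeSet \ F | v ∈ e} = {e ∈ G.edgeSet | v ∈ e} \ {e ∈ F | v ∈ e} := by
      ext e
      simp only [Set.mem_diff, Set.mem_setOf_eq]
      tauto
    have h2 : {e ∈ F | v ∈ e} ⊆ {e ∈ G.edgeSet | v ∈ e} := fun e he => ⟨hF.1 he.1, he.2⟩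
    have h3 : {e ∈ G.edgeSet | v ∈ e}.ncard = 3 := by
      rw [ncard_edges_at]
      exact h3reg v
    rw [h1, Set.ncard_sdiff h2, h3, hF.2 v]
  refine ⟨G.edgeSet \ F, ⟨Set.diff_subset, ?_⟩, ?_, ?_⟩
  · intro e he f hf hef v hve hvf
    obtain ⟨x, hx⟩ := Set.ncard_eq_one.mp (hone v)
    have h1 : e ∈ ({x} : Set (Sym2 V)) := hx ▸ ⟨he, hve⟩
    have h2 : f ∈ ({x} : Set (Sym2 V)) := hx ▸ ⟨hf, hvf⟩
    exact hef (h1.trans h2.symm)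
  · intro v
    obtain ⟨x, hx⟩ := Set.ncard_eq_one.mp (hone v)
    have h1 : x ∈ {e ∈ G.edgeSet \ F | v ∈ e} := hx ▸ rfl
    exact ⟨x, h1.1, h1.2⟩
  · rw [hFF]
    exact ⟨hF, hFk, fun sel hsel => factor_coloring G F hF sel hsel⟩
end
end
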